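/- arXiv:2310.09128 — 3 statements merged into one kernel-verified Lean document; each statement's English description precedes it below -/
import Mathlib

section
/- If G is a connected graph on n vertices that is not an E_4-graph, then the C_4-isolation number of G satisfies ι(G, C_4) ≤ ⌊n/5⌋. -/
open SimpleGraph

/-- The closed neighbourhood `N[D]` of a set `D` of vertices of `G`. -/
def closedNbhd {V : Type*} (G : SimpleGraph V) (D : Set V) : Set V :=
  D ∪ {v | ∃ u ∈ D, G.Adj u v}

/-- `G` contains a subgraph isomorphic to `H` (a copy of `H`). -/
def HasCopy {W V : Type*} (H : SimpleGraph W) (G : SimpleGraph V) : Prop :=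
  ∃ f : W ↪ V, ∀ ⦃a b⦄, H.Adj a b → G.Adj (f a) (f b)

/-- `D` is an `H`-isolating set of `G` (single graph `H`). -/
def IsIsolating {W V : Type*} (H : SimpleGraph W) (G : SimpleGraph V) (D : Set V) : Prop :=
  ¬ HasCopy H (G.induce (closedNbhd G D)ᶜ)

/-- The `H`-isolation number of `G` (single graph `H`). -/
noncomputable def isolNum {W V : Type*} (H : SimpleGraph W) (G : SimpleGraph V) : ℕ :=
  sInf {k | ∃ D : Set V, D.ncard = k ∧ IsIsolating H G D}

/-- `D` is an `F`-isolating set of `G`, for a set `F` of graphs. -/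
def IsIsolatingFam {V : Type*} (F : Set ((n : ℕ) × SimpleGraph (Fin n)))
    (G : SimpleGraph V) (D : Set V) : Prop :=
  ∀ H ∈ F, ¬ HasCopy H.2 (G.induce (closedNbhd G D)ᶜ)

/-- The `F`-isolation number of `G`, for a set `F` of graphs. -/
noncomputable def isolNumFam {V : Type*} (F : Set ((n : ℕ) × SimpleGraph (Fin n)))
    (G : SimpleGraph V) : ℕ :=
  sInf {k | ∃ D : Set V, D.ncard = k ∧ IsIsolatingFam F G D}

/-- The 4-cycle. -/
def C4 : SimpleGraph (Fin 4) := cycleGraph 4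

/-- The diamond graph: a 4-cycle together with a chord. -/
def diamondGraph : SimpleGraph (Fin 4) :=
  fromEdgeSet {s(0, 1), s(1, 2), s(2, 3), s(3, 0), s(0, 2)}

/-- The complete graph on 4 vertices. -/
def K4 : SimpleGraph (Fin 4) := ⊤

/-- `G₁`: the square of the 9-cycle. -/
def Gr1 : SimpleGraph (Fin 9) :=
  fromEdgeSet {s(0, 1), s(1, 2), s(2, 3), s(3, 4), s(4, 5), s(5, 6), s(6, 7), s(7, 8), s(8, 0),
    s(0, 2), s(1, 3), s(2, 4), s(3, 5), s(4, 6), s(5, 7), s(6, 8), s(7, 0), s(8, 1)}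

/-- `G₂`. -/
def Gr2 : SimpleGraph (Fin 9) :=
  fromEdgeSet {s(0, 1), s(0, 5), s(0, 6), s(0, 8), s(1, 2), s(1, 7), s(1, 8), s(2, 3), s(2, 6),
    s(2, 7), s(3, 4), s(3, 6), s(3, 8), s(4, 5), s(4, 7), s(4, 8), s(5, 6), s(5, 7)}

/-- `G₃`. -/
def Gr3 : SimpleGraph (Fin 9) :=
  fromEdgeSet {s(0, 1), s(0, 5), s(0, 6), s(0, 8), s(1, 2), s(1, 7), s(1, 8), s(2, 3), s(2, 7),
    s(2, 8), s(3, 4), s(3, 6), s(3, 8), s(4, 5), s(4, 6), s(4, 7), s(5, 6), s(5, 7)}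

/-- `G₄`. -/
def Gr4 : SimpleGraph (Fin 9) :=
  fromEdgeSet {s(0, 1), s(0, 2), s(0, 3), s(0, 4), s(1, 2), s(1, 5), s(1, 6), s(2, 5), s(2, 6),
    s(3, 4), s(3, 7), s(3, 8), s(4, 7), s(4, 8), s(5, 6), s(5, 8), s(6, 7), s(7, 8)}

/-- `G₅`: `G₄` with the edge `{2,3}` removed. -/
def Gr5 : SimpleGraph (Fin 9) :=
  fromEdgeSet {s(0, 1), s(0, 2), s(0, 3), s(0, 4), s(1, 5), s(1, 6), s(2, 5), s(2, 6),
    s(3, 4), s(3, 7), s(3, 8), s(4, 7), s(4, 8), s(5, 6), s(5, 8), s(6, 7), s(7, 8)}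

/-- `G₆`: `G₅` with the edge `{4,5}` removed. -/
def Gr6 : SimpleGraph (Fin 9) :=
  fromEdgeSet {s(0, 1), s(0, 2), s(0, 3), s(0, 4), s(1, 5), s(1, 6), s(2, 5), s(2, 6),
    s(3, 7), s(3, 8), s(4, 7), s(4, 8), s(5, 6), s(5, 8), s(6, 7), s(7, 8)}

/-- The set `𝒢₄ = {C₄, C₄', K₄}` of 4-vertex exceptional graphs. -/
def calG4 : Set ((n : ℕ) × SimpleGraph (Fin n)) := {⟨4, C4⟩, ⟨4, diamondGraph⟩, ⟨4, K4⟩}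

/-- The set `𝒢₉ = {G₁, …, G₆}` of 9-vertex exceptional graphs. -/
def calG9 : Set ((n : ℕ) × SimpleGraph (Fin n)) :=
  {⟨9, Gr1⟩, ⟨9, Gr2⟩, ⟨9, Gr3⟩, ⟨9, Gr4⟩, ⟨9, Gr5⟩, ⟨9, Gr6⟩}

/-- The set `ℰ₄ = 𝒢₄ ∪ 𝒢₉` of exceptional graphs. -/
def calE4 : Set ((n : ℕ) × SimpleGraph (Fin n)) := calG4 ∪ calG9

/-! ### Combinatorial vocabulary -/

namespace SquareIsolation

open Finset
open scoped Classical

section Basic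

variable {V : Type*} (G : SimpleGraph V)

/-- The vertex set `S` spans a (not necessarily induced) 4-cycle of `G`. -/
def HasC4 (S : Finset V) : Prop :=
  ∃ a b c d, a ∈ S ∧ b ∈ S ∧ c ∈ S ∧ d ∈ S ∧ a ≠ c ∧ b ≠ d ∧
    G.Adj a b ∧ G.Adj b c ∧ G.Adj c d ∧ G.Adj d a

/-- `S` induces a connected subgraph, expressed through cuts. -/
def Conn (S : Finset V) : Prop :=
  S.Nonempty ∧ ∀ A ⊆ S, A.Nonempty → A ≠ S → ∃ a ∈ A, ∃ b ∈ S, b ∉ A ∧ G.Adj a b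

/-- `T` is the vertex set of a component of the subgraph induced by `S`. -/
def IsComp (T S : Finset V) : Prop :=
  T ⊆ S ∧ Conn G T ∧ ∀ a ∈ T, ∀ b ∈ S, b ∉ T → ¬ G.Adj a b

/-- `S` induces a 4-vertex exceptional graph. -/
def Bad4 (S : Finset V) : Prop := #S = 4 ∧ HasC4 G S

variable {G}

lemma HasC4.mono {S T : Finset V} (h : HasC4 G S) (hST : S ⊆ T) : HasC4 G T := by
  obtain ⟨a, b, c, d, ha, hb, hc, hd, h⟩ := h
  exact ⟨a, b, c, d, hST ha, hST hb, hST hc, hST hd, h⟩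

lemma HasC4.four_le_card {S : Finset V} (h : HasC4 G S) : 4 ≤ #S := by
  obtain ⟨a, b, c, d, ha, hb, hc, hd, hac, hbd, hab, hbc, hcd, hda⟩ := h
  have : ({a, b, c, d} : Finset V) ⊆ S := by grind
  have h4 : #({a, b, c, d} : Finset V) = 4 := by
    have := hab.ne; have := hbc.ne; have := hcd.ne; have := hda.ne
    grind
  exact h4 ▸ card_le_card this

/-- A 4-cycle inside a union of two sets without edges between them lies in one of them. -/
lemma not_hasC4_union {A B : Finset V} (hA : ¬ HasC4 G A) (hB : ¬ HasC4 G B)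
    (hAB : ∀ a ∈ A, ∀ b ∈ B, b ∉ A → ¬ G.Adj a b) : ¬ HasC4 G (A ∪ B) := by
  rintro ⟨a, b, c, d, ha, hb, hc, hd, hac, hbd, hab, hbc, hcd, hda⟩
  by_cases h : a ∈ A
  · have hbA : b ∈ A := by grind
    have hcA : c ∈ A := by grind
    have hdA : d ∈ A := by grind
    exact hA ⟨a, b, c, d, h, hbA, hcA, hdA, hac, hbd, hab, hbc, hcd, hda⟩
  · have hbA : b ∉ A := by grind [G.adj_comm]
    have hcA : c ∉ A := by grind [G.adj_comm]
    have hdA : d ∉ A := by grind [G.adj_comm]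
    exact hB ⟨a, b, c, d, by grind, by grind, by grind, by grind, hac, hbd, hab, hbc, hcd, hda⟩

/-- In a four-vertex set with a 4-cycle, the cycle can be read off from any vertex. -/
lemma Bad4.cycle {S : Finset V} (h : Bad4 G S) {y : V} (hy : y ∈ S) :
    ∃ p z q, S = {y, p, z, q} ∧ y ≠ z ∧ p ≠ q ∧ y ≠ p ∧ y ≠ q ∧ z ≠ p ∧ z ≠ q ∧
      G.Adj y p ∧ G.Adj p z ∧ G.Adj z q ∧ G.Adj q y := by
  obtain ⟨hS, a, b, c, d, ha, hb, hc, hd, hac, hbd, hab, hbc, hcd, hda⟩ := h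
  have := hab.ne; have := hbc.ne; have := hcd.ne; have := hda.ne
  have hsub : ({a, b, c, d} : Finset V) ⊆ S := by grind
  have h4 : #({a, b, c, d} : Finset V) = 4 := by grind
  have hSe : S = {a, b, c, d} := (eq_of_subset_of_card_le hsub (by omega)).symm
  have hcases : y = a ∨ y = b ∨ y = c ∨ y = d := by rw [hSe] at hy; simpa using hy
  rcases hcases with rfl | rfl | rfl | rfl
  · exact ⟨b, c, d, by grind⟩
  · exact ⟨c, d, a, by grind⟩
  · exact ⟨d, a, b, by grind⟩
  · exact ⟨a, b, c, by grind⟩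

lemma Conn.insert {S : Finset V} (hS : Conn G S) {x y : V} (hy : y ∈ S) (hxy : G.Adj y x) :
    Conn G (insert x S) := by
  refine ⟨by simp, fun A hA hne hAne => ?_⟩
  by_cases hAS : S ⊆ A
  · exact ⟨y, hAS hy, x, by simp, by grind, hxy⟩
  by_cases hdis : ∃ w ∈ S, w ∈ A
  · obtain ⟨w, hwS, hwA⟩ := hdis
    obtain ⟨a, ha, b, hb, hbA, hab⟩ := hS.2 (A ∩ S) (by grind) ⟨w, by grind⟩ (by grind)
    exact ⟨a, by grind, b, by grind, by grind, hab⟩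
  · obtain ⟨w, hw⟩ := hne
    have hwx : w = x := by grind
    exact ⟨w, hw, y, by grind, by grind, hwx ▸ hxy.symm⟩

lemma Conn.of_edge_out {S : Finset V} (hS : Conn G S) {A : Finset V} {a b : V} (ha : a ∈ S)
    (haA : a ∈ A) (hb : b ∈ S) (hbA : b ∉ A) :
    ∃ a ∈ S, a ∈ A ∧ ∃ b ∈ S, b ∉ A ∧ G.Adj a b := by
  obtain ⟨a, ha, b, hb, hbA, hab⟩ := hS.2 (A ∩ S) (by grind) ⟨a, by grind⟩ (by grind)
  exact ⟨a, by grind, by grind, b, hb, by grind, hab⟩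

/-- A set all of whose vertices can be reached from `x` by growing is connected. -/
lemma conn_of_root {S : Finset V} {x : V} (hx : x ∈ S)
    (h : ∀ A ⊆ S, x ∈ A → A ≠ S → ∃ a ∈ A, ∃ b ∈ S, b ∉ A ∧ G.Adj a b) : Conn G S := by
  refine ⟨⟨x, hx⟩, fun A hA hne hAne => ?_⟩
  by_cases hxA : x ∈ A
  · exact h A hA hxA hAne
  · obtain ⟨a, ha, b, hb, hbA, hab⟩ := h (S \ A) (by grind) (by grind) (by
      obtain ⟨w, hw⟩ := hne
      intro hc
      have : w ∈ S \ A := by rw [hc]; exact hA hw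
      grind)
    exact ⟨b, by grind, a, by grind, by grind, hab.symm⟩

lemma Conn.subset_of_isComp {C T S : Finset V} (hC : Conn G C) (hT : IsComp G T S) (hCS : C ⊆ S)
    {a : V} (ha : a ∈ C) (haT : a ∈ T) : C ⊆ T := by
  intro b hb
  by_contra hbT
  obtain ⟨c, hc, hcT, d, hd, hdT, hcd⟩ := hC.of_edge_out ha haT hb hbT
  exact hT.2.2 c hcT d (hCS hd) hdT hcd

lemma IsComp.eq_of_mem {T T' S : Finset V} (hT : IsComp G T S) (hT' : IsComp G T' S) {a : V}
    (ha : a ∈ T) (ha' : a ∈ T') : T = T' :=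
  (hT.2.1.subset_of_isComp hT' hT.1 ha ha').antisymm (hT'.2.1.subset_of_isComp hT hT'.1 ha' ha)

lemma IsComp.disjoint {T T' S : Finset V} (hT : IsComp G T S) (hT' : IsComp G T' S)
    (h : T ≠ T') : ∀ a ∈ T, a ∉ T' := fun _ ha ha' => h (hT.eq_of_mem hT' ha ha')

lemma IsComp.eq_of_conn {T S : Finset V} (hT : IsComp G T S) (hS : Conn G S) : T = S := by
  obtain ⟨a, ha⟩ := hT.2.1.1
  exact hT.1.antisymm (hS.subset_of_isComp hT Subset.rfl (hT.1 ha) ha)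

lemma exists_isComp {S : Finset V} {a : V} (ha : a ∈ S) : ∃ T, IsComp G T S ∧ a ∈ T := by
  let P : Finset V → Prop := fun T => T ⊆ S ∧ a ∈ T ∧ ∀ c ∈ T, ∀ d ∈ S, d ∉ T → ¬ G.Adj c d
  have hex : ∃ k, ∃ T, P T ∧ #T = k :=
    ⟨_, S, ⟨Subset.rfl, ha, fun _ _ _ hb hb' => absurd hb hb'⟩, rfl⟩
  obtain ⟨T, ⟨hTS, haT, hcl⟩, hcard⟩ := Nat.find_spec hex
  have hmin : ∀ T', P T' → #T ≤ #T' := fun T' h' => hcard ▸ Nat.find_min' hex ⟨T', h', rfl⟩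
  refine ⟨T, ⟨hTS, conn_of_root haT fun A hA haA hne => ?_, hcl⟩, haT⟩
  by_contra! hcon
  have := hmin A ⟨hA.trans hTS, haA, fun c hc d hd hdA => by
    by_cases hdT : d ∈ T
    · exact hcon c hc d hdT hdA
    · exact hcl c (hA hc) d hd hdT⟩
  exact hne (eq_of_subset_of_card_le hA this)

/-- Enlarging the ambient set keeps a component as long as no new vertex is adjacent to it. -/
lemma IsComp.of_isComp {T S S' : Finset V} (hT : IsComp G T S) (hTS : T ⊆ S')
    (h : ∀ a ∈ T, ∀ b ∈ S', b ∉ S → ¬ G.Adj a b) : IsComp G T S' :=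
  ⟨hTS, hT.2.1, fun a ha b hb hbT => by
    by_cases hbS : b ∈ S
    · exact hT.2.2 a ha b hbS hbT
    · exact h a ha b hb hbS⟩

lemma IsComp.of_sdiff {T T' S : Finset V} (hT : IsComp G T S) (hT' : IsComp G T' (S \ T)) :
    IsComp G T' S :=
  hT'.of_isComp (hT'.1.trans sdiff_subset) fun a ha b hb hbS hab =>
    hT.2.2 b (by grind) a (by have := hT'.1 ha; grind) (by have := hT'.1 ha; grind) hab.symm

lemma Bad4.conn {S : Finset V} (h : Bad4 G S) : Conn G S := by
  obtain ⟨y, hy⟩ : S.Nonempty := card_pos.mp (by have := h.1; omega)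
  obtain ⟨p, z, q, rfl, hyz, hpq, hyp, hyq, hzp, hzq, a1, a2, a3, a4⟩ := h.cycle hy
  refine conn_of_root hy fun A hA hyA hne => ?_
  by_cases hp : p ∈ A
  · by_cases hz : z ∈ A
    · exact ⟨z, hz, q, by simp, by grind, a3⟩
    · exact ⟨p, hp, z, by simp, hz, a2⟩
  · exact ⟨y, hyA, p, by simp, hp, a1⟩

lemma not_hasC4_of_card {S : Finset V} (h : #S ≤ 3) : ¬ HasC4 G S :=
  fun h4 => by have := h4.four_le_card; omega

/-- If no edge of `S` joins `A` to its complement, 4-cycles of `S` lie on one side. -/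
lemma HasC4.split {S : Finset V} (h : HasC4 G S) (A : Finset V)
    (hA : ∀ a ∈ S, a ∈ A → ∀ b ∈ S, b ∉ A → ¬ G.Adj a b) :
    HasC4 G (S ∩ A) ∨ HasC4 G (S \ A) := by
  by_contra! hcon
  refine not_hasC4_union hcon.1 hcon.2
    (fun a ha b hb _ => hA a (by grind) (by grind) b (by grind) (by grind)) (h.mono ?_)
  grind

/-- A vertex with at most one neighbour in `S` is on no 4-cycle of `S`. -/
lemma HasC4.erase {S : Finset V} (h : HasC4 G S) {z : V}
    (hz : ∀ p ∈ S, ∀ q ∈ S, G.Adj z p → G.Adj z q → p = q) : HasC4 G (S.erase z) := by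
  obtain ⟨a, b, c, d, ha, hb, hc, hd, hac, hbd, hab, hbc, hcd, hda⟩ := h
  have h1 : a ≠ z := by
    rintro rfl
    exact hbd (hz b hb d hd hab hda.symm)
  have h2 : b ≠ z := by
    rintro rfl
    exact hac (hz a ha c hc hab.symm hbc)
  have h3 : c ≠ z := by
    rintro rfl
    exact hbd (hz b hb d hd hbc.symm hcd)
  have h4 : d ≠ z := by
    rintro rfl
    exact hac (hz a ha c hc hda hcd.symm)
  exact ⟨a, b, c, d, by grind, by grind, by grind, by grind, hac, hbd, hab, hbc, hcd, hda⟩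

/-- A 4-cycle does not use both sides of a cut vertex. -/
lemma HasC4.split_cut {S A B : Finset V} {x : V} (h : HasC4 G S) (hS : S ⊆ insert x (A ∪ B))
    (hdis : ∀ a ∈ A, a ∉ B) (hAB : ∀ a ∈ A, ∀ b ∈ B, ¬ G.Adj a b) :
    HasC4 G (S ∩ insert x A) ∨ HasC4 G (S ∩ insert x B) := by
  obtain ⟨a, b, c, d, ha, hb, hc, hd, hac, hbd, hab, hbc, hcd, hda⟩ := h
  have key : ∀ p q, p ∈ S → q ∈ S → G.Adj p q →
      (p = x ∨ p ∈ A) ∧ (q = x ∨ q ∈ A) ∨ (p = x ∨ p ∈ B) ∧ (q = x ∨ q ∈ B) := by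
    intro p q hp hq hpq
    have := hAB p
    have := hAB q
    have := hS hp
    have := hS hq
    have := hpq.symm
    grind
  have k1 := key a b ha hb hab
  have k2 := key b c hb hc hbc
  have k3 := key c d hc hd hcd
  have k4 := key d a hd ha hda
  have := hab.ne; have := hbc.ne; have := hcd.ne; have := hda.ne
  by_cases hA : (a = x ∨ a ∈ A) ∧ (b = x ∨ b ∈ A) ∧ (c = x ∨ c ∈ A) ∧ (d = x ∨ d ∈ A)
  · exact Or.inl ⟨a, b, c, d, by grind, by grind, by grind, by grind, hac, hbd, hab, hbc, hcd, hda⟩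
  · have : (a = x ∨ a ∈ B) ∧ (b = x ∨ b ∈ B) ∧ (c = x ∨ c ∈ B) ∧ (d = x ∨ d ∈ B) := by
      grind
    exact Or.inr ⟨a, b, c, d, by grind, by grind, by grind, by grind, hac, hbd, hab, hbc, hcd, hda⟩

lemma Bad4.exists_adj {S : Finset V} (h : Bad4 G S) {y : V} (hy : y ∈ S) : ∃ z ∈ S, G.Adj y z := by
  obtain ⟨p, z, q, rfl, -, -, -, -, -, -, h, -⟩ := h.cycle hy
  exact ⟨p, by simp, h⟩

lemma Bad4.two_adj {S : Finset V} (h : Bad4 G S) {x : V} (hx : x ∈ S) :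
    2 ≤ #(S.filter (G.Adj x)) := by
  obtain ⟨p, z, q, rfl, -, hpq, -, -, -, -, hxp, -, -, hqx⟩ := h.cycle hx
  have : ({p, q} : Finset V) ⊆ ({x, p, z, q} : Finset V).filter (G.Adj x) := by
    grind [G.adj_comm]
  exact (card_pair hpq).ge.trans (card_le_card this)

/-- A 4-cycle does not use a bridge. -/
lemma HasC4.split_bridge {S B : Finset V} {b p : V} (h : HasC4 G S)
    (hB : ∀ a ∈ S, a ∈ B → ∀ c ∈ S, c ∉ B → G.Adj a c → a = b ∧ c = p) :
    HasC4 G (S ∩ B) ∨ HasC4 G (S \ B) := by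
  by_cases hpS : p ∉ S
  · exact h.split B fun a ha haB c hc hcB hac => hpS ((hB a ha haB c hc hcB hac).2 ▸ hc)
  rw [not_not] at hpS
  rcases h.split_cut (A := (S ∩ B).erase p) (B := (S \ B).erase p) (x := p) (fun x hx => by grind)
    (by grind) (fun a ha c hc hac => by
      have := hB a (by grind) (by grind) c (by grind) (by grind) hac
      grind) with h | h
  · by_cases hpB : p ∈ B
    · exact Or.inl (h.mono fun z hz => by grind)
    · refine Or.inl ((h.erase (z := p) fun x hx y hy hpx hpy => ?_).mono fun z hz => by grind)
      have := hpx.ne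
      have := hpy.ne
      have := hB x (by grind) (by grind) p (by grind) hpB hpx.symm
      have := hB y (by grind) (by grind) p (by grind) hpB hpy.symm
      grind
  · by_cases hpB : p ∈ B
    · refine Or.inr ((h.erase (z := p) fun x hx y hy hpx hpy => ?_).mono fun z hz => by grind)
      have := hpx.ne
      have := hpy.ne
      have := hB p (by grind) hpB x (by grind) (by grind) hpx
      grind
    · exact Or.inr (h.mono fun z hz => by grind)

lemma Conn.exists_adj {S : Finset V} (hS : Conn G S) {a : V} (ha : a ∈ S) (h2 : 2 ≤ #S) :
    ∃ r ∈ S, G.Adj a r := by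
  obtain ⟨c, hc, b, hb, hbA, hab⟩ := hS.2 {a} (by simpa using ha) (by simp) (fun hc => by
    rw [← hc, card_singleton] at h2
    omega)
  rw [mem_singleton] at hc
  exact ⟨b, hb, hc ▸ hab⟩

end Basic

end SquareIsolation

namespace SquareIsolation

open Finset
open scoped Classical

section Neighbourhoods

variable {V : Type*} [Fintype V] (G : SimpleGraph V)

/-- The closed neighbourhood of a vertex. -/
noncomputable def nbhd (x : V) : Finset V := univ.filter fun y => y = x ∨ G.Adj x y

/-- The closed neighbourhood of a set of vertices. -/
noncomputable def nbhds (D : Finset V) : Finset V := D.biUnion (nbhd G)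

variable {G}

@[simp, grind] lemma mem_nbhd {x y : V} : y ∈ nbhd G x ↔ y = x ∨ G.Adj x y := by simp [nbhd]

@[simp, grind] lemma mem_nbhds {D : Finset V} {y : V} :
    y ∈ nbhds G D ↔ ∃ x ∈ D, y = x ∨ G.Adj x y := by simp [nbhds]

/-- The six exceptional graphs on nine vertices. -/
def IsNineGraph (H : SimpleGraph (Fin 9)) : Prop :=
  H = Gr1 ∨ H = Gr2 ∨ H = Gr3 ∨ H = Gr4 ∨ H = Gr5 ∨ H = Gr6

variable (G) in
/-- `S` induces a 9-vertex exceptional graph. -/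
def Bad9 (S : Finset V) : Prop :=
  ∃ H, IsNineGraph H ∧ ∃ f : Fin 9 ↪ V, univ.map f = S ∧ ∀ a b, G.Adj (f a) (f b) ↔ H.Adj a b

variable (G) in
/-- `S` induces an exceptional graph. -/
def Bad (S : Finset V) : Prop := Bad4 G S ∨ Bad9 G S

variable (G) in
/-- `b` and `b'` are nonadjacent vertices of degree 3 in `B` with the same neighbours in `B`, in a
position that occurs in 9-vertex exceptional graphs. -/
structure Twins (B : Finset V) (b b' : V) : Prop where
  mem : b' ∈ B
  ne : b' ≠ b
  card : #(nbhd G b ∩ B) = 4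
  same : ∀ x ∈ B, G.Adj b x ↔ G.Adj b' x
  bad : Bad4 G ((B \ nbhd G b).erase b')
  nbr : ∃ n ∈ B, G.Adj b n ∧ ∃ q ∈ B, q ≠ b' ∧ q ∉ nbhd G b ∧ G.Adj n q
  four : ∀ n ∈ B, G.Adj b n → #(nbhd G n ∩ B) = 5

variable (G) in
/-- The properties of 9-vertex exceptional graphs used in the main argument. -/
structure Nine (B : Finset V) : Prop where
  card : #B = 9
  conn : Conn G B
  kill : ∀ y ∈ B, ∃ u ∈ B, ¬ HasC4 G (B.erase y \ nbhd G u)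
  four : ∃ y ∈ B, #(nbhd G y ∩ B) = 5
  vert : ∀ b ∈ B, #(nbhd G b ∩ B) = 5 ∧ Bad4 G (B \ nbhd G b) ∨ ∃ b', Twins G B b b'
  twin : ∀ b ∈ B, ∀ c ∈ B, ∀ d ∈ B, b ≠ c → b ≠ d → c ≠ d →
    ¬ HasC4 G ((B \ nbhd G b) \ nbhd G c) ∨ ¬ HasC4 G ((B \ nbhd G b) \ nbhd G d)

end Neighbourhoods

end SquareIsolation

namespace SquareIsolation

open Finset

section Masks

/-- The `i`-th row of the 9 × 9 bit matrix `m`. -/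
def row (m i : ℕ) : ℕ := (m >>> (9 * i)) % 512

/-- The graph with adjacency matrix `m` has no 4-cycle inside the set of bits of `S`. -/
def c4free (m S : ℕ) : Bool :=
  (List.range 9).all fun a => !S.testBit a || (List.range 9).all fun c => !S.testBit c || c.ble a ||
    (row m a &&& row m c &&& S) &&& ((row m a &&& row m c &&& S) - 1) == 0

/-- The complement of a set of bits. -/
def compl9 (S : ℕ) : ℕ := S ^^^ 511

/-- The closed neighbourhood of `i` in the graph with adjacency matrix `m`. -/
def star (m i : ℕ) : ℕ := row m i ||| (1 <<< i)

/-- The number of bits of `S`. -/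
def count9 (S : ℕ) : ℕ := #(univ.filter fun i : Fin 9 => S.testBit i = true)

/-- The property `Nine` for adjacency matrices. -/
def NineMask (m : ℕ) : Prop :=
  (∀ a b : Fin 9, a = b ∨ m.testBit (9 * a + b) = true ∨
    ∃ c : Fin 9, m.testBit (9 * a + c) = true ∧ m.testBit (9 * c + b) = true) ∧
  (∀ y : Fin 9, ∃ u : Fin 9, c4free m (compl9 (star m u ||| 1 <<< y.val)) = true) ∧
  (∃ y : Fin 9, count9 (star m y) = 5) ∧
  (∀ b : Fin 9, count9 (star m b) = 5 ∧ c4free m (compl9 (star m b)) = false ∨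
    ∃ b' : Fin 9, b' ≠ b ∧ count9 (star m b) = 4 ∧ row m b = row m b' ∧
      c4free m (compl9 (star m b ||| 1 <<< b'.val)) = false ∧
      (∃ n : Fin 9, m.testBit (9 * b + n) = true ∧ ∃ q : Fin 9, q ≠ b' ∧
        (star m b).testBit q = false ∧ m.testBit (9 * n + q) = true) ∧
      ∀ n : Fin 9, m.testBit (9 * b + n) = true → count9 (star m n) = 5) ∧
  ∀ b c d : Fin 9, b ≠ c → b ≠ d → c ≠ d → c4free m (compl9 (star m b ||| star m c)) = true ∨
    c4free m (compl9 (star m b ||| star m d)) = true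

instance (m : ℕ) : Decidable (NineMask m) := by unfold NineMask; infer_instance

/-- The adjacency matrices of the nine-vertex exceptional graphs. -/
def nineMasks : List ℕ :=
  [924125104315999978396550, 128002775158120017234786, 71334593523272299252578,
    872091274716011238836766, 872091274716011238310430, 872091274715459335012894]

lemma nineMask_of_mem : ∀ m ∈ nineMasks, NineMask m := by decide +kernel

lemma Gr1_adj (a b : Fin 9) :
    Gr1.Adj a b ↔ (924125104315999978396550).testBit (9 * a + b) = true := by
  simp only [Gr1, SimpleGraph.fromEdgeSet_adj, Set.mem_insert_iff, Set.mem_singleton_iff]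
  revert a b
  decide +kernel

lemma Gr2_adj (a b : Fin 9) :
    Gr2.Adj a b ↔ (128002775158120017234786).testBit (9 * a + b) = true := by
  simp only [Gr2, SimpleGraph.fromEdgeSet_adj, Set.mem_insert_iff, Set.mem_singleton_iff]
  revert a b
  decide +kernel

lemma Gr3_adj (a b : Fin 9) :
    Gr3.Adj a b ↔ (71334593523272299252578).testBit (9 * a + b) = true := by
  simp only [Gr3, SimpleGraph.fromEdgeSet_adj, Set.mem_insert_iff, Set.mem_singleton_iff]
  revert a b
  decide +kernel

lemma Gr4_adj (a b : Fin 9) :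
    Gr4.Adj a b ↔ (872091274716011238836766).testBit (9 * a + b) = true := by
  simp only [Gr4, SimpleGraph.fromEdgeSet_adj, Set.mem_insert_iff, Set.mem_singleton_iff]
  revert a b
  decide +kernel

lemma Gr5_adj (a b : Fin 9) :
    Gr5.Adj a b ↔ (872091274716011238310430).testBit (9 * a + b) = true := by
  simp only [Gr5, SimpleGraph.fromEdgeSet_adj, Set.mem_insert_iff, Set.mem_singleton_iff]
  revert a b
  decide +kernel

lemma Gr6_adj (a b : Fin 9) :
    Gr6.Adj a b ↔ (872091274715459335012894).testBit (9 * a + b) = true := by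
  simp only [Gr6, SimpleGraph.fromEdgeSet_adj, Set.mem_insert_iff, Set.mem_singleton_iff]
  revert a b
  decide +kernel

lemma IsNineGraph.exists_mask {H : SimpleGraph (Fin 9)} (h : IsNineGraph H) :
    ∃ m ∈ nineMasks, ∀ a b : Fin 9, H.Adj a b ↔ m.testBit (9 * a + b) = true := by
  rcases h with rfl | rfl | rfl | rfl | rfl | rfl
  exacts [⟨_, by simp [nineMasks], Gr1_adj⟩, ⟨_, by simp [nineMasks], Gr2_adj⟩,
    ⟨_, by simp [nineMasks], Gr3_adj⟩, ⟨_, by simp [nineMasks], Gr4_adj⟩,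
    ⟨_, by simp [nineMasks], Gr5_adj⟩, ⟨_, by simp [nineMasks], Gr6_adj⟩]

lemma exists_isNineGraph {m : ℕ} (h : m ∈ nineMasks) :
    ∃ H, IsNineGraph H ∧ ∀ a b : Fin 9, H.Adj a b ↔ m.testBit (9 * a + b) = true := by
  simp only [nineMasks, List.mem_cons, List.not_mem_nil, or_false] at h
  rcases h with rfl | rfl | rfl | rfl | rfl | rfl
  exacts [⟨Gr1, by simp [IsNineGraph], Gr1_adj⟩, ⟨Gr2, by simp [IsNineGraph], Gr2_adj⟩,
    ⟨Gr3, by simp [IsNineGraph], Gr3_adj⟩, ⟨Gr4, by simp [IsNineGraph], Gr4_adj⟩,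
    ⟨Gr5, by simp [IsNineGraph], Gr5_adj⟩, ⟨Gr6, by simp [IsNineGraph], Gr6_adj⟩]

lemma testBit_row (m i : ℕ) (j : Fin 9) : (row m i).testBit j = m.testBit (9 * i + j) := by
  have : (512 : ℕ) = 2 ^ 9 := rfl
  rw [row, this, Nat.testBit_mod_two_pow, Nat.testBit_shiftRight]
  simp

lemma testBit_compl9 (S : ℕ) (j : Fin 9) : (compl9 S).testBit j = !S.testBit j := by
  have : (511 : ℕ) = 2 ^ 9 - 1 := rfl
  rw [compl9, this, Nat.testBit_xor, Nat.testBit_two_pow_sub_one]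
  simp

lemma testBit_one_shiftLeft (i j : ℕ) : (1 <<< i).testBit j = decide (j = i) := by
  rw [Nat.one_shiftLeft, Nat.testBit_two_pow]
  simp [eq_comm]

lemma testBit_star (m i : ℕ) (j : Fin 9) :
    (star m i).testBit j = (m.testBit (9 * i + j) || decide (j.val = i)) := by
  rw [star, Nat.testBit_or, testBit_row, testBit_one_shiftLeft]

/-- A number has at most one bit exactly if it has no bit in common with its predecessor. -/
lemma and_pred_eq_zero_iff (x : ℕ) :
    x &&& (x - 1) = 0 ↔ ∀ i j, x.testBit i = true → x.testBit j = true → i = j := by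
  rcases Nat.eq_zero_or_pos x with rfl | hx
  · simp
  rw [Nat.and_sub_one_eq_zero_iff_isPowerOfTwo hx.ne']
  constructor
  · rintro ⟨k, rfl⟩ i j hi hj
    rw [Nat.testBit_two_pow] at hi hj
    simp at hi hj
    omega
  · intro h
    obtain ⟨i, hi⟩ := Nat.exists_testBit_of_ne_zero hx.ne'
    refine ⟨i, Nat.eq_of_testBit_eq fun j => ?_⟩
    rw [Nat.testBit_two_pow]
    by_cases hij : i = j
    · simp [← hij, hi]
    · have : x.testBit j ≠ true := fun hj => hij (h i j hi hj)
      simp_all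

end Masks

end SquareIsolation

namespace SquareIsolation

open Finset
open scoped Classical

section Labellings

variable {V : Type*} {G : SimpleGraph V} {f : Fin 9 ↪ V} {m S : ℕ} {T : Finset V}

lemma not_hasC4_of_c4free (hm : ∀ a b, G.Adj (f a) (f b) → m.testBit (9 * a + b) = true)
    (hTf : T ⊆ univ.map f) (hT : ∀ i, f i ∈ T → S.testBit i = true) (h : c4free m S = true) :
    ¬ HasC4 G T := by
  rintro ⟨a, b, c, d, ha, hb, hc, hd, hac, hbd, hab, hbc, hcd, hda⟩
  obtain ⟨a, -, rfl⟩ := mem_map.mp (hTf ha)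
  obtain ⟨b, -, rfl⟩ := mem_map.mp (hTf hb)
  obtain ⟨c, -, rfl⟩ := mem_map.mp (hTf hc)
  obtain ⟨d, -, rfl⟩ := mem_map.mp (hTf hd)
  obtain ⟨hac', hbd'⟩ : a ≠ c ∧ b ≠ d := ⟨fun hc => hac (by rw [hc]), fun hc => hbd (by rw [hc])⟩
  wlog hlt : a < c generalizing a c
  · exact this c hc hbc.symm a ha hac.symm hab.symm hcd.symm hda.symm hac'.symm
      (lt_of_le_of_ne (not_lt.mp hlt) hac'.symm)
  simp only [c4free, List.all_eq_true, List.mem_range, Bool.or_eq_true, Bool.not_eq_true',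
    beq_iff_eq, Nat.ble_eq] at h
  have h1 := h a a.2
  simp only [hT a ha, Bool.true_eq_false, false_or] at h1
  have h2 := h1 c c.2
  simp only [hT c hc, Bool.true_eq_false, not_le.mpr hlt, Fin.val_fin_le, false_or] at h2
  have h3 := (and_pred_eq_zero_iff _).mp h2 b d
    (by simp [testBit_row, hm a b hab, hm c b hbc.symm, hT b hb])
    (by simp [testBit_row, hm a d hda.symm, hm c d hcd, hT d hd])
  exact hbd' (Fin.ext h3)

lemma hasC4_of_c4free (hm : ∀ a b : Fin 9, m.testBit (9 * a + b) = true → G.Adj (f a) (f b))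
    (hT : ∀ i : Fin 9, S.testBit i = true → f i ∈ T) (h : c4free m S = false) : HasC4 G T := by
  rw [← Bool.not_eq_true] at h
  simp only [c4free, List.all_eq_true, List.mem_range, Bool.or_eq_true, Bool.not_eq_true',
    beq_iff_eq, Nat.ble_eq] at h
  push Not at h
  obtain ⟨a, ha, haS, c, hc, ⟨hcS, hac⟩, hx⟩ := h
  rw [ne_eq, and_pred_eq_zero_iff] at hx
  push Not at hx
  obtain ⟨b, d, hb, hd, hbd⟩ := hx
  have hlt : ∀ b, (row m a &&& row m c &&& S).testBit b = true → b < 9 := fun b hb => by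
    by_contra hcon
    have : (512 : ℕ) = 2 ^ 9 := rfl
    rw [Nat.testBit_and, Nat.testBit_and, row, this, Nat.testBit_mod_two_pow] at hb
    simp [hcon] at hb
  have hb9 := hlt b hb
  have hd9 := hlt d hd
  lift a to Fin 9 using ha
  lift b to Fin 9 using hb9
  lift c to Fin 9 using hc
  lift d to Fin 9 using hd9
  simp only [Nat.testBit_and, testBit_row, Bool.and_eq_true] at hb hd
  refine ⟨f a, f b, f c, f d, hT a (by simpa using haS), hT b hb.2, hT c (by simpa using hcS),
    hT d hd.2, ?_, ?_, hm a b hb.1.1, (hm c b hb.1.2).symm, hm c d hd.1.2, (hm a d hd.1.1).symm⟩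
  · exact fun hc => hac.ne (congrArg Fin.val (f.injective hc))
  · exact fun hc => hbd (congrArg Fin.val (f.injective hc))

lemma card_eq_count9 (hTf : T ⊆ univ.map f) (hT : ∀ i, f i ∈ T ↔ S.testBit i = true) :
    #T = count9 S := by
  rw [count9, ← card_map f]
  congr 1
  ext x
  simp only [mem_map, mem_filter, mem_univ, true_and]
  constructor
  · intro hx
    obtain ⟨i, -, rfl⟩ := mem_map.mp (hTf hx)
    exact ⟨i, (hT i).mp hx, rfl⟩
  · rintro ⟨i, hi, rfl⟩
    exact (hT i).mpr hi

lemma nine_of_mask [Fintype V] (hm : ∀ a b, G.Adj (f a) (f b) ↔ m.testBit (9 * a + b) = true)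
    (h : NineMask m) : Nine G (univ.map f) := by
  obtain ⟨hconn, hkill, hfour, hvert, htwin⟩ := h
  have hmem : ∀ {x}, x ∈ univ.map f → ∃ i, f i = x := fun hx => by simpa using hx
  have hbit : ∀ i j : Fin 9, f j ∈ nbhd G (f i) ↔ (star m i).testBit j = true := fun i j => by
    rw [testBit_star, mem_nbhd, hm]
    simp [Fin.ext_iff, or_comm]
  have hc : #(univ.map f) = 9 := by simp
  have hcnt : ∀ i, #(nbhd G (f i) ∩ univ.map f) = count9 (star m i) := fun i =>
    card_eq_count9 inter_subset_right fun j => by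
      rw [mem_inter, hbit]
      simp
  have hcompl : ∀ i, #(univ.map f \ nbhd G (f i)) + count9 (star m i) = 9 := fun i => by
    rw [← hcnt, inter_comm, card_sdiff_add_card_inter, hc]
  have hnot : ∀ {S : ℕ} {T : Finset V}, T ⊆ univ.map f →
      (∀ i, f i ∈ T → S.testBit i = false) → c4free m (compl9 S) = true → ¬ HasC4 G T :=
    fun hTf hT h => not_hasC4_of_c4free (fun a b => (hm a b).mp) hTf
      (fun i hi => by simp [testBit_compl9, hT i hi]) h
  have hyes : ∀ {S : ℕ} {T : Finset V},
      (∀ i : Fin 9, S.testBit i = false → f i ∈ T) → c4free m (compl9 S) = false → HasC4 G T :=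
    fun hT h => hasC4_of_c4free (fun a b => (hm a b).mpr)
      (fun i hi => hT i (by simpa [testBit_compl9] using hi)) h
  refine ⟨hc, ?_, ?_, ?_, ?_, ?_⟩
  · refine ⟨by simp, fun A hA ⟨a, ha⟩ hne => ?_⟩
    obtain ⟨b, hb, hbA⟩ : ∃ b ∈ univ.map f, b ∉ A := by
      by_contra! hcon
      exact hne (hA.antisymm hcon)
    have haf := hA ha
    obtain ⟨a, rfl⟩ := hmem haf
    obtain ⟨b, rfl⟩ := hmem hb
    rcases hconn a b with rfl | hab | ⟨c, hac, hcb⟩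
    · exact absurd ha hbA
    · exact ⟨f a, ha, f b, hb, hbA, (hm a b).mpr hab⟩
    · by_cases hcA : f c ∈ A
      · exact ⟨f c, hcA, f b, hb, hbA, (hm c b).mpr hcb⟩
      · exact ⟨f a, ha, f c, by simp, hcA, (hm a c).mpr hac⟩
  · intro y hy
    obtain ⟨y, rfl⟩ := hmem hy
    obtain ⟨u, hu⟩ := hkill y
    refine ⟨f u, by simp, hnot (fun x => by simp +contextual) (fun i hi => ?_) hu⟩
    rw [mem_sdiff, mem_erase, hbit] at hi
    rw [Nat.testBit_or, testBit_one_shiftLeft]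
    have : i ≠ y := fun hc => hi.1.1 (by rw [hc])
    simp_all [Fin.ext_iff]
  · obtain ⟨y, hy⟩ := hfour
    exact ⟨f y, by simp, (hcnt y).trans hy⟩
  · intro b hb
    obtain ⟨b, rfl⟩ := hmem hb
    have hcb := hcompl b
    refine (hvert b).imp (fun ⟨h5, h4⟩ => ?_) fun ⟨b', hne, h4, hrow, hc4, hnbr, h5⟩ => ?_
    · refine ⟨(hcnt b).trans h5, by omega, hyes (fun i hi => ?_) h4⟩
      rw [mem_sdiff, hbit]
      simp [hi]
    · have hne' : f b' ≠ f b := fun hc => hne (f.injective hc)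
      have hsame : ∀ x ∈ univ.map f, G.Adj (f b) x ↔ G.Adj (f b') x := fun x hx => by
        obtain ⟨x, rfl⟩ := hmem hx
        rw [hm, hm, ← testBit_row, ← testBit_row, hrow]
      have hb'n : f b' ∉ nbhd G (f b) := by
        rw [mem_nbhd, hsame (f b') (by simp)]
        simp [hne']
      refine ⟨f b', by simp, hne', (hcnt b).trans h4, hsame, ⟨?_, hyes (fun i hi => ?_) hc4⟩,
        ?_, fun n hn hbn => ?_⟩
      · rw [card_erase_of_mem (by simp [hb'n])]
        omega
      · rw [Nat.testBit_or, testBit_one_shiftLeft] at hi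
        rw [mem_erase, mem_sdiff, hbit]
        simp_all [Fin.ext_iff]
      · obtain ⟨n, hbn, q, hqb', hqb, hnq⟩ := hnbr
        refine ⟨f n, by simp, (hm b n).mpr hbn, f q, by simp, by simpa using hqb', ?_,
          (hm n q).mpr hnq⟩
        rw [hbit]
        simp [hqb]
      · obtain ⟨n, rfl⟩ := hmem hn
        exact (hcnt n).trans (h5 n ((hm b n).mp hbn))
  · intro b hb c hc d hd hbc hbd hcd
    obtain ⟨b, rfl⟩ := hmem hb
    obtain ⟨c, rfl⟩ := hmem hc
    obtain ⟨d, rfl⟩ := hmem hd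
    have key : ∀ c : Fin 9, c4free m (compl9 (star m b ||| star m c)) = true →
        ¬ HasC4 G ((univ.map f \ nbhd G (f b)) \ nbhd G (f c)) := fun c h =>
      hnot (sdiff_subset.trans sdiff_subset) (fun i hi => by
        rw [mem_sdiff, mem_sdiff, hbit, hbit] at hi
        simp_all) h
    exact (htwin b c d (fun hc => hbc (by rw [hc])) (fun hc => hbd (by rw [hc]))
      fun hc => hcd (by rw [hc])).imp (key c) (key d)

lemma Bad9.nine [Fintype V] {S : Finset V} (h : Bad9 G S) : Nine G S := by
  obtain ⟨H, hH, f, rfl, hf⟩ := h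
  obtain ⟨m, hm, hmH⟩ := hH.exists_mask
  exact nine_of_mask (fun a b => (hf a b).trans (hmH a b)) (nineMask_of_mem m hm)

end Labellings

end SquareIsolation

namespace SquareIsolation

open Finset

section Certificates

/-- A case analysis: decide whether a pair of vertices is adjacent, note that the vertex `w` is
isolating, or give the bijection (in decimal digits) to an exceptional graph. -/
inductive Cert
  | split (e : ℕ) (l r : Cert)
  | dead (w : ℕ)
  | iso (p : ℕ)

/-- Both bits of the pair encoded by `e`. -/
def pairBits (e : ℕ) : ℕ := 1 <<< e ||| 1 <<< (9 * (e % 9) + e / 9)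

/-- `F n`, with `n` evaluated first by the kernel. -/
def evalNat (n : ℕ) (F : ℕ → Bool) : Bool := Nat.rec (F 0) (fun k _ => F (k + 1)) n

/-- The digit of `p` at position `i`. -/
def digit (p i : ℕ) : ℕ := p / 10 ^ i % 10

/-- The digits of `p` are a bijection from the graph with matrix `m` to that with matrix `A`. -/
def isoCheck (A p m : ℕ) : Bool :=
  (List.range 9).all fun i => digit p i < 9 && (List.range 9).all fun j =>
    j.ble i || (digit p i != digit p j &&
      A.testBit (9 * digit p i + digit p j) == m.testBit (9 * i + j))

/-- `c` handles all graphs between the matrices `A` and `U`. -/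
def Cert.check : Cert → ℕ → ℕ → Bool
  | split e l r, A, U => e < 81 && evalNat (A ||| pairBits e) (fun A => l.check A U) &&
      evalNat (U ^^^ (U &&& pairBits e)) fun U => r.check A U
  | dead w, A, U => w < 9 && c4free U (compl9 (star A w))
  | iso p, A, U => A == U && nineMasks.any (isoCheck A p)

open Cert in
/-- The case analysis for graphs with a vertex of degree 4. -/
def nineCert : Cert :=
  split 23 (split 32 (dead 5) (split 34 (split 41 (dead 5) (split 16 (dead 7) (split 25 (dead 7)
    (split 43 (split 52 (dead 5) (split 11 (split 12 (split 13 (dead 1) (split 15 (dead 1)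
    (split 17 (dead 1) (split 42 (split 24 (dead 6) (split 33 (dead 6) (split 21 (split 22 (dead
    2) (split 26 (dead 2) (split 31 (dead 3) (split 35 (dead 3) (split 44 (split 62 (iso
    473086215) (iso 37421865)) (dead 3)))))) (split 44 (dead 4) (split 62 (split 22 (split 26
    (dead 2) (split 31 (dead 3) (split 35 (iso 148765203) (dead 2)))) (split 26 (split 31 (split
    35 (dead 3) (iso 347685210)) (dead 2)) (dead 3))) (dead 1)))))) (split 21 (dead 3) (split 35
    (dead 3) (split 44 (split 26 (dead 8) (split 62 (split 22 (split 24 (dead 2) (split 31 (dead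
    3) (split 33 (iso 146785203) (dead 2)))) (split 24 (split 31 (split 33 (dead 3) (iso
    347865210)) (dead 2)) (dead 3))) (dead 1))) (dead 1)))))))) (split 22 (split 21 (dead 2)
    (split 24 (dead 2) (split 26 (dead 2) (split 42 (dead 4) (split 44 (dead 4) (split 33 (split
    15 (dead 6) (split 13 (split 17 (dead 1) (split 31 (dead 3) (split 35 (split 62 (iso
    374086215) (iso 47321865)) (dead 4)))) (split 17 (split 31 (split 35 (dead 3) (split 62 (iso
    437685120) (dead 2))) (dead 1)) (dead 3)))) (split 13 (dead 4) (split 17 (dead 1) (split 15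
    (split 31 (split 35 (split 62 (iso 437865120) (dead 2)) (dead 1)) (dead 1)) (dead
    3)))))))))) (split 13 (split 15 (dead 1) (split 17 (dead 1) (split 62 (split 33 (split 24
    (dead 6) (split 35 (dead 3) (split 42 (dead 4) (split 21 (split 26 (dead 2) (split 31 (dead
    3) (split 44 (iso 246785103) (dead 2)))) (split 26 (split 31 (split 44 (dead 4) (iso
    437685210)) (dead 2)) (dead 4)))))) (split 35 (split 26 (dead 8) (split 44 (dead 4) (split
    21 (split 24 (dead 2) (split 31 (dead 3) (split 42 (iso 248765103) (dead 2)))) (split 24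
    (split 31 (split 42 (dead 4) (iso 437865210)) (dead 2)) (dead 4))))) (dead 1))) (split 33
    (split 24 (dead 6) (split 35 (dead 3) (dead 1))) (dead 1))))) (split 21 (split 24 (dead 2)
    (split 26 (dead 2) (split 33 (dead 3) (split 35 (dead 3) (split 31 (split 62 (split 15
    (split 17 (dead 1) (split 42 (dead 4) (split 44 (iso 347865120) (dead 1)))) (split 17 (split
    42 (split 44 (dead 4) (iso 347685120)) (dead 1)) (dead 3))) (split 15 (split 17 (dead 1)
    (dead 3)) (dead 3))) (split 15 (dead 1) (split 17 (dead 1) (dead 4)))))))) (split 62 (dead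
    6) (split 15 (split 17 (dead 1) (split 35 (split 33 (dead 3) (split 24 (split 26 (dead 2)
    (split 42 (dead 4) (split 44 (split 31 (iso 876543210) (iso 658721430)) (dead 6)))) (split
    42 (split 26 (split 31 (split 44 (dead 4) (iso 263478510)) (dead 2)) (dead 4)) (dead 8))))
    (split 24 (dead 6) (split 26 (split 31 (split 42 (dead 6) (split 33 (split 44 (iso
    264378510) (dead 1)) (dead 2))) (dead 1)) (dead 6))))) (split 33 (split 35 (dead 3) (split
    17 (split 24 (split 26 (dead 2) (split 31 (split 42 (dead 6) (split 44 (iso 283476510) (dead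
    2))) (dead 2))) (split 42 (split 26 (split 44 (dead 4) (split 31 (iso 678543210) (iso
    587621430))) (dead 6)) (dead 8))) (split 24 (dead 6) (split 26 (split 42 (dead 6) (dead 8))
    (dead 3))))) (split 24 (split 26 (dead 2) (split 42 (split 17 (split 31 (split 35 (split 44
    (dead 4) (iso 284376510)) (dead 6)) (dead 1)) (dead 4)) (dead 8))) (dead 8))))))))) (split
    12 (split 21 (split 31 (dead 3) (split 33 (dead 3) (split 35 (dead 3) (split 42 (split 13
    (dead 4) (split 15 (dead 6) (split 22 (dead 2) (split 17 (dead 1) (split 24 (dead 2) (split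
    26 (dead 2) (split 44 (split 62 (iso 473086215) (iso 473086215)) (dead 3)))))))) (dead
    3))))) (split 13 (split 15 (dead 1) (split 17 (dead 1) (split 24 (split 22 (dead 2) (split
    26 (split 33 (dead 3) (split 35 (dead 3) (split 42 (dead 4) (split 44 (dead 4) (split 31
    (split 62 (iso 251086437) (iso 15243867)) (split 62 (iso 251086437) (iso 251086437)))))))
    (dead 1))) (dead 1)))) (split 22 (split 33 (split 31 (dead 3) (split 35 (dead 3) (split 42
    (dead 4) (split 44 (split 62 (dead 6) (split 15 (split 17 (dead 1) (split 24 (dead 2) (split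
    26 (iso 354287610) (dead 1)))) (split 17 (split 24 (split 26 (dead 2) (iso 382476510)) (dead
    1)) (dead 2)))) (dead 3))))) (split 44 (dead 4) (split 15 (split 17 (dead 1) (split 24 (dead
    2) (split 26 (split 31 (split 35 (dead 3) (split 42 (dead 4) (split 62 (iso 326587401) (dead
    3)))) (split 35 (split 42 (split 62 (dead 6) (iso 362478510)) (dead 3)) (dead 6))) (dead
    1)))) (split 26 (dead 2) (split 17 (split 24 (split 31 (split 35 (dead 3) (split 42 (dead 4)
    (split 62 (iso 328567401) (dead 3)))) (split 35 (split 42 (split 62 (dead 6) (iso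
    354267810)) (dead 3)) (dead 6))) (dead 1)) (split 24 (dead 2) (split 31 (dead 3) (dead
    6)))))))) (split 15 (dead 1) (split 17 (dead 1) (split 33 (dead 3) (split 35 (dead 3) (split
    42 (dead 4) (split 26 (dead 2) (split 24 (split 31 (split 44 (dead 4) (dead 1)) (dead 2))
    (dead 3))))))))))) (split 22 (split 24 (dead 2) (split 26 (dead 2) (split 42 (dead 4) (split
    44 (dead 4) (split 13 (split 15 (dead 1) (split 17 (dead 1) (split 21 (dead 2) (split 31
    (dead 3) (split 33 (split 35 (split 62 (iso 374086215) (iso 374086215)) (dead 4)) (dead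
    4)))))) (split 33 (dead 3) (split 35 (dead 3) (split 15 (split 17 (split 21 (split 31 (split
    62 (iso 152086437) (iso 25143867)) (split 62 (iso 152086437) (iso 152086437))) (dead 1))
    (dead 2)) (dead 2))))))))) (split 62 (split 31 (split 33 (dead 6) (split 35 (dead 8) (split
    42 (dead 6) (split 44 (dead 8) (split 13 (split 21 (split 15 (split 17 (dead 1) (split 24
    (dead 2) (split 26 (iso 426587301) (dead 1)))) (split 17 (split 24 (split 26 (dead 2) (iso
    428567301)) (dead 1)) (dead 2))) (split 15 (dead 1) (split 17 (dead 1) (dead 2)))) (split 15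
    (split 17 (dead 1) (dead 2)) (dead 2))))))) (dead 6)) (split 15 (split 17 (dead 1) (split 21
    (split 24 (dead 2) (split 31 (dead 3) (split 13 (split 26 (split 33 (split 35 (dead 3)
    (split 42 (dead 4) (split 44 (iso 462378510) (dead 3)))) (split 35 (split 42 (split 44 (dead
    4) (iso 453287610)) (dead 3)) (dead 4))) (dead 1)) (split 26 (dead 2) (split 35 (dead 3)
    (dead 1)))))) (split 13 (dead 1) (split 33 (dead 3) (split 24 (split 26 (dead 2) (split 35
    (split 42 (dead 4) (split 44 (split 31 (iso 876543210) (iso 876543210)) (dead 6))) (dead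
    6))) (dead 4)))))) (split 26 (split 21 (dead 2) (split 24 (dead 2) (split 35 (dead 8) (split
    13 (dead 1) (split 17 (split 33 (split 42 (split 44 (dead 4) (split 31 (iso 678543210) (iso
    678543210))) (dead 8)) (dead 8)) (dead 4)))))) (split 31 (dead 3) (split 13 (split 17 (split
    21 (split 24 (split 33 (split 35 (dead 3) (split 42 (dead 4) (split 44 (iso 453267810) (dead
    3)))) (split 35 (split 42 (split 44 (dead 4) (iso 482376510)) (dead 3)) (dead 4))) (dead 1))
    (dead 1)) (split 33 (dead 6) (split 21 (split 24 (dead 2) (dead 1)) (dead 1)))) (split 33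
    (dead 3) (split 21 (split 24 (dead 2) (dead 8)) (dead 4)))))))))))) (dead 5))))) (dead 5)))
    (split 34 (split 16 (dead 7) (split 43 (dead 7) (split 32 (dead 5) (split 25 (split 41
    (split 52 (dead 5) (split 11 (split 12 (split 13 (dead 1) (split 15 (dead 1) (split 17 (dead
    1) (split 42 (split 22 (dead 4) (split 24 (dead 6) (split 31 (dead 3) (split 26 (dead 2)
    (split 33 (dead 3) (split 35 (dead 3) (split 44 (split 21 (split 62 (iso 451086327) (iso
    15432867)) (split 62 (iso 451086327) (iso 451086327))) (dead 1)))))))) (dead 1))))) (split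
    22 (split 21 (dead 2) (split 24 (dead 2) (split 26 (dead 2) (split 33 (split 15 (dead 6)
    (split 31 (dead 3) (split 17 (dead 1) (split 35 (split 42 (dead 4) (split 44 (dead 4) (split
    13 (split 62 (iso 372086415) (iso 27341865)) (split 62 (iso 372086415) (iso 372086415)))))
    (dead 2))))) (dead 2))))) (split 15 (split 13 (dead 1) (split 17 (dead 1) (split 31 (split
    42 (dead 4) (split 44 (split 21 (split 24 (dead 2) (split 26 (dead 2) (split 33 (dead 3)
    (split 35 (dead 3) (split 62 (iso 246587301) (dead 2)))))) (split 62 (dead 6) (split 24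
    (split 26 (dead 2) (split 33 (dead 3) (split 35 (iso 253487610) (dead 2)))) (split 26 (split
    33 (split 35 (dead 3) (iso 264378510)) (dead 2)) (dead 3))))) (dead 1))) (dead 1)))) (split
    44 (split 26 (dead 8) (split 31 (dead 4) (split 17 (dead 1) (split 24 (dead 2) (split 21
    (split 33 (split 13 (split 35 (dead 3) (split 42 (dead 4) (split 62 (iso 237685410) (dead
    1)))) (dead 3)) (dead 4)) (dead 4)))))) (split 31 (split 24 (split 21 (dead 2) (split 26
    (dead 2) (split 33 (dead 3) (split 35 (split 13 (split 17 (dead 1) (split 42 (dead 4) (split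
    62 (iso 136785402) (dead 1)))) (split 17 (split 42 (split 62 (dead 6) (iso 284376510)) (dead
    1)) (dead 6))) (dead 2))))) (split 35 (dead 3) (split 17 (split 13 (dead 1) (split 42 (split
    21 (split 26 (dead 2) (split 33 (dead 3) (split 62 (iso 248567301) (dead 2)))) (split 26
    (split 33 (split 62 (dead 6) (iso 253467810)) (dead 2)) (dead 6))) (dead 1))) (split 21
    (dead 3) (split 13 (split 26 (split 33 (split 42 (dead 4) (split 62 (iso 138765402) (dead
    1))) (dead 1)) (dead 3)) (dead 6)))))) (split 17 (dead 1) (split 24 (dead 2) (split 26 (dead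
    2) (split 33 (dead 3) (split 35 (split 13 (split 42 (split 21 (split 62 (iso 237865410)
    (dead 1)) (dead 4)) (dead 2)) (dead 3)) (dead 1))))))))))) (split 31 (split 33 (dead 3)
    (split 35 (dead 3) (split 42 (dead 4) (split 44 (dead 4) (split 12 (split 15 (dead 1) (split
    17 (dead 1) (split 21 (dead 2) (split 22 (dead 2) (split 24 (split 26 (split 13 (split 62
    (iso 273086415) (iso 37241865)) (split 62 (iso 273086415) (iso 273086415))) (dead 3)) (dead
    3)))))) (split 15 (split 24 (dead 6) (split 13 (split 17 (dead 1) (split 21 (split 22 (dead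
    4) (split 26 (split 62 (iso 415687230) (dead 3)) (dead 1))) (dead 1))) (split 26 (dead 2)
    (split 17 (split 22 (split 21 (split 62 (iso 154086327) (iso 45132867)) (split 62 (iso
    154086327) (iso 154086327))) (dead 1)) (dead 4))))) (split 17 (split 22 (dead 4) (split 21
    (split 24 (split 13 (split 26 (dead 2) (split 62 (iso 415867230) (dead 3))) (dead 2)) (dead
    1)) (dead 1))) (dead 2)))))))) (split 15 (split 17 (dead 1) (split 42 (split 22 (dead 4)
    (split 12 (dead 1) (split 24 (dead 6) (split 26 (split 33 (dead 6) (split 35 (split 44 (dead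
    4) (split 62 (dead 6) (split 13 (split 21 (iso 876532410) (iso 658741320)) (split 21 (iso
    876532410) (iso 876532410))))) (dead 6))) (dead 6))))) (split 44 (split 24 (split 26 (dead
    2) (split 33 (dead 6) (split 35 (split 62 (dead 6) (split 12 (split 13 (dead 1) (split 21
    (dead 2) (split 22 (iso 364278510) (dead 1)))) (split 13 (split 21 (split 22 (dead 2) (iso
    463278510)) (dead 1)) (dead 2)))) (dead 6)))) (split 35 (dead 8) (split 12 (split 13 (dead
    1) (split 22 (split 21 (split 26 (dead 2) (split 33 (dead 3) (split 62 (iso 346587201) (dead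
    2)))) (split 26 (split 33 (split 62 (dead 6) (iso 352487610)) (dead 2)) (dead 6))) (dead
    1))) (split 21 (split 22 (dead 4) (split 26 (split 13 (split 33 (split 62 (dead 6) (iso
    462378510)) (dead 4)) (dead 2)) (dead 1))) (dead 4))))) (split 12 (dead 1) (split 24 (dead
    2) (split 33 (dead 6) (split 22 (split 26 (dead 2) (split 21 (split 35 (split 13 (split 62
    (iso 415687320) (dead 2)) (dead 3)) (dead 1)) (dead 1))) (dead 8)))))))) (split 44 (split 22
    (dead 4) (split 26 (dead 8) (split 35 (dead 8) (split 42 (dead 4) (split 24 (split 12 (split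
    17 (dead 1) (split 13 (split 33 (dead 3) (split 21 (split 62 (iso 327685410) (dead 1)) (dead
    4))) (dead 2))) (split 17 (split 33 (split 62 (dead 6) (split 13 (split 21 (iso 678532410)
    (iso 587641320)) (split 21 (iso 678532410) (iso 678532410)))) (dead 8)) (dead 6))) (split 12
    (dead 1) (dead 8))))))) (split 24 (split 26 (dead 2) (split 33 (dead 6) (split 35 (split 12
    (split 21 (dead 3) (split 22 (split 13 (split 17 (dead 1) (split 42 (dead 4) (split 62 (iso
    436785102) (dead 1)))) (split 17 (split 42 (split 62 (dead 6) (iso 352467810)) (dead 1))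
    (dead 6))) (dead 3))) (split 13 (split 17 (split 21 (split 22 (dead 2) (split 42 (split 62
    (dead 6) (iso 482376510)) (dead 3))) (dead 1)) (dead 2)) (dead 2))) (split 12 (split 13
    (split 17 (dead 1) (dead 2)) (dead 2)) (dead 6))))) (split 35 (split 12 (dead 3) (split 13
    (split 17 (dead 8) (split 22 (split 21 (dead 2) (split 26 (dead 2) (split 33 (dead 3) (dead
    2)))) (dead 8))) (dead 3))) (split 12 (split 22 (split 17 (split 13 (dead 1) (split 42
    (split 21 (split 26 (dead 2) (split 33 (dead 3) (split 62 (iso 348567201) (dead 2)))) (split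
    26 (split 33 (split 62 (dead 6) (iso 384276510)) (dead 2)) (dead 6))) (dead 1))) (split 21
    (dead 2) (split 13 (split 26 (split 33 (split 42 (dead 4) (split 62 (iso 438765102) (dead
    1))) (dead 2)) (dead 1)) (dead 6)))) (split 17 (dead 1) (split 26 (split 33 (dead 3) (split
    13 (split 42 (split 21 (split 62 (iso 327865410) (dead 1)) (dead 4)) (dead 2)) (dead 2)))
    (dead 1)))) (split 13 (split 17 (split 21 (split 33 (split 22 (split 26 (dead 2) (split 42
    (dead 4) (split 62 (iso 415867320) (dead 2)))) (split 26 (split 42 (split 62 (dead 6) (iso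
    483276510)) (dead 2)) (dead 6))) (dead 1)) (dead 1)) (split 22 (dead 2) (dead 6))) (split 26
    (dead 2) (split 21 (split 22 (split 17 (split 33 (dead 3) (dead 4)) (dead 2)) (dead 6))
    (dead 6)))))))))))) (dead 7)) (split 41 (dead 5) (split 22 (split 12 (split 15 (dead 1)
    (split 17 (dead 1) (split 33 (dead 3) (split 35 (dead 3) (split 52 (split 11 (split 13 (dead
    1) (split 24 (dead 2) (split 26 (dead 2) (split 31 (dead 3) (split 21 (split 42 (split 44
    (split 62 (iso 573186204) (iso 137520864)) (dead 1)) (dead 1)) (dead 5)))))) (split 13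
    (split 24 (split 21 (dead 2) (split 26 (split 31 (split 42 (dead 4) (split 44 (dead 4)
    (split 62 (iso 573186402) (iso 137540862)))) (dead 5)) (dead 1))) (dead 1)) (dead 7)))
    (split 24 (dead 2) (split 13 (dead 1) (split 11 (split 26 (dead 2) (split 31 (dead 3) (split
    21 (split 42 (dead 4) (dead 1)) (dead 5)))) (dead 7))))))))) (split 52 (split 11 (split 15
    (split 13 (dead 1) (split 17 (dead 1) (split 31 (split 42 (dead 4) (split 44 (split 21
    (split 24 (dead 2) (split 26 (dead 2) (split 33 (dead 3) (split 35 (dead 3) (split 62 (iso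
    784365201) (dead 3)))))) (split 62 (dead 8) (split 24 (split 26 (dead 2) (split 33 (dead 3)
    (split 35 (iso 438756120) (dead 2)))) (split 26 (split 33 (split 35 (dead 3) (iso
    235678401)) (dead 2)) (dead 3))))) (dead 1))) (dead 1)))) (split 44 (split 26 (dead 8)
    (split 31 (dead 4) (split 17 (dead 1) (split 21 (split 24 (dead 2) (split 33 (split 13
    (split 35 (dead 3) (split 42 (dead 4) (split 62 (iso 584176203) (dead 1)))) (dead 3)) (dead
    4))) (dead 5))))) (split 26 (split 21 (dead 2) (split 24 (dead 2) (split 31 (split 33 (split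
    35 (dead 3) (split 13 (split 17 (dead 1) (split 42 (dead 4) (split 62 (iso 582176403) (dead
    1)))) (split 42 (split 17 (split 62 (dead 6) (iso 436758120)) (dead 4)) (dead 8)))) (dead
    2)) (dead 5)))) (split 33 (dead 3) (split 31 (split 17 (split 13 (dead 1) (split 42 (split
    21 (split 24 (dead 2) (split 35 (dead 3) (split 62 (iso 764385201) (dead 3)))) (split 35
    (split 24 (split 62 (dead 6) (iso 235876401)) (dead 3)) (dead 6))) (dead 1))) (split 21
    (dead 3) (split 24 (split 13 (split 35 (split 42 (dead 4) (split 62 (iso 562187403) (dead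
    1))) (dead 1)) (dead 6)) (dead 3)))) (split 17 (dead 1) (split 21 (split 13 (split 24 (dead
    2) (split 35 (split 42 (split 62 (iso 564187203) (dead 1)) (dead 3)) (dead 1))) (dead 3))
    (dead 5)))))))) (split 13 (split 21 (split 33 (split 31 (dead 3) (split 35 (dead 3) (split
    42 (dead 4) (split 44 (split 62 (dead 8) (split 15 (split 17 (dead 1) (split 24 (dead 2)
    (split 26 (iso 435678201) (dead 1)))) (split 24 (split 17 (split 26 (dead 2) (iso
    418576320)) (dead 2)) (dead 8)))) (dead 3))))) (split 44 (dead 4) (split 15 (split 17 (dead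
    1) (split 24 (dead 2) (split 26 (split 31 (split 35 (dead 3) (split 42 (dead 4) (split 62
    (iso 873265401) (dead 3)))) (split 42 (split 35 (split 62 (dead 6) (iso 416578320)) (dead
    4)) (dead 8))) (dead 1)))) (split 26 (dead 2) (split 17 (split 24 (split 31 (split 35 (dead
    3) (split 42 (dead 4) (split 62 (iso 673285401) (dead 3)))) (split 35 (split 42 (split 62
    (dead 6) (iso 435876201)) (dead 3)) (dead 6))) (dead 1)) (split 24 (dead 2) (split 31 (dead
    3) (split 35 (split 42 (dead 6) (dead 3)) (dead 1))))))))) (split 15 (dead 1) (split 17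
    (dead 1) (split 31 (split 24 (split 26 (dead 2) (dead 3)) (dead 3)) (dead 5))))) (dead 7)))
    (split 24 (dead 2) (split 26 (dead 2) (split 42 (dead 4) (split 17 (dead 1) (split 35 (dead
    3) (split 44 (dead 4) (split 15 (dead 1) (dead 3)))))))))) (split 11 (split 13 (split 12
    (dead 1) (split 15 (dead 1) (split 17 (dead 1) (split 21 (split 24 (dead 2) (split 26 (dead
    2) (split 31 (dead 3) (dead 5)))) (dead 5))))) (dead 7)) (dead 7)))))))) (split 41 (dead 5)
    (split 32 (split 25 (split 16 (dead 7) (split 43 (split 52 (dead 5) (split 11 (split 13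
    (split 12 (dead 1) (split 15 (dead 1) (split 17 (dead 1) (split 33 (split 21 (dead 3) (split
    24 (dead 6) (split 31 (dead 3) (split 26 (dead 2) (split 35 (split 42 (dead 4) (split 44
    (dead 4) (split 22 (split 62 (iso 351086427) (iso 15342867)) (split 62 (iso 351086427) (iso
    351086427))))) (dead 1)))))) (dead 1))))) (split 21 (split 22 (dead 2) (split 24 (dead 2)
    (split 26 (dead 2) (split 33 (dead 3) (split 17 (dead 1) (split 31 (dead 3) (split 15 (dead
    1) (split 35 (dead 3) (split 42 (split 44 (split 12 (split 62 (iso 472086315) (iso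
    27431865)) (split 62 (iso 472086315) (iso 472086315))) (dead 2)) (dead 2)))))))))) (split 15
    (split 12 (dead 1) (split 17 (dead 1) (split 31 (split 33 (dead 3) (split 35 (split 22
    (split 24 (dead 2) (split 26 (dead 2) (split 42 (dead 4) (split 44 (dead 4) (split 62 (iso
    236587401) (dead 2)))))) (split 62 (dead 6) (split 24 (split 26 (dead 2) (split 42 (dead 4)
    (split 44 (iso 254387610) (dead 2)))) (split 26 (split 42 (split 44 (dead 4) (iso
    263478510)) (dead 2)) (dead 4))))) (dead 1))) (dead 1)))) (split 35 (split 26 (dead 8)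
    (split 31 (dead 3) (split 17 (dead 1) (split 24 (dead 2) (split 22 (split 33 (dead 3) (split
    42 (split 12 (split 44 (dead 4) (split 62 (iso 247685310) (dead 1))) (dead 4)) (dead 3)))
    (dead 3)))))) (split 31 (split 24 (split 22 (dead 2) (split 26 (dead 2) (split 42 (dead 4)
    (split 44 (split 12 (split 17 (dead 1) (split 33 (dead 3) (split 62 (iso 146785302) (dead
    1)))) (split 17 (split 33 (split 62 (dead 6) (iso 283476510)) (dead 1)) (dead 6))) (dead
    2))))) (split 44 (dead 4) (split 17 (split 12 (dead 1) (split 33 (split 22 (split 26 (dead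
    2) (split 42 (dead 4) (split 62 (iso 238567401) (dead 2)))) (split 26 (split 42 (split 62
    (dead 6) (iso 254367810)) (dead 2)) (dead 6))) (dead 1))) (split 22 (dead 4) (split 12
    (split 26 (split 33 (dead 3) (split 42 (split 62 (iso 148765302) (dead 1)) (dead 1))) (dead
    3)) (dead 6)))))) (split 17 (dead 1) (split 24 (dead 2) (split 26 (dead 2) (split 33 (split
    22 (split 42 (dead 4) (split 44 (split 12 (split 62 (iso 247865310) (dead 1)) (dead 4))
    (dead 1))) (dead 3)) (dead 4)))))))))) (split 31 (split 33 (dead 3) (split 35 (dead 3)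
    (split 42 (dead 4) (split 44 (dead 4) (split 13 (split 15 (dead 1) (split 17 (dead 1) (split
    21 (dead 2) (split 22 (dead 2) (split 24 (split 26 (split 12 (split 62 (iso 274086315) (iso
    47231865)) (split 62 (iso 274086315) (iso 274086315))) (dead 4)) (dead 4)))))) (split 15
    (split 24 (dead 6) (split 12 (split 17 (dead 1) (split 21 (dead 3) (split 22 (split 26
    (split 62 (iso 427865130) (dead 3)) (dead 1)) (dead 1)))) (split 26 (dead 2) (split 17
    (split 21 (split 22 (split 62 (iso 153086427) (iso 35142867)) (split 62 (iso 153086427) (iso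
    153086427))) (dead 1)) (dead 3))))) (split 17 (split 21 (dead 3) (split 22 (split 24 (split
    12 (split 26 (dead 2) (split 62 (iso 427685130) (dead 3))) (dead 2)) (dead 1)) (dead 1)))
    (dead 2)))))))) (split 15 (split 17 (dead 1) (split 33 (split 21 (dead 3) (split 13 (dead 1)
    (split 24 (dead 6) (split 26 (split 35 (dead 3) (split 42 (dead 4) (split 44 (split 62 (dead
    6) (split 12 (split 22 (iso 876542310) (iso 658731420)) (split 22 (iso 876542310) (iso
    876542310)))) (dead 6)))) (dead 6))))) (split 35 (split 24 (split 26 (dead 2) (split 42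
    (dead 6) (split 44 (split 62 (dead 6) (split 12 (split 13 (dead 1) (split 21 (dead 2) (split
    22 (iso 364278510) (dead 1)))) (split 13 (split 21 (split 22 (dead 2) (iso 463278510)) (dead
    1)) (dead 2)))) (dead 6)))) (split 44 (dead 8) (split 13 (split 12 (dead 1) (split 21 (split
    22 (split 26 (dead 2) (split 42 (dead 4) (split 62 (iso 436587201) (dead 2)))) (split 26
    (split 42 (split 62 (dead 6) (iso 452387610)) (dead 2)) (dead 6))) (dead 1))) (split 21
    (dead 3) (split 22 (split 26 (split 12 (split 42 (split 62 (dead 6) (iso 362478510)) (dead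
    3)) (dead 2)) (dead 1)) (dead 1)))))) (split 13 (dead 1) (split 24 (dead 2) (split 42 (dead
    6) (split 21 (split 26 (dead 2) (split 22 (split 44 (split 12 (split 62 (iso 315687420)
    (dead 2)) (dead 4)) (dead 1)) (dead 1))) (dead 8)))))))) (split 35 (split 21 (dead 3) (split
    26 (dead 8) (split 33 (dead 3) (split 44 (dead 4) (split 24 (split 13 (split 17 (dead 1)
    (split 12 (split 42 (dead 4) (split 22 (split 62 (iso 427685310) (dead 1)) (dead 3))) (dead
    2))) (split 17 (split 42 (split 62 (dead 6) (split 12 (split 22 (iso 678542310) (iso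
    587631420)) (split 22 (iso 678542310) (iso 678542310)))) (dead 8)) (dead 6))) (split 13
    (dead 1) (dead 8))))))) (split 24 (split 26 (dead 2) (split 42 (dead 6) (split 44 (split 13
    (split 21 (split 22 (dead 2) (split 12 (split 17 (dead 1) (split 33 (dead 3) (split 62 (iso
    346785102) (dead 1)))) (split 17 (split 33 (split 62 (dead 6) (iso 452367810)) (dead 1))
    (dead 6)))) (dead 4)) (split 12 (split 17 (split 21 (dead 2) (split 22 (split 33 (split 62
    (dead 6) (iso 382476510)) (dead 4)) (dead 1))) (dead 2)) (dead 2))) (split 12 (split 13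
    (split 17 (dead 1) (dead 2)) (dead 6)) (dead 2))))) (split 44 (split 12 (split 13 (dead 4)
    (split 17 (dead 8) (split 21 (split 22 (dead 2) (split 26 (dead 2) (split 33 (dead 3) (dead
    4)))) (dead 8)))) (dead 4)) (split 12 (split 22 (split 17 (split 13 (dead 1) (split 42
    (split 21 (split 26 (dead 2) (split 33 (dead 3) (split 62 (iso 315867420) (dead 2)))) (split
    26 (split 33 (split 62 (dead 6) (iso 384276510)) (dead 2)) (dead 6))) (dead 1))) (split 21
    (dead 2) (split 13 (split 26 (split 33 (split 42 (dead 4) (split 62 (iso 427865310) (dead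
    1))) (dead 2)) (dead 1)) (dead 6)))) (split 17 (dead 1) (split 33 (dead 3) (split 13 (split
    21 (split 26 (split 42 (split 62 (iso 348765102) (dead 1)) (dead 2)) (dead 1)) (dead 4))
    (dead 2))))) (split 13 (split 17 (split 21 (split 33 (split 22 (split 26 (dead 2) (split 42
    (dead 4) (split 62 (iso 438567201) (dead 2)))) (split 26 (split 42 (split 62 (dead 6) (iso
    483276510)) (dead 2)) (dead 6))) (dead 1)) (dead 1)) (split 22 (split 21 (dead 2) (split 26
    (dead 2) (dead 1))) (dead 6))) (split 26 (dead 2) (split 21 (split 17 (split 22 (split 33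
    (dead 3) (split 42 (dead 4) (dead 1))) (dead 6)) (dead 2)) (dead 6)))))))))))) (dead 5)))
    (dead 5)) (split 16 (split 25 (dead 7) (split 43 (dead 7) (split 11 (split 12 (dead 1)
    (split 13 (dead 1) (split 15 (dead 1) (split 17 (dead 1) (split 24 (dead 2) (split 26 (dead
    2) (split 21 (split 22 (split 31 (split 62 (split 33 (split 35 (dead 3) (split 42 (dead 6)
    (split 44 (split 52 (iso 684375201) (iso 348620751)) (dead 1)))) (split 35 (split 42 (split
    44 (dead 4) (split 52 (iso 864375201) (iso 438620751))) (dead 1)) (dead 1))) (split 33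
    (split 35 (dead 3) (dead 1)) (dead 1))) (split 33 (split 35 (dead 3) (dead 1)) (dead 1)))
    (split 31 (split 33 (dead 6) (split 35 (dead 8) (dead 1))) (dead 5))) (split 22 (split 31
    (split 42 (dead 6) (split 33 (split 35 (dead 3) (split 44 (dead 8) (dead 1))) (dead 1)))
    (dead 5)) (dead 5))))))))) (split 12 (split 13 (dead 1) (split 15 (dead 1) (split 17 (dead
    1) (split 33 (dead 3) (split 35 (dead 3) (split 21 (split 22 (split 31 (split 62 (split 24
    (split 26 (dead 2) (split 42 (dead 6) (split 44 (split 52 (iso 684275301) (iso 248630751))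
    (dead 1)))) (split 26 (split 42 (split 44 (dead 4) (split 52 (iso 864275301) (iso
    428630751))) (dead 1)) (dead 1))) (split 24 (split 26 (dead 2) (dead 1)) (dead 1))) (split
    24 (dead 6) (split 26 (dead 8) (dead 1)))) (split 24 (split 26 (dead 2) (dead 1)) (dead 1)))
    (split 22 (split 31 (split 42 (dead 6) (split 24 (split 26 (dead 2) (split 44 (dead 8) (dead
    1))) (dead 1))) (dead 5)) (dead 5)))))))) (split 13 (split 15 (dead 1) (split 17 (dead 1)
    (split 42 (dead 4) (split 44 (dead 4) (split 21 (split 22 (split 31 (split 62 (split 24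
    (split 26 (dead 2) (split 33 (dead 6) (split 35 (split 52 (iso 683275401) (iso 238640751))
    (dead 1)))) (split 26 (split 33 (split 35 (dead 3) (split 52 (iso 863275401) (iso
    328640751))) (dead 1)) (dead 1))) (split 24 (split 26 (dead 2) (dead 1)) (dead 1))) (split
    24 (dead 6) (split 26 (dead 8) (dead 1)))) (split 31 (split 33 (dead 6) (split 24 (split 26
    (dead 2) (split 35 (dead 8) (dead 1))) (dead 1))) (dead 5))) (split 22 (split 24 (split 26
    (dead 2) (dead 1)) (dead 1)) (dead 5))))))) (split 62 (split 24 (dead 6) (split 26 (dead 8)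
    (split 33 (dead 6) (split 17 (dead 1) (split 35 (dead 8) (dead 1)))))) (split 21 (split 15
    (split 17 (dead 1) (split 44 (split 42 (dead 4) (split 24 (split 26 (dead 2) (split 22
    (split 33 (dead 6) (split 35 (split 31 (split 52 (iso 162075438) (iso 26143758)) (split 52
    (iso 162075438) (iso 162075438))) (dead 1))) (dead 1))) (split 33 (split 26 (split 35 (dead
    3) (split 31 (split 22 (split 52 (iso 163075428) (iso 36142758)) (split 52 (iso 163075428)
    (iso 163075428))) (dead 1))) (dead 6)) (dead 8)))) (split 22 (split 24 (dead 6) (split 26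
    (split 31 (split 33 (dead 6) (split 35 (split 42 (split 52 (iso 164075328) (iso 46132758))
    (dead 8)) (dead 1))) (dead 1)) (dead 1))) (dead 1)))) (split 42 (split 44 (dead 4) (split 17
    (split 24 (split 26 (dead 2) (split 33 (dead 6) (split 31 (split 35 (split 22 (split 52 (iso
    183075426) (iso 38142756)) (split 52 (iso 183075426) (iso 183075426))) (dead 6)) (dead 1))))
    (split 22 (split 33 (split 26 (split 35 (dead 3) (split 31 (split 52 (iso 182075436) (iso
    28143756)) (split 52 (iso 182075436) (iso 182075436)))) (dead 6)) (dead 1)) (dead 1)))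
    (split 24 (dead 6) (split 22 (split 26 (split 33 (dead 6) (dead 8)) (dead 6)) (dead 1)))))
    (split 26 (dead 8) (split 22 (split 35 (dead 8) (split 24 (split 17 (split 31 (split 33
    (split 44 (split 52 (iso 184075326) (iso 48132756)) (dead 6)) (dead 1)) (dead 1)) (dead 6))
    (dead 1))) (dead 1))))) (split 22 (split 31 (split 24 (split 26 (dead 2) (split 15 (dead 1)
    (split 33 (split 17 (split 35 (dead 3) (split 42 (dead 6) (split 44 (split 52 (iso
    184075326) (iso 184075326)) (dead 6)))) (dead 6)) (dead 1)))) (split 17 (dead 1) (split 35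
    (split 15 (split 26 (split 33 (dead 3) (split 42 (split 44 (dead 4) (split 52 (iso
    164075328) (iso 164075328))) (dead 8))) (dead 1)) (dead 8)) (dead 1)))) (dead 5)) (dead
    5))))))))) (split 25 (split 43 (dead 7) (split 31 (split 11 (split 15 (dead 1) (split 17
    (dead 1) (split 24 (dead 2) (split 26 (dead 2) (split 52 (split 12 (split 13 (dead 1) (split
    33 (dead 3) (split 22 (dead 2) (split 21 (split 35 (dead 3) (split 42 (split 44 (split 62
    (iso 572186304) (iso 127530864)) (dead 1)) (dead 1))) (dead 5))))) (split 13 (split 33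
    (split 21 (dead 3) (split 22 (split 35 (split 42 (dead 4) (split 44 (dead 4) (split 62 (iso
    572186403) (iso 127540863)))) (dead 1)) (dead 5))) (dead 1)) (dead 7))) (split 33 (dead 3)
    (split 13 (dead 1) (split 12 (split 22 (dead 2) (split 21 (split 35 (dead 3) (split 42 (dead
    4) (dead 1))) (dead 5))) (dead 7))))))))) (split 52 (split 12 (split 15 (split 13 (dead 1)
    (split 17 (dead 1) (split 22 (split 42 (dead 4) (split 44 (split 21 (split 24 (dead 2)
    (split 26 (dead 2) (split 33 (dead 3) (split 35 (dead 3) (split 62 (iso 784265301) (dead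
    2)))))) (split 62 (dead 8) (split 24 (split 26 (dead 2) (split 33 (dead 3) (split 35 (iso
    325678401) (dead 2)))) (split 33 (split 26 (split 35 (dead 3) (iso 428756130)) (dead 3))
    (dead 8))))) (dead 1))) (dead 1)))) (split 44 (split 22 (dead 4) (split 17 (dead 1) (split
    21 (split 24 (split 13 (split 26 (dead 2) (split 33 (dead 3) (split 35 (dead 3) (split 42
    (dead 4) (split 62 (iso 584176302) (dead 1)))))) (dead 2)) (dead 4)) (dead 5)))) (split 24
    (split 21 (dead 2) (split 22 (split 26 (dead 2) (split 33 (dead 3) (split 35 (split 13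
    (split 17 (dead 1) (split 42 (dead 4) (split 62 (iso 583176402) (dead 1)))) (split 42 (split
    17 (split 62 (dead 6) (iso 426758130)) (dead 4)) (dead 8))) (dead 2)))) (dead 5))) (split 35
    (dead 3) (split 22 (split 17 (split 13 (dead 1) (split 42 (split 21 (split 26 (dead 2)
    (split 33 (dead 3) (split 62 (iso 764285301) (dead 2)))) (split 26 (split 33 (split 62 (dead
    6) (iso 325876401)) (dead 2)) (dead 6))) (dead 1))) (split 21 (dead 2) (split 33 (split 13
    (split 26 (split 42 (dead 4) (split 62 (iso 563187402) (dead 1))) (dead 1)) (dead 6)) (dead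
    2)))) (split 17 (dead 1) (split 21 (split 13 (split 26 (split 33 (dead 3) (split 42 (split
    62 (iso 564187302) (dead 1)) (dead 2))) (dead 1)) (dead 2)) (dead 5)))))))) (split 13 (split
    21 (split 24 (split 22 (dead 2) (split 26 (dead 2) (split 42 (dead 4) (split 44 (split 62
    (dead 8) (split 15 (split 17 (dead 1) (split 33 (dead 3) (split 35 (iso 425678301) (dead
    1)))) (split 33 (split 17 (split 35 (dead 3) (iso 418576230)) (dead 3)) (dead 8)))) (dead
    2))))) (split 44 (dead 4) (split 15 (split 17 (dead 1) (split 33 (dead 3) (split 35 (split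
    22 (split 26 (dead 2) (split 42 (dead 4) (split 62 (iso 783265401) (dead 2)))) (split 42
    (split 26 (split 62 (dead 6) (iso 416578230)) (dead 4)) (dead 8))) (dead 1)))) (split 35
    (dead 3) (split 17 (split 33 (split 22 (split 26 (dead 2) (split 42 (dead 4) (split 62 (iso
    763285401) (dead 2)))) (split 26 (split 42 (split 62 (dead 6) (iso 425876301)) (dead 2))
    (dead 6))) (dead 1)) (split 22 (dead 2) (split 33 (dead 3) (split 26 (split 42 (dead 6)
    (dead 2)) (dead 1))))))))) (split 15 (dead 1) (split 17 (dead 1) (split 22 (split 24 (dead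
    2) (split 26 (dead 2) (split 33 (dead 3) (dead 1)))) (dead 5))))) (dead 7))) (split 33 (dead
    3) (split 35 (dead 3) (split 42 (dead 4) (split 17 (dead 1) (split 26 (dead 2) (split 44
    (dead 4) (split 15 (dead 1) (dead 2)))))))))) (split 12 (split 13 (split 11 (dead 1) (split
    15 (dead 1) (split 17 (dead 1) (split 21 (split 22 (dead 2) (dead 5)) (dead 5))))) (dead 7))
    (dead 7)))) (split 13 (split 15 (dead 1) (split 17 (dead 1) (split 42 (dead 4) (split 44
    (dead 4) (split 11 (split 12 (dead 1) (split 33 (split 24 (dead 6) (split 35 (split 26 (dead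
    8) (split 31 (dead 3) (split 21 (split 22 (split 43 (split 52 (split 62 (iso 574186203) (iso
    147520863)) (dead 3)) (dead 3)) (dead 5)) (dead 5)))) (dead 1))) (dead 1))) (split 12 (split
    24 (split 26 (split 22 (dead 2) (split 21 (split 31 (split 33 (dead 3) (split 35 (dead 3)
    (split 43 (split 52 (split 62 (iso 574186302) (iso 147530862)) (dead 2)) (dead 2)))) (dead
    5)) (dead 5))) (dead 1)) (dead 1)) (split 43 (dead 7) (split 24 (dead 2) (split 26 (dead 2)
    (split 33 (dead 3) (dead 1))))))))))) (split 21 (split 52 (split 15 (split 17 (dead 1)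
    (split 43 (split 11 (split 12 (dead 1) (split 31 (split 33 (dead 3) (split 35 (split 22
    (split 24 (dead 2) (split 26 (dead 2) (split 42 (dead 4) (split 44 (dead 4) (split 62 (iso
    874365201) (dead 4)))))) (split 62 (dead 8) (split 24 (split 26 (dead 2) (split 42 (dead 4)
    (split 44 (iso 348756120) (dead 2)))) (split 26 (split 42 (split 44 (dead 4) (iso
    245678301)) (dead 2)) (dead 4))))) (dead 1))) (dead 1))) (split 12 (split 22 (split 24 (dead
    2) (split 26 (split 31 (split 33 (dead 3) (split 35 (dead 3) (split 42 (dead 4) (split 44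
    (dead 4) (split 62 (iso 874265301) (dead 4)))))) (split 62 (dead 8) (split 33 (split 35
    (dead 3) (split 42 (dead 4) (split 44 (iso 316578420) (dead 3)))) (split 35 (split 42 (split
    44 (dead 4) (iso 345678201)) (dead 3)) (dead 4))))) (dead 1))) (dead 1)) (dead 7))) (split
    11 (dead 1) (split 12 (dead 1) (split 24 (dead 2) (split 33 (dead 3) (split 42 (dead 4)
    (split 26 (dead 8) (split 22 (split 35 (dead 8) (dead 1)) (dead 1)))))))))) (split 26 (split
    22 (dead 2) (split 24 (dead 2) (split 31 (split 35 (dead 3) (split 42 (split 43 (split 11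
    (split 44 (dead 4) (split 12 (split 17 (dead 1) (split 33 (dead 3) (split 62 (iso 582176304)
    (dead 1)))) (split 33 (split 17 (split 62 (dead 6) (iso 346758120)) (dead 3)) (dead 8))))
    (dead 4)) (dead 2)) (dead 2))) (dead 5)))) (split 35 (split 31 (dead 3) (split 22 (split 33
    (dead 3) (split 42 (split 43 (split 12 (split 44 (dead 4) (split 11 (split 17 (dead 1)
    (split 24 (dead 2) (split 62 (iso 583176204) (dead 1)))) (split 24 (split 17 (split 62 (dead
    6) (iso 318576420)) (dead 2)) (dead 8)))) (dead 4)) (dead 3)) (dead 3))) (dead 5))) (split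
    42 (split 17 (split 24 (dead 6) (split 12 (dead 1) (split 11 (split 33 (dead 6) (dead 1))
    (dead 6)))) (dead 4)) (split 22 (split 12 (split 43 (split 17 (split 11 (dead 1) (split 24
    (split 31 (split 33 (dead 3) (split 44 (dead 4) (split 62 (iso 674285301) (dead 4)))) (split
    44 (split 33 (split 62 (dead 6) (iso 345876201)) (dead 4)) (dead 6))) (dead 1))) (split 24
    (dead 2) (split 31 (dead 4) (split 33 (split 11 (split 44 (split 62 (iso 563187204) (dead
    1)) (dead 1)) (dead 6)) (dead 4))))) (split 11 (dead 1) (split 17 (dead 1) (split 24 (dead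
    2) (dead 1))))) (split 44 (dead 4) (split 24 (dead 6) (split 31 (split 33 (split 11 (split
    17 (split 43 (split 62 (iso 674385201) (dead 4)) (dead 1)) (dead 3)) (dead 6)) (dead 1))
    (dead 1))))) (split 31 (split 11 (split 24 (split 43 (split 44 (split 12 (split 17 (dead 1)
    (split 33 (dead 3) (split 62 (iso 562187304) (dead 1)))) (split 17 (split 33 (split 62 (dead
    6) (iso 245876301)) (dead 1)) (dead 6))) (dead 2)) (dead 2)) (split 44 (dead 4) (split 12
    (dead 1) (split 33 (dead 6) (dead 1))))) (split 44 (dead 4) (split 12 (dead 1) (split 24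
    (dead 6) (split 33 (dead 6) (dead 1)))))) (dead 5))))))) (split 24 (dead 2) (split 26 (dead
    2) (split 33 (dead 3) (split 17 (dead 1) (split 35 (dead 3) (split 15 (dead 1) (split 42
    (dead 4) (split 43 (dead 4) (dead 1)))))))))) (split 22 (split 31 (split 24 (split 11 (dead
    2) (split 26 (dead 2) (split 43 (dead 7) (split 15 (dead 1) (split 35 (dead 3) (split 17
    (split 12 (dead 1) (split 33 (split 44 (dead 4) (dead 6)) (dead 1))) (dead 2))))))) (split
    11 (split 26 (dead 2) (split 12 (split 15 (dead 1) (split 17 (dead 1) (split 33 (dead 3)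
    (split 35 (dead 3) (split 42 (dead 4) (split 43 (dead 4) (dead 1))))))) (split 43 (dead 7)
    (split 15 (dead 1) (split 17 (dead 1) (split 33 (dead 3) (split 35 (dead 3) (split 42 (dead
    4) (dead 1))))))))) (split 43 (dead 7) (split 17 (dead 1) (split 33 (dead 3) (split 42 (dead
    4) (split 12 (dead 1) (split 26 (dead 8) (dead 1))))))))) (dead 5)) (dead 5)))))))))

lemma nineCert_check :
    nineCert.check 758533009944134946144798 1203012466040917281733150 = true := by
  decide +kernel

end Certificates

end SquareIsolation

namespace SquareIsolation

open Finset
open scoped Classical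

section Soundness

variable {V : Type*} {G : SimpleGraph V} {f : Fin 9 ↪ V} {A U : ℕ}

/-- The graph `G`, with vertices labelled by `f`, lies between the matrices `A` and `U`. -/
structure Between (G : SimpleGraph V) (f : Fin 9 ↪ V) (A U : ℕ) : Prop where
  adj : ∀ a b : Fin 9, A.testBit (9 * a + b) = true → G.Adj (f a) (f b)
  bit : ∀ a b : Fin 9, G.Adj (f a) (f b) → U.testBit (9 * a + b) = true

lemma evalNat_eq (n : ℕ) (F : ℕ → Bool) : evalNat n F = F n := by
  cases n <;> rfl

lemma testBit_pairBits {e : ℕ} {i j : Fin 9} (he : e = 9 * i + j) (a b : Fin 9) :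
    (pairBits e).testBit (9 * a + b) = true ↔ a = i ∧ b = j ∨ a = j ∧ b = i := by
  have hi : e / 9 = i := by omega
  have hj : e % 9 = j := by omega
  rw [pairBits, hi, hj, Nat.testBit_or, testBit_one_shiftLeft, testBit_one_shiftLeft,
    Bool.or_eq_true, decide_eq_true_iff, decide_eq_true_iff,
    Fin.ext_iff, Fin.ext_iff, Fin.ext_iff, Fin.ext_iff]
  omega

lemma Between.or_pairBits (h : Between G f A U) {e : ℕ} {i j : Fin 9} (he : e = 9 * i + j)
    (hij : G.Adj (f i) (f j)) : Between G f (A ||| pairBits e) U := by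
  refine ⟨fun a b hab => ?_, h.bit⟩
  rw [Nat.testBit_or, Bool.or_eq_true, testBit_pairBits he] at hab
  rcases hab with hab | ⟨rfl, rfl⟩ | ⟨rfl, rfl⟩
  exacts [h.adj a b hab, hij, hij.symm]

lemma Between.remove_pairBits (h : Between G f A U) {e : ℕ} {i j : Fin 9} (he : e = 9 * i + j)
    (hij : ¬ G.Adj (f i) (f j)) : Between G f A (U ^^^ (U &&& pairBits e)) := by
  refine ⟨h.adj, fun a b hab => ?_⟩
  have hp : ¬ (pairBits e).testBit (9 * a + b) = true := by
    rw [testBit_pairBits he]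
    rintro (⟨rfl, rfl⟩ | ⟨rfl, rfl⟩)
    exacts [hij hab, hij hab.symm]
  simp [h.bit a b hab, hp]

lemma Between.not_hasC4 [Fintype V] (h : Between G f A U) (hf : univ.map f = univ) (w : Fin 9)
    (hc : c4free U (compl9 (star A w)) = true) : ¬ HasC4 G (univ \ nbhd G (f w)) := by
  refine not_hasC4_of_c4free h.bit (by simp [hf]) (fun i hi => ?_) hc
  rw [mem_sdiff, mem_nbhd] at hi
  rw [testBit_compl9, testBit_star]
  have h1 : ¬ A.testBit (9 * w + i) = true := fun hA => hi.2 (.inr (h.adj w i hA))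
  have h2 : i.val ≠ w := fun hiw => hi.2 (.inl (by rw [Fin.ext hiw]))
  simp [h1, h2]

lemma Between.bad9 [Fintype V] (h : Between G f A A) (hV : Fintype.card V = 9) {p m : ℕ}
    (hm : m ∈ nineMasks) (hp : isoCheck A p m = true) : Bad9 G univ := by
  simp only [isoCheck, List.all_eq_true, List.mem_range, Bool.and_eq_true, decide_eq_true_iff,
    Bool.or_eq_true, beq_iff_eq, bne_iff_ne] at hp
  obtain ⟨H, hH, hadj⟩ := exists_isNineGraph hm
  let g : Fin 9 → Fin 9 := fun i => ⟨digit p i, (hp i i.2).1⟩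
  have hlt : ∀ a b : Fin 9, a < b → g a ≠ g b ∧ (G.Adj (f (g a)) (f (g b)) ↔ H.Adj a b) :=
    fun a b hab => by
      obtain ⟨hne, heq⟩ := ((hp a a.2).2 b b.2).resolve_left (by simpa using hab)
      refine ⟨fun hc => hne (congrArg Fin.val hc), ?_⟩
      rw [hadj, ← heq]
      exact ⟨h.bit (g a) (g b), h.adj (g a) (g b)⟩
  have hg : g.Injective := fun a b hab => by
    by_contra hne
    exact (lt_or_gt_of_ne hne).elim (fun h => (hlt a b h).1 hab) fun h => (hlt b a h).1 hab.symm
  refine ⟨H, hH, (⟨g, hg⟩ : Fin 9 ↪ Fin 9).trans f, ?_, fun a b => ?_⟩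
  · rw [← card_eq_iff_eq_univ, card_map, card_univ, Fintype.card_fin, hV]
  · rcases lt_trichotomy a b with hab | rfl | hab
    · exact (hlt a b hab).2
    · simp
    · rw [G.adj_comm, H.adj_comm]
      exact (hlt b a hab).2

lemma Cert.bad9 [Fintype V] (hV : Fintype.card V = 9) (hG : ∀ w, HasC4 G (univ \ nbhd G w))
    (c : Cert)
    (h : Between G f A U) (hc : c.check A U = true) : Bad9 G univ := by
  induction c generalizing A U with
  | split e l r hl hr =>
    simp only [check, evalNat_eq, Bool.and_eq_true, decide_eq_true_iff] at hc
    obtain ⟨⟨he, hcl⟩, hcr⟩ := hc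
    have he' : e = 9 * (⟨e / 9, by omega⟩ : Fin 9) + (⟨e % 9, by omega⟩ : Fin 9) :=
      (Nat.div_add_mod e 9).symm
    by_cases hij : G.Adj (f ⟨e / 9, by omega⟩) (f ⟨e % 9, by omega⟩)
    · exact hl (h.or_pairBits he' hij) hcl
    · exact hr (h.remove_pairBits he' hij) hcr
  | dead w =>
    simp only [check, Bool.and_eq_true, decide_eq_true_iff] at hc
    have hf : univ.map f = univ := by
      rw [← card_eq_iff_eq_univ, card_map, card_univ, Fintype.card_fin, hV]
    exact absurd (hG _) (h.not_hasC4 hf ⟨w, hc.1⟩ hc.2)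
  | iso p =>
    simp only [check, Bool.and_eq_true, beq_iff_eq, List.any_eq_true] at hc
    obtain ⟨rfl, m, hm, hp⟩ := hc
    exact h.bad9 hV hm hp

end Soundness

end SquareIsolation

namespace SquareIsolation

open Finset
open scoped Classical

section Counting

variable {V : Type*} [Fintype V] {G : SimpleGraph V}

lemma Bad.conn {S : Finset V} (h : Bad G S) : Conn G S := h.elim Bad4.conn fun h => h.nine.conn

lemma Bad.card {S : Finset V} (h : Bad G S) : #S = 4 ∨ #S = 9 :=
  h.imp And.left fun h => h.nine.card

/-- A bad set that has lost a vertex can be isolated with one vertex less per five. -/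
lemma Bad.touched {S : Finset V} (h : Bad G S) {k : V} (hk : k ∈ S) :
    ∃ D : Finset V, 5 * #D + 4 ≤ #S ∧ ¬ HasC4 G (S.erase k \ nbhds G D) := by
  rcases h with h | h
  · refine ⟨∅, by simp [h.1], not_hasC4_of_card ?_⟩
    have := card_le_card (sdiff_subset (s := S.erase k) (t := nbhds G ∅))
    have := card_erase_of_mem hk
    have := h.1
    omega
  · obtain ⟨u, hu, hC⟩ := h.nine.kill k hk
    exact ⟨{u}, by simp [h.nine.card], by simpa [nbhds] using hC⟩

lemma Bad.untouched {S : Finset V} (h : Bad G S) :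
    ∃ D : Finset V, 5 * #D ≤ #S + 1 ∧ ¬ HasC4 G (S \ nbhds G D) := by
  obtain ⟨k, hk⟩ := h.conn.1
  obtain ⟨D, hD, hC⟩ := h.touched hk
  refine ⟨insert k D, by have := card_insert_le k D; omega, fun h' => hC (h'.mono ?_)⟩
  intro x
  grind

variable (G) in
/-- The setting of a minimal counterexample. -/
structure MinCE : Prop where
  conn : Conn G univ
  notBad : ¬ Bad G univ
  ih : ∀ S ≠ univ, Conn G S → ¬ Bad G S → ∃ D : Finset V, 5 * #D ≤ #S ∧ ¬ HasC4 G (S \ nbhds G D)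
  min : ∀ D, ¬ HasC4 G (univ \ nbhds G D) → Fintype.card V < 5 * #D

variable (G) in
/-- The bad components of `S` that avoid `K`. -/
noncomputable def badComps (S K : Finset V) : Finset (Finset V) :=
  univ.filter fun T => IsComp G T S ∧ Bad G T ∧ Disjoint T K

@[simp, grind] lemma mem_badComps {S K T : Finset V} :
    T ∈ badComps G S K ↔ IsComp G T S ∧ Bad G T ∧ Disjoint T K := by simp [badComps]

/-- Isolating sets of two unlinked parts can be combined. -/
lemma isolate_union {A B D E K : Finset V} (hA : ¬ HasC4 G ((A \ K) \ nbhds G D))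
    (hB : ¬ HasC4 G ((B \ K) \ nbhds G E)) (hAB : ∀ a ∈ A, ∀ b ∈ B, b ∉ A → ¬ G.Adj a b) :
    ¬ HasC4 G (((A ∪ B) \ K) \ nbhds G (D ∪ E)) := by
  intro h
  rcases h.split A (fun a ha haA b hb hbA => hAB a haA b (by grind) hbA) with h | h
  · exact hA (h.mono fun x => by grind)
  · exact hB (h.mono fun x => by grind)

lemma MinCE.exists_isolating (h : MinCE G) (K : Finset V) {S : Finset V} (hS : S ≠ univ) :
    ∃ D : Finset V, ¬ HasC4 G ((S \ K) \ nbhds G D) ∧ 5 * #D ≤ #S + #(badComps G S K) := by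
  induction hn : #S using Nat.strong_induction_on generalizing S with
  | _ n IH =>
  rcases S.eq_empty_or_nonempty with rfl | ⟨a, ha⟩
  · exact ⟨∅, not_hasC4_of_card (by simp), by simp⟩
  obtain ⟨T, hT, haT⟩ := exists_isComp (G := G) ha
  have hcard : #(S \ T) + #T = #S := card_sdiff_add_card_eq_card hT.1
  have hTpos : 0 < #T := card_pos.mpr ⟨a, haT⟩
  obtain ⟨D, hD, hDc⟩ := IH #(S \ T) (by omega) (S := S \ T) (fun hc => by
    have : a ∈ S \ T := hc ▸ mem_univ a
    grind) rfl
  have hun : T ∪ S \ T = S := union_sdiff_of_subset hT.1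
  have hsub : badComps G (S \ T) K ⊆ badComps G S K := fun T' h' => by
    rw [mem_badComps] at h' ⊢
    exact ⟨hT.of_sdiff h'.1, h'.2⟩
  have key : ∀ E : Finset V, ¬ HasC4 G ((T \ K) \ nbhds G E) →
      ¬ HasC4 G ((S \ K) \ nbhds G (E ∪ D)) := fun E hE => by
    have := isolate_union hE hD fun a ha b hb hbT => hT.2.2 a ha b (by grind) hbT
    rwa [hun] at this
  have hsub' := card_le_card hsub
  by_cases hbad : Bad G T
  · by_cases hdis : Disjoint T K
    · obtain ⟨E, hE, hEC⟩ := hbad.untouched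
      refine ⟨E ∪ D, key E fun h' => hEC (h'.mono fun x => by grind), ?_⟩
      have : badComps G (S \ T) K ⊂ badComps G S K := by
        refine (ssubset_iff_of_subset hsub).mpr ⟨T, mem_badComps.mpr ⟨hT, hbad, hdis⟩, fun h' => ?_⟩
        have := (mem_badComps.mp h').1.1 haT
        grind
      have := card_lt_card this
      have := card_union_le E D
      omega
    · obtain ⟨k, hkT, hkK⟩ := not_disjoint_iff.mp hdis
      obtain ⟨E, hE, hEC⟩ := hbad.touched hkT
      refine ⟨E ∪ D, key E fun h' => hEC (h'.mono fun x => by grind), ?_⟩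
      have := card_union_le E D
      omega
  · obtain ⟨E, hE, hEC⟩ := h.ih T (fun hc => hS (by have := hT.1; grind)) hT.2.1 hbad
    refine ⟨E ∪ D, key E fun h' => hEC (h'.mono fun x => by grind), ?_⟩
    have := card_union_le E D
    omega

variable (G) in
/-- 4-cycles outside the closed neighbourhood of `y` avoid `Y`. -/
def Free (y : V) (Y : Finset V) : Prop :=
  ∀ S : Finset V, Disjoint S (nbhd G y) → HasC4 G S → HasC4 G (S \ Y)

lemma free_of_subset {y : V} {Y : Finset V} (h : Y ⊆ nbhd G y) : Free G y Y := by
  intro S hS hC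
  refine hC.mono fun x hx => mem_sdiff.mpr ⟨hx, fun hY => Finset.disjoint_left.mp hS hx (h hY)⟩

/-- A vertex with at most one neighbour outside the closed neighbourhood of `y` can be added. -/
lemma Free.insert {y z : V} {Y : Finset V} (h : Free G y Y)
    (hz : ∀ p q, p ∉ nbhd G y → q ∉ nbhd G y → p ∉ Y → q ∉ Y → G.Adj z p → G.Adj z q → p = q) :
    Free G y (insert z Y) := by
  intro S hS hC
  have h1 := h S hS hC
  have h2 := h1.erase (z := z) fun p hp q hq => by
    rw [Finset.disjoint_left] at hS
    exact hz p q (hS (by grind)) (hS (by grind)) (by grind) (by grind)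
  exact h2.mono fun x => by grind

lemma MinCE.card_le (h : MinCE G) {y : V} {Y : Finset V} (hY : Y.Nonempty) (hf : Free G y Y) :
    #Y ≤ 4 + #(badComps G (univ \ Y) (nbhd G y)) := by
  obtain ⟨a, ha⟩ := hY
  obtain ⟨D, hD, hDc⟩ := h.exists_isolating (nbhd G y) (S := univ \ Y) (fun hc => by
    have : a ∈ univ \ Y := by rw [hc]; exact mem_univ a
    grind)
  have := h.min (insert y D) fun hC => by
    have := hf _ (Finset.disjoint_left.mpr fun x => by grind) hC
    exact hD (this.mono fun x => by grind)
  have := card_insert_le y D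
  have := card_sdiff_add_card_eq_card (subset_univ Y)
  rw [card_univ] at this
  omega

end Counting

end SquareIsolation

namespace SquareIsolation

open Finset
open scoped Classical

section TwoConnected

variable {V : Type*} [Fintype V] {G : SimpleGraph V}

lemma MinCE.five_le (h : MinCE G) : 5 ≤ Fintype.card V := by
  have hC : HasC4 G univ := by
    by_contra hC
    have := h.min ∅ fun h' => hC (h'.mono (subset_univ _))
    simp at this
  have := hC.four_le_card
  rw [card_univ] at this
  by_contra hlt
  exact h.notBad (Or.inl ⟨by rw [card_univ]; omega, hC⟩)

lemma MinCE.exists_edge (h : MinCE G) {S : Finset V} {a b : V} (ha : a ∈ S) (hb : b ∉ S) :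
    ∃ a ∈ S, ∃ b, b ∉ S ∧ G.Adj a b := by
  obtain ⟨a, -, ha, b, -, hb, hab⟩ := h.conn.of_edge_out (mem_univ a) ha (mem_univ b) hb
  exact ⟨a, ha, b, hb, hab⟩

lemma MinCE.exists_badComp (h : MinCE G) {y : V} {Y : Finset V} (hY : 5 ≤ #Y) (hf : Free G y Y) :
    ∃ T, IsComp G T (univ \ Y) ∧ Bad G T ∧ Disjoint T (nbhd G y) := by
  have := h.card_le (card_pos.mp (by omega)) hf
  obtain ⟨T, hT⟩ := card_pos.mp (show 0 < #(badComps G (univ \ Y) (nbhd G y)) by omega)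
  exact ⟨T, mem_badComps.mp hT⟩

lemma MinCE.exists_two_badComps (h : MinCE G) {y : V} {Y : Finset V} (hY : 6 ≤ #Y)
    (hf : Free G y Y) : ∃ T ∈ badComps G (univ \ Y) (nbhd G y),
      ∃ T' ∈ badComps G (univ \ Y) (nbhd G y), T ≠ T' := by
  have := h.card_le (card_pos.mp (by omega)) hf
  exact one_lt_card.mp (show 1 < #(badComps G (univ \ Y) (nbhd G y)) by omega)

lemma MinCE.exists_adj_of_isComp_erase (h : MinCE G) {x : V} {T : Finset V}
    (hT : IsComp G T (univ.erase x)) : ∃ t ∈ T, G.Adj x t := by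
  obtain ⟨t, ht⟩ := hT.2.1.1
  obtain ⟨a, ha, b, hb, hab⟩ := h.exists_edge ht (b := x) (by have := @hT.1 x; grind)
  by_cases hbx : b = x
  · exact ⟨a, ha, hbx ▸ hab.symm⟩
  · exact absurd hab (hT.2.2 a ha b (by grind) hb)

lemma MinCE.not_bad_of_isComp_erase (h : MinCE G) {x : V} {T : Finset V}
    (hT : IsComp G T (univ.erase x)) : ¬ Bad G T := by
  intro hbad
  obtain ⟨t, ht, hxt⟩ := h.exists_adj_of_isComp_erase hT
  have hxT : x ∉ T := fun hx => by have := hT.1 hx; grind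
  obtain ⟨D, hD, hDc⟩ := h.exists_isolating (nbhd G x) (S := univ.erase x \ T) (fun hc => by
    have : t ∈ univ.erase x \ T := by rw [hc]; exact mem_univ t
    grind)
  have hemp : badComps G (univ.erase x \ T) (nbhd G x) = ∅ := by
    refine eq_empty_of_forall_notMem fun T' hT' => ?_
    rw [mem_badComps] at hT'
    obtain ⟨t', ht', hxt'⟩ := h.exists_adj_of_isComp_erase (hT.of_sdiff hT'.1)
    exact Finset.disjoint_left.mp hT'.2.2 ht' (by grind)
  obtain ⟨E, hE, hEC⟩ := hbad.touched ht
  have h1 := h.min (insert x (E ∪ D)) fun hC => by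
    rcases hC.split T (fun a ha haT b hb hbT => hT.2.2 a haT b (by grind) hbT) with hC | hC
    · exact hEC (hC.mono fun z => by grind)
    · exact hD (hC.mono fun z => by grind)
  have := card_insert_le x (E ∪ D)
  have := card_union_le E D
  have h2 := card_sdiff_add_card_eq_card hT.1
  rw [card_erase_of_mem (mem_univ x), card_univ] at h2
  rw [hemp, card_empty] at hDc
  omega

/-- Isolating one side of a cut vertex, when no component is bad. -/
lemma MinCE.isolate_side (h : MinCE G) {x : V} {A : Finset V} (hx : x ∉ A)
    (hA : ∀ a ∈ A, ∀ b, b ≠ x → b ∉ A → ¬ G.Adj a b) :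
    ∃ D : Finset V, ¬ HasC4 G (A \ nbhds G D) ∧ 5 * #D ≤ #A := by
  obtain ⟨D, hD, hDc⟩ := h.exists_isolating ∅ (S := A) (fun hc => hx (hc ▸ mem_univ x))
  have hemp : badComps G A ∅ = ∅ := by
    refine eq_empty_of_forall_notMem fun T hT => ?_
    rw [mem_badComps] at hT
    refine h.not_bad_of_isComp_erase (x := x) (hT.1.of_isComp (fun t ht => ?_) ?_) hT.2.1
    · have := hT.1.1 ht
      grind
    · intro a ha b hb hbA
      exact hA a (hT.1.1 ha) b (by grind) hbA
  rw [hemp, card_empty] at hDc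
  exact ⟨D, by simpa using hD, hDc⟩

/-- One side of a cut vertex is not bad together with the cut vertex. -/
lemma MinCE.not_bad_side (h : MinCE G) {x : V} {A B : Finset V} (hxA : x ∉ A) (hxB : x ∉ B)
    (hdis : ∀ a ∈ A, a ∉ B) (hun : univ = insert x (A ∪ B)) (hAne : A.Nonempty) (hBne : B.Nonempty)
    (hAB : ∀ a ∈ A, ∀ b ∈ B, ¬ G.Adj a b) (hb : #B % 5 = 0) : ¬ Bad G (insert x A) := by
  intro hbad
  have hall : ∀ v, v = x ∨ v ∈ A ∨ v ∈ B := fun v => by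
    have := mem_univ v
    rw [hun] at this
    grind
  obtain ⟨b, hbB⟩ := hBne
  obtain ⟨o, ho, c, hc, hoc⟩ := h.exists_edge hbB hxB
  have hcx : c = x := by
    rcases hall c with h1 | h1 | h1
    · exact h1
    · exact absurd hoc.symm (hAB c h1 o ho)
    · exact absurd h1 hc
  subst hcx
  obtain ⟨D, hD, hDc⟩ := h.exists_isolating (nbhd G o) (S := B.erase o) (fun hc' => by
    have : o ∈ B.erase o := by rw [hc']; exact mem_univ o
    grind)
  have hemp : badComps G (B.erase o) (nbhd G o) = ∅ := by
    refine eq_empty_of_forall_notMem fun T hT => ?_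
    rw [mem_badComps] at hT
    refine h.not_bad_of_isComp_erase (x := c) (hT.1.of_isComp (fun t ht => ?_) ?_) hT.2.1
    · have := hT.1.1 ht
      grind
    · intro a ha b hb hbA hab
      have ha' := hT.1.1 ha
      have h1 := Finset.disjoint_left.mp hT.2.2 ha
      rcases hall b with h2 | h2 | h2
      · grind
      · exact hAB b h2 a (by grind) hab.symm
      · have : b = o := by grind
        subst this
        exact h1 (by have := hab.symm; grind)
  obtain ⟨E, hE, hEC⟩ := hbad.touched (k := c) (by simp)
  have h1 := h.min (insert o (E ∪ D)) fun hC => by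
    rcases hC.split A (fun a ha haT b hb hbT => by
      refine hAB a haT b ?_
      rcases hall b with h2 | h2 | h2
      · grind
      · exact absurd h2 hbT
      · exact h2) with hC | hC
    · exact hEC (hC.mono fun z => by grind)
    · refine hD (hC.mono fun z => ?_)
      have := hall z
      grind
  have := card_insert_le o (E ∪ D)
  have := card_union_le E D
  rw [card_insert_of_notMem hxA] at hE
  have h2 : #(insert c (A ∪ B)) = Fintype.card V := by rw [← hun, card_univ]
  rw [card_insert_of_notMem (by grind), card_union_of_disjoint
    (Finset.disjoint_left.mpr hdis)] at h2
  rw [card_erase_of_mem ho, hemp, card_empty] at hDc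
  have := card_pos.mpr ⟨o, ho⟩
  omega

lemma MinCE.conn_side (h : MinCE G) {x : V} {A B : Finset V}
    (hdis : ∀ a ∈ A, a ∉ B) (hun : univ = insert x (A ∪ B))
    (hAB : ∀ a ∈ A, ∀ b ∈ B, ¬ G.Adj a b) : Conn G (insert x A) := by
  refine conn_of_root (mem_insert_self x A) fun A' hA' hxA' hne => ?_
  obtain ⟨w, hw, hwA'⟩ : ∃ w ∈ insert x A, w ∉ A' := by
    by_contra! hcon
    exact hne (hA'.antisymm hcon)
  obtain ⟨a, ha, b, hb, hab⟩ := h.exists_edge (S := A' ∪ B) (a := x) (b := w) (by grind) (by grind)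
  have hbA : b ∈ A := by
    have := mem_univ b
    rw [hun] at this
    grind
  refine ⟨a, ?_, b, by grind, by grind, hab⟩
  by_contra haA
  exact hAB b hbA a (by grind) hab.symm

/-- A minimal counterexample is 2-connected. -/
lemma MinCE.conn_erase (h : MinCE G) (x : V) : Conn G (univ.erase x) := by
  have h5 := h.five_le
  by_contra hcon
  have hne : (univ.erase x).Nonempty := by
    rw [← card_pos, card_erase_of_mem (mem_univ x), card_univ]
    omega
  obtain ⟨A, hA, hAne, hAne', hAB⟩ : ∃ A ⊆ univ.erase x, A.Nonempty ∧ A ≠ univ.erase x ∧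
      ∀ a ∈ A, ∀ b ∈ univ.erase x, b ∉ A → ¬ G.Adj a b := by
    by_contra! hc
    exact hcon ⟨hne, hc⟩
  obtain ⟨B, hB⟩ : ∃ B, B = univ.erase x \ A := ⟨_, rfl⟩
  have hxA : x ∉ A := fun hx => by have := hA hx; grind
  have hxB : x ∉ B := by grind
  have hAB' : ∀ a ∈ A, ∀ b ∈ B, ¬ G.Adj a b := fun a ha b hb => hAB a ha b (by grind) (by grind)
  have hBA' : ∀ b ∈ B, ∀ a ∈ A, ¬ G.Adj b a := fun b hb a ha hab => hAB' a ha b hb hab.symm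
  have hdis : ∀ a ∈ A, a ∉ B := by grind
  have hdis' : ∀ b ∈ B, b ∉ A := by grind
  have hun : univ = insert x (A ∪ B) := by grind
  have hun' : univ = insert x (B ∪ A) := by grind
  have hBne : B.Nonempty := by
    by_contra hBe
    rw [not_nonempty_iff_eq_empty] at hBe
    exact hAne' (hA.antisymm (by grind))
  have hn : #A + #B + 1 = Fintype.card V := by
    have h2 : #(insert x (A ∪ B)) = Fintype.card V := by rw [← hun, card_univ]
    rwa [card_insert_of_notMem (by grind), card_union_of_disjoint
      (Finset.disjoint_left.mpr hdis)] at h2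
  have hmod : #A % 5 + #B % 5 ≤ 3 := by
    obtain ⟨D, hD, hDc⟩ := h.isolate_side (x := x) (A := A) hxA
      fun a ha b hb hbA => hAB a ha b (by grind) hbA
    obtain ⟨E, hE, hEc⟩ := h.isolate_side (x := x) (A := B) hxB
      fun b hb a ha haB => hBA' b hb a (by grind)
    have := h.min (insert x (D ∪ E)) fun hC => by
      rcases hC.split A (fun a ha haT b hb hbT => hAB a haT b (by grind) hbT) with hC | hC
      · exact hD (hC.mono fun z => by grind)
      · exact hE (hC.mono fun z => by grind)
    have := card_insert_le x (D ∪ E)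
    have := card_union_le D E
    omega
  by_cases hbA : Bad G (insert x A)
  · have h1 := hbA.card
    rw [card_insert_of_notMem hxA] at h1
    exact h.not_bad_side hxA hxB hdis hun hAne hBne hAB' (by omega) hbA
  by_cases hbB : Bad G (insert x B)
  · have h1 := hbB.card
    rw [card_insert_of_notMem hxB] at h1
    exact h.not_bad_side hxB hxA hdis' hun' hBne hAne hBA' (by omega) hbB
  obtain ⟨a, ha⟩ := hAne
  obtain ⟨b, hb⟩ := hBne
  obtain ⟨D, hDc, hD⟩ := h.ih (insert x A) (fun hc => by
    have : b ∈ insert x A := by rw [hc]; exact mem_univ b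
    grind) (h.conn_side hdis hun hAB') hbA
  obtain ⟨E, hEc, hE⟩ := h.ih (insert x B) (fun hc => by
    have : a ∈ insert x B := by rw [hc]; exact mem_univ a
    grind) (h.conn_side hdis' hun' hBA') hbB
  have := h.min (D ∪ E) fun hC => by
    rcases hC.split_cut (x := x) (A := A) (B := B)
        (by rw [← hun]; exact subset_univ _) hdis hAB' with
      hC | hC
    · exact hD (hC.mono fun z => by grind)
    · exact hE (hC.mono fun z => by grind)
  have := card_union_le D E
  rw [card_insert_of_notMem hxA] at hDc
  rw [card_insert_of_notMem hxB] at hEc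
  omega

end TwoConnected

end SquareIsolation

namespace SquareIsolation

open Finset
open scoped Classical

section Links

variable {V : Type*} [Fintype V] {G : SimpleGraph V}

/-- Vertices of a 9-vertex exceptional graph have at most one open twin. -/
lemma Nine.twin_unique {B : Finset V} (hB : Nine G B) {b c d : V} (hb : b ∈ B) (hc : c ∈ B)
    (hd : d ∈ B) (hbc : b ≠ c) (hbd : b ≠ d) (hcd : c ≠ d)
    (h : ∀ x ∈ B, G.Adj b x ↔ G.Adj c x) (h' : ∀ x ∈ B, G.Adj b x ↔ G.Adj d x) : False := by
  have key : ∀ e ∈ B, b ≠ e → (∀ x ∈ B, G.Adj b x ↔ G.Adj e x) → ∀ Q ⊆ B \ nbhd G b, e ∈ Q →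
      ¬ Bad4 G Q := fun e he hbe hs Q hQ heQ hbad => by
    obtain ⟨z, hz, hez⟩ := hbad.exists_adj heQ
    have hz' := hQ hz
    have := hs z (by grind)
    grind
  have hc' : c ∉ nbhd G b := by have := h c hc; grind [SimpleGraph.irrefl]
  have hd' : d ∉ nbhd G b := by have := h' d hd; grind [SimpleGraph.irrefl]
  rcases hB.vert b hb with ⟨-, hbad⟩ | ⟨b', hb'⟩
  · exact key c hc hbc h _ Subset.rfl (by grind) hbad
  · by_cases hcb : c = b'
    · exact key d hd hbd h' _ (erase_subset _ _) (by grind) hb'.bad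
    · exact key c hc hbc h _ (erase_subset _ _) (by grind) hb'.bad

lemma Twins.symm {B : Finset V} (hB : Nine G B) {b b' : V} (hb : b ∈ B) (h : Twins G B b b') :
    Twins G B b' b := by
  have hnadj : b ∉ nbhd G b' := by have := h.same b hb; have := h.ne; grind [SimpleGraph.irrefl]
  rcases hB.vert b' h.mem with ⟨-, hbad⟩ | ⟨c, hc⟩
  · obtain ⟨z, hz, hbz⟩ := hbad.exists_adj (y := b) (by grind)
    have := h.same z (by grind)
    grind
  · by_cases hcb : c = b
    · exact hcb ▸ hc
    · exact (hB.twin_unique h.mem hc.mem hb hc.ne.symm h.ne (hcb) hc.same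
        fun x hx => (h.same x hx).symm).elim

variable (G) in
/-- The link from `b ∈ B` to `p ∉ B` is the only one at `b`, and removing `p` leaves an
exceptional graph outside `B`, not linked to the non-neighbours of `b`. -/
structure Tight (B : Finset V) (b p : V) : Prop where
  unique : ∀ q ∉ B, G.Adj b q → q = p
  bad : Bad G ((univ \ B).erase p)
  nonadj : ∀ q ∈ B, q ∉ nbhd G b → ¬ (∀ x ∈ B, G.Adj b x ↔ G.Adj q x) →
    ∀ r ∉ B, r ≠ p → ¬ G.Adj q r

lemma MinCE.false_of_tight (h : MinCE G) {B : Finset V} (hB : Nine G B)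
    (hP : 2 ≤ #(univ \ B))
    (hlink : ∀ b ∈ B, ∀ p ∉ B, G.Adj b p → ∃ r ∉ B, G.Adj p r)
    (ht : ∀ b ∈ B, ∀ p ∉ B, G.Adj b p → Tight G B b p) : False := by
  have hn := card_sdiff_add_card_eq_card (subset_univ B)
  rw [hB.card, card_univ] at hn
  obtain ⟨p₀, hp₀, q₀, hq₀, hpq₀⟩ := one_lt_card.mp (show 1 < #(univ \ B) by omega)
  obtain ⟨b₀, hb₀⟩ := hB.conn.1
  obtain ⟨b, hb, p, hp, hbp⟩ := h.exists_edge hb₀ (b := p₀) (by grind)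
  obtain ⟨b2, hb2, p2, hp2, hbp2, hpp2⟩ : ∃ b2 ∈ B, ∃ p2, p2 ∉ B ∧ G.Adj b2 p2 ∧ p ≠ p2 := by
    obtain ⟨w, hw, hwp⟩ : ∃ w, w ∉ B ∧ w ≠ p := by
      by_cases hpe : p₀ = p
      · exact ⟨q₀, by grind⟩
      · exact ⟨p₀, by grind⟩
    obtain ⟨a, ha, haB, c, hc, hcB, hac⟩ := (h.conn_erase p).of_edge_out (A := B) (a := b) (b := w)
      (by grind) hb (by grind) hw
    exact ⟨a, haB, c, hcB, hac, by grind⟩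
  have star : ∀ b ∈ B, ∀ p ∉ B, G.Adj b p → ∀ b2 ∈ B, ∀ p2 ∉ B, G.Adj b2 p2 → p ≠ p2 →
      HasC4 G ((B \ nbhd G b) \ nbhd G b2) := by
    intro b hb p hp hbp b2 hb2 p2 hp2 hbp2 hne
    by_contra hC
    have hbb : b ≠ b2 := by
      rintro rfl
      exact hne ((ht b hb p2 hp2 hbp2).unique p hp hbp)
    obtain ⟨D, hD, hDC⟩ := (ht b hb p hp hbp).bad.touched (k := p2) (by grind)
    have := h.min (insert b (insert b2 D)) fun hC' => by
      rcases hC'.split B (fun q hq hqB r hr hrB hqr => by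
        have e1 : ∀ x ∈ B, G.Adj b x ↔ G.Adj q x := by
          by_contra hcon
          exact (ht b hb p hp hbp).nonadj q hqB (by grind) hcon r hrB (by grind) hqr
        have e2 : ∀ x ∈ B, G.Adj b2 x ↔ G.Adj q x := by
          by_contra hcon
          exact (ht b2 hb2 p2 hp2 hbp2).nonadj q hqB (by grind) hcon r hrB (by grind) hqr
        exact hB.twin_unique hb hqB hb2 (by grind) hbb (by grind) e1 fun x hx =>
          (e1 x hx).trans (e2 x hx).symm) with hC' | hC'
      · exact hC (hC'.mono fun z => by grind)
      · exact hDC (hC'.mono fun z => by grind)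
    have := card_insert_le b (insert b2 D)
    have := card_insert_le b2 D
    rw [card_erase_of_mem (by grind)] at hD
    omega
  have uniq : ∀ b ∈ B, ∀ p ∉ B, G.Adj b p → ∀ b2 ∈ B, ∀ p2 ∉ B, G.Adj b2 p2 → p ≠ p2 →
      ∀ b3 ∈ B, ∀ p3 ∉ B, G.Adj b3 p3 → p ≠ p3 → b3 = b2 := by
    intro b hb p hp hbp b2 hb2 p2 hp2 hbp2 hne b3 hb3 p3 hp3 hbp3 hne3
    by_contra hcon
    have h2 : b ≠ b2 := by
      rintro rfl
      exact hne ((ht b hb p2 hp2 hbp2).unique p hp hbp)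
    have h3 : b ≠ b3 := by
      rintro rfl
      exact hne3 ((ht b hb p3 hp3 hbp3).unique p hp hbp)
    rcases hB.twin b hb b2 hb2 b3 hb3 h2 h3 (Ne.symm hcon) with hC | hC
    · exact hC (star b hb p hp hbp b2 hb2 p2 hp2 hbp2 hne)
    · exact hC (star b hb p hp hbp b3 hb3 p3 hp3 hbp3 hne3)
  have links : ∀ b3 ∈ B, ∀ p3 ∉ B, G.Adj b3 p3 → b3 = b ∧ p3 = p ∨ b3 = b2 ∧ p3 = p2 := by
    intro b3 hb3 p3 hp3 hbp3
    by_cases hpp3 : p = p3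
    · left
      have := uniq b2 hb2 p2 hp2 hbp2 b hb p hp hbp hpp2.symm b3 hb3 p3 hp3 hbp3 (by grind)
      exact ⟨this, hpp3.symm⟩
    · right
      have := uniq b hb p hp hbp b2 hb2 p2 hp2 hbp2 hpp2 b3 hb3 p3 hp3 hbp3 hpp3
      subst this
      exact ⟨rfl, (ht b3 hb3 p2 hp2 hbp2).unique p3 hp3 hbp3⟩
  obtain ⟨u, hu, huC⟩ := hB.kill b2 hb2
  obtain ⟨r, hr, hpr⟩ := hlink b2 hb2 p2 hp2 hbp2
  have hrp2 := hpr.ne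
  obtain ⟨D, hD, hDC⟩ := (ht b2 hb2 p2 hp2 hbp2).bad.touched (k := r)
    (by simp [hr, hrp2.symm])
  have := h.min (insert p2 (insert u D)) fun hC => by
    clear hn hP hD star uniq hlink ht
    obtain ⟨S, hS⟩ : ∃ S, S = univ \ nbhds G (insert p2 (insert u D)) := ⟨_, rfl⟩
    rw [← hS] at hC
    rcases hC.split_bridge (B := B) (b := b) (p := p) (fun a ha haB c hc hcB hac => by
      rcases links a haB c hcB hac with h1 | ⟨rfl, rfl⟩
      · exact h1
      · grind) with hC | hC
    · exact huC (hC.mono fun z hz => by have := hbp2.symm; grind)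
    · exact hDC (hC.mono fun z hz => by grind)
  have := card_insert_le p2 (insert u D)
  have := card_insert_le u D
  rw [card_erase_of_mem (by simp [hp2])] at hD
  omega

end Links

end SquareIsolation

namespace SquareIsolation

open Finset
open scoped Classical

section Loose

variable {V : Type*} [Fintype V] {G : SimpleGraph V}

variable (G) in
/-- The neighbours of `b` outside `B`. -/
noncomputable def outer (B : Finset V) (b : V) : Finset V := univ.filter fun r => r ∉ B ∧ G.Adj b r

@[simp, grind] lemma mem_outer {B : Finset V} {b r : V} :
    r ∈ outer G B b ↔ r ∉ B ∧ G.Adj b r := by simp [outer]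

lemma MinCE.tight_of (h : MinCE G) {B Q Y : Finset V} {b p : V}
    (hY : 6 ≤ #Y) (hf : Free G b Y) (hun : ∀ x, x ∉ Y ↔ x ∈ Q ∨ x ∉ B ∧ x ≠ p)
    (hQ : Conn G Q)
    (hQt : ∀ q ∈ B, q ∉ nbhd G b → ¬ (∀ x ∈ B, G.Adj b x ↔ G.Adj q x) → q ∈ Q)
    (hP : ∀ T, IsComp G T ((univ \ B).erase p) → Bad G T → T = (univ \ B).erase p) :
    Tight G B b p := by
  have hQY : Q ⊆ univ \ Y := fun x hx => by simp [hun, hx]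
  obtain ⟨T, hT, hTb, hTd, hTQ⟩ : ∃ T, IsComp G T (univ \ Y) ∧ Bad G T ∧ Disjoint T (nbhd G b) ∧
      ∀ x ∈ T, x ∉ Q := by
    obtain ⟨T, hT, T', hT', hne⟩ := h.exists_two_badComps hY hf
    rw [mem_badComps] at hT hT'
    by_cases h1 : ∀ x ∈ T, x ∉ Q
    · exact ⟨T, hT.1, hT.2.1, hT.2.2, h1⟩
    · refine ⟨T', hT'.1, hT'.2.1, hT'.2.2, fun x hx hxQ => ?_⟩
      push Not at h1
      obtain ⟨y, hy, hyQ⟩ := h1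
      have := hQ.subset_of_isComp hT.1 hQY hyQ hy hxQ
      exact hne (hT.1.eq_of_mem hT'.1 this hx)
  have hTP : T = (univ \ B).erase p := by
    refine hP T (hT.of_isComp (fun x hx => ?_) fun a ha c hc hcY => ?_) hTb
    · have h1 := hTQ x hx
      have h2 := (hun x).mp (mem_sdiff.mp (hT.1 hx)).2
      simp
      tauto
    · refine absurd ?_ hcY
      simp at hc ⊢
      rw [hun]
      tauto
  have hmem : ∀ r, r ∉ B → r ≠ p → r ∈ T := fun r hr hrp => by simp [hTP, hr, hrp]
  refine ⟨fun q hq hbq => ?_, hTP ▸ hTb, fun q hq hqb hns r hr hrp hqr => ?_⟩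
  · by_contra hqp
    exact Finset.disjoint_left.mp hTd (hmem q hq hqp) (by simp [hbq])
  · have hqQ := hQt q hq hqb hns
    exact hT.2.2 r (hmem r hr hrp) q (hQY hqQ) (fun hqT => hTQ q hqT hqQ) hqr.symm

/-- Every link is tight unless it leaves a vertex of degree 3 whose open twin has at least two
other neighbours outside. -/
lemma MinCE.tight_or (h : MinCE G) {B : Finset V} (hB : Nine G B) {b p : V} (hb : b ∈ B)
    (hp : p ∉ B) (hbp : G.Adj b p)
    (hP : ∀ T, IsComp G T ((univ \ B).erase p) → Bad G T → T = (univ \ B).erase p) :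
    Tight G B b p ∨ ∃ b', Twins G B b b' ∧ 2 ≤ #((outer G B b').erase p) := by
  have hpY : p ∉ nbhd G b ∩ B := by simp [hp]
  have hc := card_insert_of_notMem hpY
  have hf : Free G b (insert p (nbhd G b ∩ B)) := free_of_subset fun x hx => by
    simp at hx ⊢
    rcases hx with rfl | hx
    · exact Or.inr hbp
    · exact hx.1
  rcases hB.vert b hb with ⟨h5, hbad⟩ | ⟨b', hb'⟩
  · left
    refine h.tight_of (Q := B \ nbhd G b) (Y := insert p (nbhd G b ∩ B)) (by omega) hf
      (fun x => ?_) hbad.conn (fun q hq hqb _ => by simp [hq, hqb]) hP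
    simp only [mem_insert, mem_inter, mem_sdiff]
    by_cases hx : x = p
    · subst hx; simp [hp]
    · tauto
  · by_cases h2 : 2 ≤ #((outer G B b').erase p)
    · exact Or.inr ⟨b', hb', h2⟩
    left
    have hb'b : b' ∉ nbhd G b := by
      have := hb'.same b' hb'.mem
      have := hb'.ne
      grind [SimpleGraph.irrefl]
    have hb'p : b' ≠ p := fun hc => hp (hc ▸ hb'.mem)
    have hb'Y : b' ∉ insert p (nbhd G b ∩ B) := by
      rw [mem_insert, mem_inter]
      tauto
    have hc' := card_insert_of_notMem hb'Y
    have h4 := hb'.card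
    refine h.tight_of (Q := (B \ nbhd G b).erase b') (Y := insert b' (insert p (nbhd G b ∩ B)))
      (by omega) (hf.insert fun r s hr hs hrY hsY hbr hbs => ?_)
      (fun x => ?_) hb'.bad.conn
      (fun q hq hqb hns => ?_) hP
    · by_contra hrs
      have hr' : r ∈ (outer G B b').erase p := by
        have := hb'.same r
        simp at hr hrY
        simp
        tauto
      have hs' : s ∈ (outer G B b').erase p := by
        have := hb'.same s
        simp at hs hsY
        simp
        tauto
      have := one_lt_card.mpr ⟨r, hr', s, hs', hrs⟩
      omega
    · simp only [mem_insert, mem_inter, mem_sdiff, mem_erase]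
      by_cases hx : x = p
      · subst hx; simp [hp]
      · by_cases hx' : x = b'
        · subst hx'; simp [hb'.mem]
        · tauto
    · have : q ≠ b' := fun hc => hns (hc ▸ hb'.same)
      simp [hq, hqb, this]

/-- Either all links are tight, or there are open twins with many neighbours outside. -/
lemma MinCE.tight_or_loose (h : MinCE G) {B : Finset V} (hB : Nine G B)
    (hP : ∀ b ∈ B, ∀ p ∉ B, G.Adj b p → ∀ T, IsComp G T ((univ \ B).erase p) → Bad G T →
      T = (univ \ B).erase p) :
    (∀ b ∈ B, ∀ p ∉ B, G.Adj b p → Tight G B b p) ∨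
      ∃ b ∈ B, ∃ b', Twins G B b b' ∧ (outer G B b).Nonempty ∧ (outer G B b').Nonempty ∧
        (∀ p ∈ outer G B b, 2 ≤ #((outer G B b').erase p)) ∧
        ∀ p ∈ outer G B b', 2 ≤ #((outer G B b).erase p) := by
  by_contra! hcon
  obtain ⟨⟨b, hb, p, hp, hbp, hnt⟩, hcon⟩ := hcon
  rcases h.tight_or hB hb hp hbp (hP b hb p hp hbp) with ht | ⟨b', hb', h2⟩
  · exact hnt ht
  have many : ∀ {c c' : V} {r : V}, c ∈ B → Twins G B c c' → 2 ≤ #(outer G B c) →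
      r ∈ outer G B c → 2 ≤ #((outer G B c').erase r) := by
    intro c c' r hc hcc h2 hr
    rw [mem_outer] at hr
    rcases h.tight_or hB hc hr.1 hr.2 (hP c hc r hr.1 hr.2) with ht | ⟨d, hd, hd2⟩
    · obtain ⟨s, hs, hsr⟩ := exists_mem_ne (show 1 < #(outer G B c) by omega) r
      rw [mem_outer] at hs
      exact absurd (ht.unique s hs.1 hs.2) hsr
    · by_cases hdc : d = c'
      · exact hdc ▸ hd2
      · exact (hB.twin_unique hc hd.mem hcc.mem hd.ne.symm hcc.ne.symm hdc hd.same hcc.same).elim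
  have h2' : 2 ≤ #(outer G B b') := h2.trans (card_le_card (erase_subset _ _))
  obtain ⟨r, hr⟩ := card_pos.mp (show 0 < #(outer G B b') by omega)
  have h3 := many hb'.mem (hb'.symm hB hb) h2' hr
  have h3' : 2 ≤ #(outer G B b) := h3.trans (card_le_card (erase_subset _ _))
  obtain ⟨r', hr', hlt⟩ := hcon b hb b' hb' ⟨p, by simp [hp, hbp]⟩ ⟨r, hr⟩
    fun p hp => many hb hb' h3' hp
  have := many hb'.mem (hb'.symm hB hb) h2' hr'
  omega

end Loose

end SquareIsolation

namespace SquareIsolation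

open Finset
open scoped Classical

section FiveSet

variable {V : Type*} [Fintype V] {G : SimpleGraph V}

lemma Twins.notMem_of_isComp {B Y T : Finset V} {b b' n q : V} (h : Twins G B b b')
    (hbn : G.Adj b n) (hn : n ∈ B) (hq : q ∈ B) (hqb' : q ≠ b') (hqb : q ∉ nbhd G b)
    (hnq : G.Adj n q) (hT : IsComp G T (univ \ Y)) (hTd : Disjoint T (nbhd G b)) (hnY : n ∉ Y)
    (hY : ∀ x ∈ B, x ∉ nbhd G b → x ∉ Y) : ∀ x ∈ T, x ∉ B := by
  have hTb : ∀ x ∈ T, x ∉ nbhd G b := fun x hx => Finset.disjoint_left.mp hTd hx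
  have hnT : n ∉ T := fun hnT => hTb n hnT (by simp [hbn])
  have hadj : ∀ x ∈ T, ¬ G.Adj x n := fun x hx => hT.2.2 x hx n (by simp [hnY]) hnT
  intro x hx hxB
  by_cases hxb' : x = b'
  · exact hadj x hx (hxb' ▸ (h.same n hn).mp hbn)
  · have hxQ : x ∈ (B \ nbhd G b).erase b' :=
      mem_erase.mpr ⟨hxb', mem_sdiff.mpr ⟨hxB, hTb x hx⟩⟩
    have hqQ : q ∈ (B \ nbhd G b).erase b' :=
      mem_erase.mpr ⟨hqb', mem_sdiff.mpr ⟨hq, hqb⟩⟩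
    have := h.bad.conn.subset_of_isComp hT (fun z hz => by
      rw [mem_erase, mem_sdiff] at hz
      simp [hY z hz.2.1 hz.2.2]) hxQ hx hqQ
    exact hadj q this hnq.symm

/-- In a minimal counterexample whose order is not 9, no connected 5-set that is dominated by a
vertex, as far as 4-cycles are concerned, has a connected complement. -/
lemma MinCE.false_of_five (h : MinCE G) (hn : Fintype.card V ≠ 9) {y : V} {P : Finset V}
    (hP : #P = 5) (hf : Free G y P) (hc : Conn G P) (hR : Conn G (univ \ P)) : False := by
  obtain ⟨T, hT, hTb, hTd⟩ := h.exists_badComp hP.ge hf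
  have hTR := hT.eq_of_conn hR
  subst hTR
  have hcard := card_sdiff_add_card_eq_card (subset_univ P)
  rw [hP, card_univ] at hcard
  obtain ⟨B, hB⟩ : ∃ B, B = univ \ P := ⟨_, rfl⟩
  have hBP : univ \ B = P := by rw [hB, sdiff_sdiff_right_self, inf_eq_inter, univ_inter]
  have hBn : Nine G B := by
    rcases hTb with h4 | h9
    · have := h4.1
      omega
    · exact hB ▸ h9.nine
  have hmem : ∀ x, x ∉ B ↔ x ∈ P := by simp [hB]
  rcases h.tight_or_loose hBn fun b hb p hp hbp T hT hTb => by
    refine eq_of_subset_of_card_le hT.1 ?_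
    rw [hBP, card_erase_of_mem ((hmem p).mp hp)]
    have := hTb.card
    omega with ht | ⟨b, hb, b', hb', ⟨p, hp⟩, -, h1, h2⟩
  · refine h.false_of_tight hBn (by rw [hBP]; omega) (fun b hb p hp hbp => ?_) ht
    obtain ⟨r, hr, hpr⟩ := hc.exists_adj ((hmem p).mp hp) (by omega)
    exact ⟨r, (hmem r).mpr hr, hpr⟩
  · obtain ⟨r, hr⟩ := card_pos.mp (show 0 < #((outer G B b').erase p) by have := h1 p hp; omega)
    obtain ⟨p1, hp1, p2, hp2, hpp⟩ := one_lt_card.mp (h2 r (mem_erase.mp hr).2)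
    simp only [mem_erase, mem_outer] at hp1 hp2
    obtain ⟨n, hnB, hbn, q, hq, hqb', hqb, hnq⟩ := hb'.nbr
    have hY : #(insert p1 (insert p2 ((nbhd G b ∩ B).erase n))) = 5 := by
      rw [card_insert_of_notMem, card_insert_of_notMem, card_erase_of_mem, hb'.card]
      · simp [hbn, hnB]
      · simp [hp2.2.1]
      · simp [hp1.2.1, hpp]
    obtain ⟨T, hT, hTb, hTd⟩ := h.exists_badComp (y := b) hY.ge (free_of_subset fun x hx => by
      simp at hx ⊢
      rcases hx with rfl | rfl | hx
      · exact Or.inr hp1.2.2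
      · exact Or.inr hp2.2.2
      · exact hx.2.1)
    have hTB := hb'.notMem_of_isComp hbn hnB hq hqb' hqb hnq hT hTd
      (by simp; exact ⟨fun hc => hp1.2.1 (hc ▸ hnB), fun hc => hp2.2.1 (hc ▸ hnB)⟩)
      fun x hx hxb => by
        simp at hxb ⊢
        exact ⟨fun hc => hp1.2.1 (hc ▸ hx), fun hc => hp2.2.1 (hc ▸ hx), by tauto⟩
    have hsub : T ⊆ (P.erase p1).erase p2 := fun x hx => by
      have := (hmem x).mp (hTB x hx)
      have := hT.1 hx
      simp at this
      simp
      tauto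
    have := card_le_card hsub
    rw [card_erase_of_mem, card_erase_of_mem ((hmem p1).mp hp1.2.1), hP] at this
    · have := hTb.card
      omega
    · simp [(hmem p2).mp hp2.2.1, hpp.symm]

end FiveSet

end SquareIsolation

namespace SquareIsolation

open Finset
open scoped Classical

section SmallDegree

variable {V : Type*} [Fintype V] {G : SimpleGraph V}

lemma MinCE.hasC4 (h : MinCE G) : HasC4 G univ := by
  by_contra hC
  have := h.min ∅ fun h' => hC (h'.mono (subset_univ _))
  simp at this

lemma MinCE.exists_bad4_of_degree_le (h : MinCE G) (hd : ∀ v, #(nbhd G v) ≤ 4) {H : Finset V}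
    (hH : Bad4 G H) {y x : V} (hy : y ∈ H) (hx : x ∉ H) (hyx : G.Adj y x) :
    ∃ C, Bad4 G C ∧ IsComp G C (univ \ insert x H) ∧ Disjoint C (nbhd G y) := by
  obtain ⟨p, z, q, rfl, hyz, hpq, hyp, hyq, hzp, hzq, a1, a2, a3, a4⟩ := hH.cycle hy
  simp only [mem_insert, mem_singleton, not_or] at hx
  obtain ⟨hxy, hxp, hxz, hxq⟩ := hx
  have hf : Free G y (insert z {y, p, q, x}) := by
    refine (free_of_subset fun w hw => ?_).insert fun r s hr hs hrY hsY hzr hzs => ?_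
    · have := a4.symm
      simp at hw ⊢
      rcases hw with rfl | rfl | rfl | rfl <;> simp [*]
    · by_contra hrs
      have hsub : ({z, p, q, r, s} : Finset V) ⊆ nbhd G z := fun w hw => by
        have := a2.symm
        simp at hw ⊢
        rcases hw with rfl | rfl | rfl | rfl | rfl <;> simp [*]
      have h5 : #({z, p, q, r, s} : Finset V) = 5 := by
        have := hzr.ne
        have := hzs.ne
        clear hsub hr hs
        simp at hrY hsY
        grind
      have := card_le_card hsub
      have := hd z
      omega
  have hY : insert z {y, p, q, x} = insert x ({y, p, z, q} : Finset V) := by grind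
  rw [hY] at hf
  obtain ⟨T, hT, hTb, hTd⟩ := h.exists_badComp (y := y) (Y := insert x ({y, p, z, q} : Finset V))
    (by rw [card_insert_of_notMem (by simp [*]), hH.1]) hf
  refine ⟨T, hTb.resolve_right fun h9 => ?_, hT, hTd⟩
  obtain ⟨u, hu, hu5⟩ := h9.nine.four
  have := card_le_card (inter_subset_left (s₁ := nbhd G u) (s₂ := T))
  have := hd u
  omega

lemma MinCE.exists_bad4 (h : MinCE G) : ∃ H, Bad4 G H ∧ ∃ y ∈ H, ∃ x, x ∉ H ∧ G.Adj y x := by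
  obtain ⟨H, hH⟩ : ∃ H, Bad4 G H := by
    obtain ⟨a, b, c, d, -, -, -, -, hac, hbd, hab, hbc, hcd, hda⟩ := h.hasC4
    have := hab.ne; have := hbc.ne; have := hcd.ne; have := hda.ne
    exact ⟨{a, b, c, d}, by grind, a, b, c, d, by simp [*]⟩
  have h5 := h.five_le
  obtain ⟨w, hw⟩ : ∃ w, w ∉ H := by
    by_contra! hcon
    have := card_le_card (fun x _ => hcon x : univ ⊆ H)
    rw [card_univ, hH.1] at this
    omega
  obtain ⟨y₀, hy₀⟩ := hH.conn.1
  exact ⟨H, hH, h.exists_edge hy₀ hw⟩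

lemma MinCE.exists_degree_four (h : MinCE G) (hn : Fintype.card V ≠ 9) : ∃ v, 5 ≤ #(nbhd G v) := by
  by_contra! hd
  replace hd : ∀ v, #(nbhd G v) ≤ 4 := fun v => by have := hd v; omega
  obtain ⟨H, hH, y, hy, x, hx, hyx⟩ := h.exists_bad4
  obtain ⟨C, hC, hCc, hCd⟩ := h.exists_bad4_of_degree_le hd hH hy hx hyx
  have hCmem : ∀ c ∈ C, c ≠ x ∧ c ∉ H := fun c hc => by
    have := hCc.1 hc
    simpa using this
  obtain ⟨c₀, hc₀⟩ := hC.conn.1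
  obtain ⟨c, hcx, hcC, k, hkx, hkC, hck⟩ := (h.conn_erase x).of_edge_out (A := C) (a := c₀) (b := y)
    (by simp [hCmem c₀ hc₀]) hc₀ (by simp [hyx.ne]) (fun hyC => (hCmem y hyC).2 hy)
  have hkH : k ∈ H := by
    by_contra hkH
    exact hCc.2.2 c hcC k (by simp at hkx; simp [hkx, hkH]) hkC hck
  have hky : k ≠ y := by
    rintro rfl
    exact Finset.disjoint_left.mp hCd hcC (by simp [hck.symm])
  obtain ⟨C', hC', hCc', hCd'⟩ := h.exists_bad4_of_degree_le hd hC hcC hkC hck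
  have hyW : y ∈ univ \ insert k C := by
    simp only [mem_sdiff, mem_univ, mem_insert, true_and, not_or]
    exact ⟨hky.symm, fun hyC => (hCmem y hyC).2 hy⟩
  have hW : Conn G (univ \ insert k C) := by
    refine conn_of_root hyW fun A hA hyA hne => ?_
    by_contra! hcon
    replace hcon : ∀ a ∈ A, ∀ b, b ≠ k → b ∉ C → G.Adj a b → b ∈ A := fun a ha b hbk hbC hab => by
      by_contra hbA
      exact hcon a ha b (by simp [hbk, hbC]) hbA hab
    have hHC : ∀ b ∈ H, b ∉ C := fun b hb hbC => (hCmem b hbC).2 hb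
    have hxA : x ∈ A := hcon y hyA x (fun hc => hx (hc ▸ hkH)) (fun hxC => (hCmem x hxC).1 rfl) hyx
    have hHA : ∀ b ∈ H, b ≠ k → b ∈ A := by
      obtain ⟨p, z, q, rfl, hyz, hpq, hyp, hyq, hzp, hzq, a1, a2, a3, a4⟩ := hH.cycle hy
      have hp : p ≠ k → p ∈ A := fun hpk => hcon y hyA p hpk (hHC p (by simp)) a1
      have hq : q ≠ k → q ∈ A := fun hqk => hcon y hyA q hqk (hHC q (by simp)) a4.symm
      have hz : z ≠ k → z ∈ A := fun hzk => by
        by_cases hpk : p = k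
        · exact hcon q (hq fun hc => hpq (hpk.trans hc.symm)) z hzk (hHC z (by simp)) a3.symm
        · exact hcon p (hp hpk) z hzk (hHC z (by simp)) a2
      intro b hb hbk
      simp only [mem_insert, mem_singleton] at hb
      rcases hb with rfl | rfl | rfl | rfl
      · exact hyA
      · exact hp hbk
      · exact hz hbk
      · exact hq hbk
    obtain ⟨w, hwW, hwA⟩ : ∃ w ∈ univ \ insert k C, w ∉ A := by
      by_contra! hc
      exact hne (hA.antisymm hc)
    have hwW' : w ≠ k ∧ w ∉ C := by simpa using hwW
    obtain ⟨a, -, haA, b, hbk, hbA, hab⟩ :=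
      (h.conn_erase k).of_edge_out (A := A ∪ C) (a := y) (b := w)
      (by simp [hky.symm]) (by simp [hyA]) (by simp [hwW']) (by simp [hwA, hwW'])
    simp only [mem_union, not_or, mem_erase, mem_univ, and_true] at haA hbk hbA
    rcases haA with haA | haC
    · exact hbA.1 (hcon a haA b hbk hbA.2 hab)
    · refine hCc.2.2 a haC b ?_ hbA.2 hab
      have h1 : b ≠ x := fun hc => hbA.1 (hc ▸ hxA)
      have h2 : b ∉ H := fun hc => hbA.1 (hHA b hc hbk)
      simp [h1, h2]
  have hCW := hCc'.eq_of_conn hW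
  have := card_sdiff_add_card_eq_card (subset_univ (insert k C))
  rw [← hCW, hC'.1, card_insert_of_notMem hkC, hC.1, card_univ] at this
  omega

end SmallDegree

end SquareIsolation

namespace SquareIsolation

open Finset
open scoped Classical

section Pole

variable {V : Type*} [Fintype V] {G : SimpleGraph V}

variable (G) in
/-- The vertices outside `H` with a neighbour in `H`. -/
noncomputable def link (H : Finset V) : Finset V := univ.filter fun x => x ∉ H ∧ ∃ y ∈ H, G.Adj y x

@[simp, grind] lemma mem_link {H : Finset V} {x : V} :
    x ∈ link G H ↔ x ∉ H ∧ ∃ y ∈ H, G.Adj y x := by simp [link]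

lemma outer_subset_link {H : Finset V} {y : V} (hy : y ∈ H) : outer G H y ⊆ link G H := by
  intro x
  grind

variable (G) in
/-- `H` is a bad component of the graph obtained by deleting the closed neighbourhood of `v`, and
among these its link is smallest. -/
structure Pole (v : V) (H : Finset V) : Prop where
  comp : IsComp G H (univ \ nbhd G v)
  bad : Bad G H
  min : ∀ T, IsComp G T (univ \ nbhd G v) → Bad G T → #(link G H) ≤ #(link G T)

lemma MinCE.exists_pole (h : MinCE G) (hn : Fintype.card V ≠ 9) : ∃ v H, Pole G v H := by
  obtain ⟨v, hv⟩ := h.exists_degree_four hn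
  obtain ⟨T, hT, hTb, -⟩ := h.exists_badComp hv (free_of_subset (y := v) Subset.rfl)
  obtain ⟨H, hH, hmin⟩ := exists_min_image (badComps G (univ \ nbhd G v) ∅) (fun T => #(link G T))
    ⟨T, by simp [hT, hTb]⟩
  rw [mem_badComps] at hH
  exact ⟨v, H, hH.1, hH.2.1, fun T hT hTb => hmin T (by simp [hT, hTb])⟩

variable {v : V} {H : Finset V}

lemma Pole.notMem (hp : Pole G v H) : v ∉ H := fun hv => by
  have := hp.comp.1 hv
  simp at this

lemma Pole.nonadj (hp : Pole G v H) {y : V} (hy : y ∈ H) : ¬ G.Adj v y := fun hv => by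
  have := hp.comp.1 hy
  simp [hv] at this

lemma Pole.adj (hp : Pole G v H) {x y : V} (hy : y ∈ H) (hx : x ∉ H) (hyx : G.Adj y x) :
    G.Adj v x := by
  by_contra hvx
  have hxv : x ≠ v := by
    rintro rfl
    exact hp.nonadj hy hyx.symm
  exact hp.comp.2.2 y hy x (by simp [hvx, hxv]) hx hyx

lemma Pole.conn_sdiff (hp : Pole G v H) {S : Finset V} (hS : Conn G S) (hv : v ∈ S) :
    Conn G (S \ H) := by
  refine conn_of_root (x := v) (by simp [hv, hp.notMem]) fun A hA hvA hne => ?_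
  have hne' : ((S \ H) \ A).Nonempty := by
    rw [sdiff_nonempty]
    exact fun hc => hne (hA.antisymm hc)
  obtain ⟨a, ha, b, hb, hbA, hab⟩ := hS.2 ((S \ H) \ A) (fun x => by grind) hne'
    (fun hc => by rw [← hc] at hv; simp [hvA] at hv)
  simp only [mem_sdiff] at ha hbA
  by_cases hbH : b ∈ H
  · exact ⟨v, hvA, a, by simp [ha], ha.2, hp.adj hbH ha.1.2 hab.symm⟩
  · exact ⟨b, by tauto, a, by simp [ha], ha.2, hab.symm⟩

lemma Pole.conn_erase (h : MinCE G) (hp : Pole G v H) {x : V} (hx : x ≠ v) :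
    Conn G ((univ \ H).erase x) := by
  have := hp.conn_sdiff (h.conn_erase x) (by simp [hx.symm])
  rwa [erase_sdiff_comm] at this

/-- A bad component around a vertex of `H` contains `v`, or its link is in that of the vertex. -/
lemma Pole.mem_or (hp : Pole G v H) {y : V} (hy : y ∈ H) {Y T : Finset V} (hY : Y ⊆ nbhd G y)
    (hT : IsComp G T (univ \ Y)) (hTb : Bad G T)
    (hTH : v ∉ T → (∀ x ∈ T, ¬ G.Adj v x) → ∀ x ∈ T, x ∉ H) :
    v ∈ T ∨ outer G H y = link G H := by
  by_contra! hcon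
  obtain ⟨hvT, hne⟩ := hcon
  have hvY : v ∉ Y := fun hv => by
    have := hY hv
    simp at this
    rcases this with rfl | this
    · exact hp.notMem hy
    · exact hp.nonadj hy this.symm
  have hTv : ∀ x ∈ T, ¬ G.Adj v x := fun x hx hvx =>
    hT.2.2 x hx v (by simp [hvY]) hvT hvx.symm
  have hTH := hTH hvT hTv
  have hTn : T ⊆ univ \ nbhd G v := fun x hx => by
    have : x ≠ v := fun hc => hvT (hc ▸ hx)
    simp [this, hTv x hx]
  have hTHadj : ∀ t ∈ T, ∀ b ∈ H, ¬ G.Adj t b := fun t ht b hb htb =>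
    hp.comp.2.2 b hb t (hTn ht) (hTH t ht) htb.symm
  have hYo : ∀ x ∈ Y, x ∉ H → x ∈ outer G H y := fun x hx hxH => by
    have := hY hx
    simp at this
    rcases this with rfl | this
    · exact absurd hy hxH
    · simp [hxH, this]
  have hcomp : IsComp G T (univ \ nbhd G v) := hT.of_isComp hTn fun a ha b hb hbY hab => by
    simp only [mem_sdiff, mem_univ, true_and, not_not] at hb hbY
    by_cases hbH : b ∈ H
    · exact hTHadj a ha b hbH hab
    · have := hYo b hbY hbH
      rw [mem_outer] at this
      exact hb (by simp [hp.adj hy hbH this.2])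
  have hlink : link G T ⊆ outer G H y := fun w hw => by
    rw [mem_link] at hw
    obtain ⟨hwT, t, ht, htw⟩ := hw
    have hwY : w ∈ Y := by
      by_contra hwY
      exact hT.2.2 t ht w (by simp [hwY]) hwT htw
    exact hYo w hwY fun hwH => hTHadj t ht w hwH htw
  have h1 := card_le_card hlink
  have h2 := hp.min T hcomp hTb
  exact hne (eq_of_subset_of_card_le (outer_subset_link hy) (by omega))

/-- Opposite vertices of a four-vertex pole. -/
lemma Pole.two_le_opposite (h : MinCE G) (hn : Fintype.card V ≠ 9) (hp : Pole G v H) (hH : Bad4 G H)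
    {y p z q x : V} (hHe : H = {y, p, z, q}) (hyp : G.Adj y p) (hqy : G.Adj q y)
    (hx : x ∉ H) (hyx : G.Adj y x) :
    ¬ G.Adj y z ∧ 2 ≤ #(outer G H z \ nbhd G y) := by
  have hyH : y ∈ H := by simp [hHe]
  have hvx : v ≠ x := fun hc => hp.nonadj hyH (hc ▸ hyx.symm)
  have hnf : ¬ Free G y (insert x H) := fun hf => by
    refine h.false_of_five hn (by rw [card_insert_of_notMem hx, hH.1]) hf
      (hH.conn.insert hyH hyx) ?_
    rw [sdiff_insert]
    exact hp.conn_erase h hvx.symm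
  by_contra hcon
  apply hnf
  by_cases hyz : G.Adj y z
  · refine free_of_subset fun w hw => ?_
    rw [mem_insert, hHe] at hw
    simp only [mem_insert, mem_singleton] at hw
    rw [mem_nbhd]
    rcases hw with rfl | rfl | rfl | rfl | rfl <;> simp_all [G.adj_comm]
  have hle : #(outer G H z \ nbhd G y) ≤ 1 := by
    by_contra hc
    exact hcon ⟨hyz, by omega⟩
  have hins : insert x H = insert z {x, y, p, q} := by
    rw [hHe]
    ext
    simp
    tauto
  rw [hins]
  refine (free_of_subset fun w hw => ?_).insert fun r s hr hs hrY hsY hzr hzs => ?_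
  · simp only [mem_insert, mem_singleton] at hw
    rw [mem_nbhd]
    rcases hw with rfl | rfl | rfl | rfl <;> simp_all [G.adj_comm]
  · have key : ∀ r, r ∉ nbhd G y → r ∉ ({x, y, p, q} : Finset V) → G.Adj z r →
        r ∈ outer G H z \ nbhd G y := fun r hr hrY hzr => by
      have := hzr.ne
      simp only [mem_insert, mem_singleton, not_or] at hrY
      rw [mem_sdiff, mem_outer, hHe]
      simp only [mem_insert, mem_singleton]
      exact ⟨⟨by tauto, hzr⟩, hr⟩
    exact card_le_one.mp hle r (key r hr hrY hzr) s (key s hs hsY hzs)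

/-- A vertex of a four-vertex pole which does not see the whole link. -/
lemma Pole.exists_bad4 (h : MinCE G) (hp : Pole G v H)
    {y p z q : V} (hHe : H = {y, p, z, q}) (hyp : G.Adj y p) (hqy : G.Adj q y) (hpq : p ≠ q)
    (hyz : ¬ G.Adj y z) (h2 : 2 ≤ #(outer G H y)) (hl : outer G H y ≠ link G H) :
    #(nbhd G y) = 5 ∧ #(outer G H y) = 2 ∧
      ∃ T, IsComp G T (univ \ nbhd G y) ∧ Bad G T ∧ v ∈ T := by
  have hyH : y ∈ H := by simp [hHe]
  have hcard : #(nbhd G y) = 3 + #(outer G H y) := by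
    have he : nbhd G y = {y, p, q} ∪ outer G H y := by
      ext w
      have := hyp
      have := hqy.symm
      simp only [mem_nbhd, mem_union, mem_insert, mem_singleton, mem_outer, hHe]
      grind
    rw [he, card_union_of_disjoint, card_eq_three.mpr ⟨y, p, q, hyp.ne, hqy.ne.symm, hpq, rfl⟩]
    rw [Finset.disjoint_left]
    intro w hw hw'
    rw [mem_outer, hHe] at hw'
    simp at hw hw'
    tauto
  have hv : ∀ T, IsComp G T (univ \ nbhd G y) → Bad G T → v ∈ T := fun T hT hTb => by
    refine (hp.mem_or hyH Subset.rfl hT hTb fun hvT hTv x hx hxH => ?_).resolve_right hl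
    have hTn : ∀ t ∈ T, t ∉ nbhd G y := fun t ht => by simpa using hT.1 ht
    have hxz : x = z := by
      have := hTn x hx
      rw [hHe] at hxH
      simp at hxH this
      have := hyp
      have := hqy.symm
      grind
    obtain ⟨w, hw, hxw⟩ := hT.2.1.exists_adj hx (by have := hTb.card; omega)
    by_cases hwH : w ∈ H
    · have := hTn w hw
      rw [hHe] at hwH
      simp at hwH this
      have := hyp
      have := hqy.symm
      have := hxw.ne
      grind
    · exact hTv w hw (hp.adj hxH hwH hxw)
  have hle : #(badComps G (univ \ nbhd G y) (nbhd G y)) ≤ 1 := by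
    refine card_le_one.mpr fun T hT T' hT' => ?_
    rw [mem_badComps] at hT hT'
    exact hT.1.eq_of_mem hT'.1 (hv T hT.1 hT.2.1) (hv T' hT'.1 hT'.2.1)
  have := h.card_le ⟨y, by simp⟩ (free_of_subset (y := y) (Y := nbhd G y) Subset.rfl)
  obtain ⟨T, hT, hTb, -⟩ := h.exists_badComp (by omega)
    (free_of_subset (y := y) (Y := nbhd G y) Subset.rfl)
  exact ⟨by omega, by omega, T, hT, hTb, hv T hT hTb⟩

/-- The bad component opposite to a vertex of a four-vertex pole. -/
lemma Pole.eq_insert_outer (hp : Pole G v H)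
    {y z : V} (hz : z ∈ H) (hN : ∀ x ∈ H, x ∉ nbhd G y → x = z) (hyz : z ∉ nbhd G y)
    (h2 : #(outer G H z) = 2) (hd : ∀ r ∈ outer G H z, r ∉ nbhd G y)
    {T : Finset V} (hT : IsComp G T (univ \ nbhd G y)) (hTb : Bad G T) (hv : v ∈ T) :
    #T = 4 ∧ T = insert v (insert z (outer G H z)) := by
  have hzH := hz
  have hout : outer G H z ⊆ T := fun r hr => by
    by_contra hrT
    have := mem_outer.mp hr
    exact hT.2.2 v hv r (by simpa using hd r hr) hrT (hp.adj hz this.1 this.2)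
  obtain ⟨r, hr⟩ := card_pos.mp (show 0 < #(outer G H z) by omega)
  have hzT : z ∈ T := by
    by_contra hzT
    exact hT.2.2 r (hout hr) z (by simpa using hyz) hzT (mem_outer.mp hr).2.symm
  have hznT : nbhd G z ∩ T = insert z (outer G H z) := by
    ext w
    simp only [mem_inter, mem_nbhd, mem_insert, mem_outer]
    constructor
    · rintro ⟨rfl | hzw, hwT⟩
      · exact Or.inl rfl
      · by_cases hwH : w ∈ H
        · refine Or.inl (hN w hwH ?_)
          simpa using hT.1 hwT
        · exact Or.inr ⟨hwH, hzw⟩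
    · rintro (rfl | hw)
      · exact ⟨Or.inl rfl, hzT⟩
      · exact ⟨Or.inr hw.2, hout (mem_outer.mpr hw)⟩
  have hzo : z ∉ outer G H z := by simp [hz]
  have hc3 : #(nbhd G z ∩ T) = 3 := by rw [hznT, card_insert_of_notMem hzo, h2]
  have hT4 : #T = 4 := by
    rcases hTb with h4 | h9
    · exact h4.1
    · rcases h9.nine.vert z hzT with ⟨h5, -⟩ | ⟨b', hb'⟩
      · omega
      · have := hb'.card
        omega
  refine ⟨hT4, (eq_of_subset_of_card_le ?_ ?_).symm⟩
  · exact insert_subset hv (insert_subset hzT hout)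
  · rw [card_insert_of_notMem, card_insert_of_notMem hzo, h2, hT4]
    rw [mem_insert, mem_outer]
    rintro (rfl | hc)
    · exact hp.notMem hz
    · exact hp.nonadj hz hc.2.symm

lemma Pole.false_of_bad4 (h : MinCE G) (hn : Fintype.card V ≠ 9) (hp : Pole G v H)
    (hH : Bad4 G H) : False := by
  obtain ⟨w, hw⟩ := hH.conn.1
  obtain ⟨y, hyH, x, hx, hyx⟩ := h.exists_edge hw hp.notMem
  obtain ⟨p, z, q, hHe, hyz, hpq, hyp, hyq, hzp, hzq, a1, a2, a3, a4⟩ := hH.cycle hyH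
  have hzH : z ∈ H := by simp [hHe]
  have hHe' : H = {z, p, y, q} := by rw [hHe]; ext; simp; tauto
  obtain ⟨hnyz, hoz⟩ := hp.two_le_opposite h hn hH hHe a1 a4 hx hyx
  obtain ⟨r, hr⟩ := card_pos.mp (show 0 < #(outer G H z \ nbhd G y) by omega)
  have hr := mem_outer.mp (mem_sdiff.mp hr).1
  obtain ⟨-, hoy⟩ := hp.two_le_opposite h hn hH hHe' a2.symm a3.symm hr.1 hr.2
  have hl : ∀ y z, z ∈ H → 2 ≤ #(outer G H z \ nbhd G y) → outer G H y ≠ link G H := by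
    intro y z hz h2 hc
    obtain ⟨r, hr⟩ := card_pos.mp (show 0 < #(outer G H z \ nbhd G y) by omega)
    rw [mem_sdiff] at hr
    have := outer_subset_link hz hr.1
    rw [← hc, mem_outer] at this
    exact hr.2 (by simp [this])
  obtain ⟨hy5, hy2, T, hT, hTb, hvT⟩ := hp.exists_bad4 h hHe a1 a4 hpq hnyz
    (hoy.trans (card_le_card sdiff_subset)) (hl y z hzH hoz)
  obtain ⟨-, hz2, T', hT', hTb', hvT'⟩ := hp.exists_bad4 h hHe' a2.symm a3.symm hpq
    (fun hc => hnyz hc.symm) (hoz.trans (card_le_card sdiff_subset)) (hl z y hyH hoy)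
  have hdz : outer G H z \ nbhd G y = outer G H z :=
    eq_of_subset_of_card_le sdiff_subset (by omega)
  have hdy : outer G H y \ nbhd G z = outer G H y :=
    eq_of_subset_of_card_le sdiff_subset (by omega)
  obtain ⟨hT4, hTe⟩ := hp.eq_insert_outer hzH (fun x hxH hxn => by
    rw [hHe] at hxH
    simp at hxH hxn
    have := a4.symm
    grind) (by simp [hyz.symm, hnyz]) hz2 (fun r hr => by rw [← hdz, mem_sdiff] at hr; exact hr.2)
    hT hTb hvT
  obtain ⟨-, hTe'⟩ := hp.eq_insert_outer hyH (fun x hxH hxn => by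
    rw [hHe] at hxH
    simp at hxH hxn
    have := a2.symm
    grind) (by simp [hyz, G.adj_comm z y, hnyz]) hy2
    (fun r hr => by rw [← hdy, mem_sdiff] at hr; exact hr.2) hT' hTb' hvT'
  have hdis : Disjoint (nbhd G y) T := Finset.disjoint_left.mpr fun w hw hwT => by
    have := hT.1 hwT
    simp at this hw
    tauto
  obtain ⟨w, hw⟩ : ∃ w, w ∉ nbhd G y ∪ T := by
    by_contra! hc
    refine hn ?_
    rw [← card_univ, ← eq_univ_iff_forall.mpr hc, card_union_of_disjoint hdis, hy5, hT4]
  obtain ⟨b, hb, a, ha, hab⟩ := h.exists_edge (S := nbhd G y ∪ T) (a := y) (by simp) hw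
  rw [mem_union, not_or] at ha
  have haH : a ∉ H := fun haH => by
    have hat : a ≠ z := fun hc => ha.2 (by rw [hTe, hc]; simp)
    have := ha.1
    rw [hHe] at haH
    simp at haH this
    have := a4.symm
    grind
  have haT : ∀ t ∈ T, ¬ G.Adj t a := fun t ht => hT.2.2 t ht a (by simpa using ha.1) ha.2
  have hbH : b ∉ H := fun hbH => haT v hvT (hp.adj hbH haH hab)
  rw [mem_union] at hb
  rcases hb with hb | hb
  · have hyb : G.Adj y b := by
      rw [mem_nbhd] at hb
      exact hb.resolve_left fun hc => hbH (hc ▸ hyH)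
    have hbT' : b ∈ T' := by rw [hTe']; simp [hbH, hyb]
    have haz : a ∉ nbhd G z := fun hc => by
      rw [mem_nbhd] at hc
      refine hc.elim (fun hc => haH (hc ▸ hzH)) fun hc => ha.2 ?_
      rw [hTe]
      simp [haH, hc]
    have haT' : a ∈ T' := by
      by_contra hc
      exact hT'.2.2 b hbT' a (by simpa using haz) hc hab
    rw [hTe', mem_insert, mem_insert, mem_outer] at haT'
    rcases haT' with rfl | rfl | hc
    · exact ha.2 hvT
    · exact haH hyH
    · exact ha.1 (by simp [hc.2])
  · exact haT b hb hab

end Pole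

end SquareIsolation

namespace SquareIsolation

open Finset
open scoped Classical

section NinePole

variable {V : Type*} [Fintype V] {G : SimpleGraph V} {v : V} {H : Finset V}

/-- Around a loose twin, nine-vertex poles have components of a restricted kind. -/
lemma Pole.notMem_of_twins {b b' n : V} (ht : Twins G H b b') (hn : n ∈ H)
    (hbn : G.Adj b n) {q : V} (hq : q ∈ H) (hqb' : q ≠ b') (hqb : q ∉ nbhd G b) (hnq : G.Adj n q)
    {T : Finset V} (hT : IsComp G T (univ \ (nbhd G b).erase n)) (hTd : Disjoint T (nbhd G b)) :
    ∀ x ∈ T, x ∉ H :=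
  ht.notMem_of_isComp hbn hn hq hqb' hqb hnq hT hTd (by simp) fun x _ hxb => by
    simp only [mem_erase, not_and]
    exact fun _ => hxb

lemma Pole.outer_eq_link (h : MinCE G) (hp : Pole G v H) {b b' : V} (hb : b ∈ H)
    (ht : Twins G H b b') (hne : (outer G H b).Nonempty)
    (h1 : ∀ p ∈ outer G H b, 2 ≤ #((outer G H b').erase p))
    (h2 : ∀ p ∈ outer G H b', 2 ≤ #((outer G H b).erase p)) :
    outer G H b = link G H ∧ 11 ≤ #(univ \ H) := by
  obtain ⟨p, hpo⟩ := hne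
  obtain ⟨p', hpo'⟩ := card_pos.mp (show 0 < #((outer G H b').erase p) by have := h1 p hpo; omega)
  have h3 := h2 p' (mem_erase.mp hpo').2
  have h4 : #((outer G H b).erase p') ≤ #(outer G H b) := card_erase_le
  obtain ⟨n, hnH, hbn, q, hq, hqb', hqb, hnq⟩ := ht.nbr
  have hcard : #((nbhd G b).erase n) = 3 + #(outer G H b) := by
    have he : nbhd G b = nbhd G b ∩ H ∪ outer G H b := by
      ext w
      simp only [mem_nbhd, mem_union, mem_inter, mem_outer]
      grind
    rw [card_erase_of_mem (by simp [hbn]), he, card_union_of_disjoint, ht.card]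
    · omega
    · rw [Finset.disjoint_left]
      intro w hw hw'
      rw [mem_outer] at hw'
      exact hw'.1 (mem_inter.mp hw).2
  have hf : Free G b ((nbhd G b).erase n) := free_of_subset (erase_subset _ _)
  have hTH : ∀ T ∈ badComps G (univ \ (nbhd G b).erase n) (nbhd G b), ∀ x ∈ T, x ∉ H :=
    fun T hT => by
      rw [mem_badComps] at hT
      exact Pole.notMem_of_twins ht hnH hbn hq hqb' hqb hnq hT.1 hT.2.2
  have hl : outer G H b = link G H := by
    by_contra hl
    have hv : ∀ T ∈ badComps G (univ \ (nbhd G b).erase n) (nbhd G b), v ∈ T := fun T hT => by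
      have := hTH T hT
      rw [mem_badComps] at hT
      exact (hp.mem_or hb (erase_subset _ _) hT.1 hT.2.1 fun _ _ => this).resolve_right hl
    have hle : #(badComps G (univ \ (nbhd G b).erase n) (nbhd G b)) ≤ 1 := by
      refine card_le_one.mpr fun T hT T' hT' => ?_
      have := hv T hT
      have := hv T' hT'
      rw [mem_badComps] at hT hT'
      exact hT.1.eq_of_mem hT'.1 (by assumption) (by assumption)
    have := h.card_le (Y := (nbhd G b).erase n) (card_pos.mp (by omega)) hf
    obtain ⟨T, hT, hTb, hTd⟩ := h.exists_badComp (by omega) hf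
    have hTm := mem_badComps.mpr ⟨hT, hTb, hTd⟩
    have hsub : outer G H b' ⊆ outer G H b := fun r hr => by
      rw [mem_outer] at hr ⊢
      refine ⟨hr.1, ?_⟩
      by_contra hbr
      have hrn : r ∉ (nbhd G b).erase n := by
        simp only [mem_erase, mem_nbhd, not_and, not_or]
        exact fun _ => ⟨fun hc => hr.1 (hc ▸ hb), hbr⟩
      have hrT : r ∈ T := by
        by_contra hrT
        exact hT.2.2 v (hv T hTm) r (by simpa using hrn) hrT (hp.adj ht.mem hr.1 hr.2)
      have hb'n : b' ∉ (nbhd G b).erase n := by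
        simp only [mem_erase, mem_nbhd, not_and, not_or]
        exact fun _ => ⟨ht.ne, fun hc => (G.irrefl ((ht.same b' ht.mem).mp hc))⟩
      refine hT.2.2 r hrT b' (by simpa using hb'n) (fun hc => hTH T hTm b' hc ht.mem) hr.2.symm
    have := card_le_card (erase_subset_erase p hsub)
    have := h1 p hpo
    rw [card_erase_of_mem hpo] at *
    omega
  refine ⟨hl, ?_⟩
  have h5 : outer G H b' ⊆ outer G H b := hl ▸ outer_subset_link ht.mem
  have h6 : 3 ≤ #(outer G H b) := by
    rw [card_erase_of_mem (h5 (mem_erase.mp hpo').2)] at h3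
    omega
  obtain ⟨T, hT, T', hT', hTT'⟩ := h.exists_two_badComps (Y := (nbhd G b).erase n) (by omega) hf
  have hsub : outer G H b ∪ (T ∪ T') ⊆ univ \ H := fun x hx => by
    simp only [mem_union, mem_outer] at hx
    have := hTH T hT x
    have := hTH T' hT' x
    simp only [mem_sdiff, mem_univ, true_and]
    tauto
  have hdo : ∀ T ∈ badComps G (univ \ (nbhd G b).erase n) (nbhd G b), ∀ x ∈ outer G H b, x ∉ T := by
    intro T hT x hx hxT
    rw [mem_badComps] at hT
    exact Finset.disjoint_left.mp hT.2.2 hxT (by simp [(mem_outer.mp hx).2])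
  have := card_le_card hsub
  rw [card_union_of_disjoint, card_union_of_disjoint] at this
  · have := (mem_badComps.mp hT).2.1.card
    have := (mem_badComps.mp hT').2.1.card
    omega
  · exact Finset.disjoint_left.mpr ((mem_badComps.mp hT).1.disjoint (mem_badComps.mp hT').1 hTT')
  · refine Finset.disjoint_left.mpr fun x hx hx' => ?_
    rw [mem_union] at hx'
    exact hx'.elim (hdo T hT x hx) (hdo T' hT' x hx)

/-- If only two twins of a nine-vertex pole are linked, there is a small isolating set. -/
lemma Pole.false_of_two_linked (h : MinCE G) (hp : Pole G v H) (hH : Nine G H) {b b' x : V}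
    (hb : b ∈ H) (hxH : x ∉ H) (hbx : G.Adj b x) (hbx' : G.Adj b' x)
    (hl : ∀ c ∈ H, c ≠ b → c ≠ b' → ∀ r ∉ H, ¬ G.Adj c r) : False := by
  have hxv : x ≠ v := fun hc => hp.nonadj hb (hc ▸ hbx.symm)
  obtain ⟨u, -, hu⟩ := hH.kill b hb
  obtain ⟨D, hD, hDc⟩ := h.exists_isolating (nbhd G x) (S := (univ \ H).erase x) (fun hc => by
    have : x ∈ (univ \ H).erase x := by rw [hc]; exact mem_univ x
    simp at this)
  have h0 : #(badComps G ((univ \ H).erase x) (nbhd G x)) = 0 := by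
    rw [card_eq_zero, eq_empty_iff_forall_notMem]
    intro T hT
    rw [mem_badComps] at hT
    have := hT.1.eq_of_conn (hp.conn_erase h hxv)
    exact Finset.disjoint_left.mp hT.2.2 (show v ∈ T by rw [this]; simp [hxv.symm, hp.notMem])
      (by simp [(hp.adj hb hxH hbx).symm])
  have hlt := h.min (insert x (insert u D)) fun hC => by
    rcases hC.split H fun a ha haH c hc hcH hac => by
      have h1 : a ≠ b := by
        rintro rfl
        have := (mem_sdiff.mp ha).2
        rw [mem_nbhds] at this
        exact this ⟨x, by simp, Or.inr hbx.symm⟩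
      have h2 : a ≠ b' := by
        rintro rfl
        have := (mem_sdiff.mp ha).2
        rw [mem_nbhds] at this
        exact this ⟨x, by simp, Or.inr hbx'.symm⟩
      exact hl a haH h1 h2 c hcH hac
      with hC | hC
    · refine hu (hC.mono fun w hw => ?_)
      simp only [mem_inter, mem_sdiff, mem_univ, true_and, mem_nbhds, mem_insert, not_exists] at hw
      simp only [mem_sdiff, mem_erase]
      refine ⟨⟨?_, hw.2⟩, fun hwu => hw.1 u ⟨by simp, by simpa using hwu⟩⟩
      rintro rfl
      exact hw.1 x ⟨by simp, Or.inr hbx.symm⟩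
    · refine hD (hC.mono fun w hw => ?_)
      simp only [mem_sdiff, mem_univ, true_and, mem_nbhds, mem_insert, not_exists] at hw
      simp only [mem_sdiff, mem_erase, mem_univ, true_and, mem_nbhds, not_exists]
      have hwx : ¬ (w = x ∨ G.Adj x w) := fun hc => hw.1 x ⟨by simp, hc⟩
      refine ⟨⟨⟨fun hc => hwx (Or.inl hc), hw.2⟩, fun hc => hwx (by simpa using hc)⟩,
        fun d hd => ?_⟩
      exact hw.1 d ⟨by simp [hd.1], hd.2⟩
  have := card_insert_le x (insert u D)
  have := card_insert_le u D
  have hc := card_sdiff_add_card_eq_card (subset_univ H)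
  rw [hH.card, card_univ] at hc
  rw [card_erase_of_mem (by simp [hxH])] at hDc
  have : 0 < #(univ \ H) := card_pos.mpr ⟨x, by simp [hxH]⟩
  omega

lemma Pole.false_of_nine (h : MinCE G) (hp : Pole G v H) (hH : Nine G H) : False := by
  have hne : ∀ b ∈ H, ∀ p ∉ H, G.Adj b p → p ≠ v := fun b hb p _ hbp hc =>
    hp.nonadj hb (hc ▸ hbp.symm)
  have hP : ∀ b ∈ H, ∀ p ∉ H, G.Adj b p → ∀ T, IsComp G T ((univ \ H).erase p) → Bad G T →
      T = (univ \ H).erase p := fun b hb p hpH hbp T hT _ =>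
    hT.eq_of_conn (hp.conn_erase h (hne b hb p hpH hbp))
  rcases h.tight_or_loose hH hP with ht | ⟨b, hb, b', ht, hbo, hbo', h1, h2⟩
  · obtain ⟨w, hw⟩ := hH.conn.1
    obtain ⟨b, hb, p, hpH, hbp⟩ := h.exists_edge hw hp.notMem
    refine h.false_of_tight hH ?_
      (fun b hb p hpH hbp => ⟨v, hp.notMem, (hp.adj hb hpH hbp).symm⟩) ht
    exact one_lt_card.mpr ⟨p, by simp [hpH], v, by simp [hp.notMem], hne b hb p hpH hbp⟩
  obtain ⟨hl, h11⟩ := hp.outer_eq_link h hb ht hbo h1 h2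
  obtain ⟨hl', -⟩ := hp.outer_eq_link h ht.mem (ht.symm hH hb) hbo' h2 h1
  obtain ⟨x, hx⟩ := hbo
  have hx' := hx
  rw [hl, ← hl', mem_outer] at hx'
  rw [mem_outer] at hx
  refine hp.false_of_two_linked h hH hb hx.1 hx.2 hx'.2 fun c hc hcb hcb' r hr hcr => ?_
  by_cases hbc : G.Adj b c
  · rcases h.tight_or hH hc hr hcr (hP c hc r hr hcr) with htc | ⟨c', hc', -⟩
    · have := htc.bad.card
      rw [card_erase_of_mem (by simp [hr])] at this
      omega
    · have := hc'.card
      have := ht.four c hc hbc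
      omega
  have hcl : r ∈ outer G H b := by rw [hl]; simp only [mem_link]; exact ⟨hr, c, hc, hcr⟩
  obtain ⟨p, hp0⟩ := card_pos.mp (show 0 < #((outer G H b).erase r) by
    have := h2 r (by rwa [hl', ← hl])
    omega)
  rw [mem_erase, mem_outer] at hp0
  obtain ⟨hpr, hpH, hbp⟩ := hp0
  obtain ⟨T, hT, hTb, hTd⟩ := h.exists_badComp (y := b) (Y := insert p (nbhd G b ∩ H))
    (by rw [card_insert_of_notMem (by simp [hpH]), ht.card]) (free_of_subset fun w hw => by
      rw [mem_insert, mem_inter] at hw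
      rcases hw with rfl | hw
      · simp [hbp]
      · exact hw.1)
  have hrT : r ∉ T := fun hrT =>
    Finset.disjoint_left.mp hTd hrT (by simp [(mem_outer.mp hcl).2])
  have hY : ∀ w, w ∉ H → w ≠ p → w ∈ univ \ insert p (nbhd G b ∩ H) := fun w hw hwp => by
    simp [hw, hwp]
  have hYH : ∀ w ∈ H, w ∉ nbhd G b → w ∈ univ \ insert p (nbhd G b ∩ H) := fun w hw hwb => by
    simp only [mem_sdiff, mem_univ, mem_insert, mem_inter, true_and, not_or, not_and]
    exact ⟨fun hc => hpH (hc ▸ hw), fun hc => absurd hc hwb⟩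
  have hTP : ∀ w ∈ T, w ∉ H → w ≠ p → False := fun w hw hwH hwp => hrT <|
    (hp.conn_erase h (hne b hb p hpH hbp)).subset_of_isComp hT (fun z hz => by
      simp only [mem_erase, mem_sdiff] at hz
      exact hY z hz.2.2 hz.1) (a := w) (by simp [hwH, hwp]) hw (by simp [hr, hpr.symm])
  obtain ⟨w, hw⟩ := hT.2.1.1
  have hwb : w ∉ nbhd G b := fun hc => Finset.disjoint_left.mp hTd hw hc
  have hwH : w ∈ H := by
    by_contra hwH
    exact hTP w hw hwH fun hc => hwb (by simp [hc, hbp])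
  by_cases hwb' : w = b'
  · subst hwb'
    have hbr := hcl
    rw [hl, ← hl', mem_outer] at hbr
    exact hT.2.2 w hw r (hY r hr hpr.symm) hrT hbr.2
  · have hcT := ht.bad.conn.subset_of_isComp hT (fun z hz => by
      simp only [mem_erase, mem_sdiff] at hz
      exact hYH z hz.2.1 hz.2.2) (a := w) (by
        simp only [mem_erase, mem_sdiff]
        exact ⟨hwb', hwH, hwb⟩) hw
      (show c ∈ (H \ nbhd G b).erase b' by simp [hc, hcb, hcb', hbc])
    exact hT.2.2 c hcT r (hY r hr hpr.symm) hrT hcr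

/-- Minimal counterexamples have nine vertices. -/
lemma MinCE.card_eq_nine (h : MinCE G) : Fintype.card V = 9 := by
  by_contra hn
  obtain ⟨v, H, hp⟩ := h.exists_pole hn
  exact hp.bad.elim (hp.false_of_bad4 h hn) fun h9 => hp.false_of_nine h h9.nine

end NinePole

end SquareIsolation

namespace SquareIsolation

open Finset
open scoped Classical

section NineVertices

variable {V : Type*} [Fintype V] {G : SimpleGraph V}

lemma nineCert_lower : ∀ a b : Fin 9, (758533009944134946144798).testBit (9 * a + b) = true →
    s(a, b) ∈
      [s(0, 1), s(0, 2), s(0, 3), s(0, 4), s(5, 6), s(6, 7), s(7, 8), s(8, 5), s(1, 5)] := by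
  decide +kernel

lemma nineCert_upper : ∀ a b : Fin 9, (1203012466040917281733150).testBit (9 * a + b) = false →
    a = b ∨ a = 0 ∧ 5 ≤ b ∨ b = 0 ∧ 5 ≤ a := by
  decide +kernel

lemma bad9_of_card_nbhd_eq_five (hV : Fintype.card V = 9) (hconn : Conn G univ)
    (hG : ∀ w, HasC4 G (univ \ nbhd G w)) {v : V} (hv : #(nbhd G v) = 5) : Bad9 G univ := by
  have hQ : Bad4 G (univ \ nbhd G v) := ⟨by rw [card_univ_sdiff, hV, hv], hG v⟩
  obtain ⟨n, hn, q, -, hq, hnq⟩ := hconn.2 (nbhd G v) (subset_univ _) ⟨v, by simp⟩ fun hc => by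
    rw [hc, card_univ, hV] at hv
    omega
  have hvn : G.Adj v n := by
    rcases mem_nbhd.mp hn with rfl | hvn
    · exact absurd (mem_nbhd.mpr (.inr hnq)) hq
    · exact hvn
  obtain ⟨p, z, r, hS, -, -, -, -, -, -, hqp, hpz, hzr, hrq⟩ :=
    hQ.cycle (y := q) (by rw [mem_sdiff]; exact ⟨mem_univ q, hq⟩)
  have h3 : #(((nbhd G v).erase v).erase n) = 3 := by
    rw [card_erase_of_mem (by simp [hvn, hvn.ne']), card_erase_of_mem (by simp), hv]
  obtain ⟨x, y, w, -, -, -, hN⟩ := card_eq_three.mp h3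
  have hNmem : ∀ u, u ∈ ({x, y, w} : Finset V) → G.Adj v u := fun u hu => by
    rw [← hN, mem_erase, mem_erase, mem_nbhd] at hu
    exact hu.2.2.resolve_left hu.2.1
  have hSmem : ∀ u, u ∈ ({q, p, z, r} : Finset V) → ¬ G.Adj v u := fun u hu hvu => by
    rw [← hS, mem_sdiff, mem_nbhd] at hu
    exact hu.2 (.inr hvu)
  let f : Fin 9 → V := ![v, n, x, y, w, q, p, z, r]
  have hf : Function.Surjective f := fun u => by
    have hu : u = v ∨ u = n ∨ u ∈ ({x, y, w} : Finset V) ∨ u ∈ ({q, p, z, r} : Finset V) := by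
      rw [← hN, ← hS, mem_erase, mem_erase, mem_sdiff]
      simp only [mem_univ, true_and]
      tauto
    simp only [mem_insert, mem_singleton] at hu
    rcases hu with h | h | (h | h | h) | (h | h | h | h)
    exacts [⟨0, h.symm⟩, ⟨1, h.symm⟩, ⟨2, h.symm⟩, ⟨3, h.symm⟩, ⟨4, h.symm⟩, ⟨5, h.symm⟩,
      ⟨6, h.symm⟩, ⟨7, h.symm⟩, ⟨8, h.symm⟩]
  have hinj : Function.Injective f :=
    ((Fintype.bijective_iff_surjective_and_card f).mpr ⟨hf, by simp [hV]⟩).injective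
  have hedge : ∀ a b : Fin 9, s(a, b) ∈ [s(0, 1), s(0, 2), s(0, 3), s(0, 4), s(5, 6), s(6, 7),
      s(7, 8), s(8, 5), s(1, 5)] → G.Adj (f a) (f b) := fun a b hab => by
    rw [← SimpleGraph.mem_edgeSet, ← Sym2.map_mk]
    generalize s(a, b) = e at hab
    simp only [List.mem_cons, List.not_mem_nil, or_false] at hab
    rcases hab with rfl | rfl | rfl | rfl | rfl | rfl | rfl | rfl | rfl
    exacts [hvn, hNmem x (by simp), hNmem y (by simp), hNmem w (by simp), hqp, hpz, hzr, hrq, hnq]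
  have hnon : ∀ b : Fin 9, 5 ≤ b → ¬ G.Adj v (f b) := fun b hb => by
    have : b = 5 ∨ b = 6 ∨ b = 7 ∨ b = 8 := by omega
    rcases this with rfl | rfl | rfl | rfl
    exacts [hSmem q (by simp), hSmem p (by simp), hSmem z (by simp), hSmem r (by simp)]
  refine nineCert.bad9 hV hG (f := ⟨f, hinj⟩)
    ⟨fun a b hab => hedge a b (nineCert_lower a b hab), fun a b hab => ?_⟩ nineCert_check
  by_contra hU
  rcases nineCert_upper a b (by simpa using hU) with rfl | ⟨rfl, hb⟩ | ⟨rfl, ha⟩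
  exacts [hab.ne rfl, hnon b hb hab, hnon a ha hab.symm]

lemma MinCE.bad4_sdiff (h : MinCE G) (hV : Fintype.card V = 9) (hd : ∀ v, #(nbhd G v) ≤ 4)
    {H : Finset V} (hH : Bad4 G H) {y x : V} (hy : y ∈ H) (hx : x ∉ H) (hyx : G.Adj y x) :
    Bad4 G (univ \ insert x H) := by
  obtain ⟨C, hC, hCc, -⟩ := h.exists_bad4_of_degree_le hd hH hy hx hyx
  rwa [← eq_of_subset_of_card_le hCc.1 (by
    rw [card_univ_sdiff, card_insert_of_notMem hx, hV, hH.1, hC.1])]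

/-- There is no minimal counterexample. -/
lemma not_minCE : ¬ MinCE G := fun h => by
  have hV := h.card_eq_nine
  have hG : ∀ w, HasC4 G (univ \ nbhd G w) := fun w => by
    by_contra hw
    have := h.min {w} (by simpa [nbhds] using hw)
    rw [card_singleton] at this
    omega
  by_cases hd : ∀ v, #(nbhd G v) ≤ 4
  · obtain ⟨H, hH, y, hy, x, hx, hyx⟩ := h.exists_bad4
    obtain ⟨C, hCe⟩ : ∃ C, C = univ \ insert x H := ⟨_, rfl⟩
    have hC : Bad4 G C := hCe ▸ h.bad4_sdiff hV hd hH hy hx hyx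
    have hxC : x ∉ C := by simp [hCe]
    have hmem : ∀ w, w ∈ C ↔ w ≠ x ∧ w ∉ H := by simp [hCe]
    obtain ⟨c, hc⟩ := hC.conn.1
    obtain ⟨a, -, ha, b, hb, hbH, hab⟩ := (h.conn_erase x).of_edge_out (A := H) (a := y) (b := c)
      (by simp; grind) hy (by simp; grind) (by grind)
    have hbC : b ∈ C := by simp at hb; grind
    have h1 := (h.bad4_sdiff hV hd hH ha hbH hab).two_adj (x := x) (by simp; grind)
    have h2 := (h.bad4_sdiff hV hd hC hbC (fun haC => ((hmem a).mp haC).2 ha) hab.symm).two_adj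
      (x := x) (by simp; grind)
    have hdis : Disjoint ((univ \ insert b H).filter (G.Adj x))
        ((univ \ insert a C).filter (G.Adj x)) := by
      rw [Finset.disjoint_left]
      intro w hw1 hw2
      simp only [mem_filter, mem_sdiff, mem_univ, mem_insert, true_and, not_or] at hw1 hw2
      have := hw1.2.ne
      grind
    have hsub : insert x ((univ \ insert b H).filter (G.Adj x) ∪
        (univ \ insert a C).filter (G.Adj x)) ⊆ nbhd G x := by
      intro w
      simp only [mem_insert, mem_union, mem_filter, mem_nbhd]
      tauto
    have := card_le_card hsub
    rw [card_insert_of_notMem (by simp), card_union_of_disjoint hdis] at this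
    have := hd x
    omega
  · push Not at hd
    obtain ⟨v, hv⟩ := hd
    have h4 := (hG v).four_le_card
    rw [card_univ_sdiff, hV] at h4
    exact h.notBad (.inr (bad9_of_card_nbhd_eq_five hV h.conn hG (v := v) (by omega)))

end NineVertices

end SquareIsolation

namespace SquareIsolation

open Finset
open scoped Classical

section Transfer

variable {V W : Type*} {G : SimpleGraph V} {f : W ↪ V} {T : Finset W}

lemma hasC4_map_iff : HasC4 G (T.map f) ↔ HasC4 (G.comap f) T := by
  constructor
  · rintro ⟨a, b, c, d, ha, hb, hc, hd, hac, hbd, h⟩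
    obtain ⟨a, ha', rfl⟩ := mem_map.mp ha
    obtain ⟨b, hb', rfl⟩ := mem_map.mp hb
    obtain ⟨c, hc', rfl⟩ := mem_map.mp hc
    obtain ⟨d, hd', rfl⟩ := mem_map.mp hd
    exact ⟨a, b, c, d, ha', hb', hc', hd', fun h => hac (by rw [h]), fun h => hbd (by rw [h]), h⟩
  · rintro ⟨a, b, c, d, ha, hb, hc, hd, hac, hbd, h⟩
    exact ⟨f a, f b, f c, f d, mem_map_of_mem f ha, mem_map_of_mem f hb, mem_map_of_mem f hc,
      mem_map_of_mem f hd, f.injective.ne hac, f.injective.ne hbd, h⟩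

lemma Conn.of_map (h : Conn G (T.map f)) : Conn (G.comap f) T := by
  refine ⟨map_nonempty.mp h.1, fun A hA hne hAT => ?_⟩
  obtain ⟨a, ha, b, hb, hbA, hab⟩ := h.2 (A.map f) (map_subset_map.mpr hA) (hne.map)
    fun hc => hAT (map_injective f hc)
  obtain ⟨a, ha', rfl⟩ := mem_map.mp ha
  obtain ⟨b, hb', rfl⟩ := mem_map.mp hb
  exact ⟨a, ha', b, hb', fun hc => hbA (mem_map_of_mem f hc), hab⟩

lemma Bad.map (h : Bad (G.comap f) T) : Bad G (T.map f) := by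
  refine h.imp (fun h => ⟨(card_map f).trans h.1, hasC4_map_iff.mpr h.2⟩) ?_
  rintro ⟨H, hH, g, rfl, hg⟩
  exact ⟨H, hH, g.trans f, (Finset.map_map ..).symm, hg⟩

lemma map_sdiff_nbhds [Fintype V] [Fintype W] (D : Finset W) :
    T.map f \ nbhds G (D.map f) = (T \ nbhds (G.comap f) D).map f := by
  ext x
  simp only [mem_sdiff, mem_map, mem_nbhds]
  constructor
  · rintro ⟨⟨w, hw, rfl⟩, h⟩
    refine ⟨w, ⟨hw, fun ⟨d, hd, hdw⟩ => h ⟨f d, ⟨d, hd, rfl⟩, hdw.imp (congrArg f) id⟩⟩, rfl⟩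
  · rintro ⟨w, ⟨hw, h⟩, rfl⟩
    refine ⟨⟨w, hw, rfl⟩, ?_⟩
    rintro ⟨_, ⟨d, hd, rfl⟩, hdw⟩
    exact h ⟨d, hd, hdw.imp (fun h => f.injective h) id⟩

end Transfer

section Conclusion

/-- Connected graphs that are not exceptional have small isolating sets. -/
lemma exists_isolating {V : Type*} [Fintype V] {G : SimpleGraph V} (hG : Conn G univ)
    (hbad : ¬ Bad G univ) :
    ∃ D : Finset V, 5 * #D ≤ Fintype.card V ∧ ¬ HasC4 G (univ \ nbhds G D) := by
  induction hn : Fintype.card V using Nat.strong_induction_on generalizing V with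
  | _ n IH =>
  subst hn
  by_contra! hcon
  refine not_minCE (G := G) ⟨hG, hbad, fun S hS hSc hSb => ?_, fun D hD => ?_⟩
  · let f : {x // x ∈ S} ↪ V := Function.Embedding.subtype _
    have hf : univ.map f = S := by
      ext x
      simp [f]
    obtain ⟨x, hx⟩ : ∃ x, x ∉ S := by simpa [Finset.eq_univ_iff_forall] using hS
    obtain ⟨D, hDc, hD⟩ := IH (Fintype.card {x // x ∈ S})
      (by rw [Fintype.card_coe]; exact card_lt_univ_of_notMem hx) (G := G.comap f)
      (Conn.of_map (by rwa [hf])) (fun hb => hSb (by rw [← hf]; exact hb.map)) rfl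
    refine ⟨D.map f, by rwa [card_map, ← Fintype.card_coe S], fun h => hD ?_⟩
    have hm := map_sdiff_nbhds (G := G) (f := f) (T := univ) D
    rw [hf] at hm
    rw [hm] at h
    exact hasC4_map_iff.mp h
  · by_contra! hDc
    exact hD (hcon D hDc)

lemma nonempty_iso {V : Type*} {G : SimpleGraph V} {n : ℕ} {H : SimpleGraph (Fin n)} {f : Fin n → V}
    (hf : f.Bijective) (h : ∀ a b, G.Adj (f a) (f b) ↔ H.Adj a b) : Nonempty (G ≃g H) :=
  ⟨(⟨Equiv.ofBijective f hf, h _ _⟩ : H ≃g G).symm⟩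

variable {V : Type*} [Fintype V] {G : SimpleGraph V}

lemma conn_univ (hG : G.Connected) : Conn G univ := by
  obtain ⟨v⟩ := hG.nonempty
  refine conn_of_root (mem_univ v) fun A _ hv hA => ?_
  obtain ⟨w, hw⟩ : ∃ w, w ∉ A := by simpa [Finset.eq_univ_iff_forall] using hA
  obtain ⟨p⟩ := hG.preconnected v w
  obtain ⟨d, -, hd, hd'⟩ := p.exists_boundary_dart A hv hw
  exact ⟨d.fst, hd, d.snd, mem_univ _, hd', d.adj⟩

lemma Bad4.exists_iso (h : Bad4 G univ) : ∃ H ∈ calG4, Nonempty (G ≃g H.2) := by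
  obtain ⟨v, hv⟩ := h.conn.1
  obtain ⟨p, z, q, hS, hvz, hpq, hvp, hvq, hzp, hzq, hvp', hpz', hzq', hqv'⟩ := h.cycle hv
  have hcard : Fintype.card V = 4 := h.1
  have hbij : ∀ f : Fin 4 → V, f.Surjective → f.Bijective := fun f hf =>
    (Fintype.bijective_iff_surjective_and_card f).mpr ⟨hf, by simp [hcard]⟩
  have hmem : ∀ u, u = v ∨ u = p ∨ u = z ∨ u = q := fun u => by
    have := mem_univ u
    rw [hS] at this
    simpa using this
  have h1 : Function.Bijective ![v, p, z, q] := hbij _ fun u => by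
    rcases hmem u with h | h | h | h
    exacts [⟨0, h.symm⟩, ⟨1, h.symm⟩, ⟨2, h.symm⟩, ⟨3, h.symm⟩]
  have h2 : Function.Bijective ![p, z, q, v] := hbij _ fun u => by
    rcases hmem u with h | h | h | h
    exacts [⟨3, h.symm⟩, ⟨0, h.symm⟩, ⟨1, h.symm⟩, ⟨2, h.symm⟩]
  have hpv' := hvp'.symm
  have hzp' := hpz'.symm
  have hqz' := hzq'.symm
  have hvq' := hqv'.symm
  have hzv := G.adj_comm z v
  have hqp := G.adj_comm q p
  by_cases hvz' : G.Adj v z <;> by_cases hpq' : G.Adj p q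
  · refine ⟨⟨4, K4⟩, by simp [calG4], nonempty_iso h1 fun a b => ?_⟩
    fin_cases a <;> fin_cases b <;> simp [K4, *]
  · refine ⟨⟨4, diamondGraph⟩, by simp [calG4], nonempty_iso h1 fun a b => ?_⟩
    fin_cases a <;> fin_cases b <;> simp [diamondGraph, *]
  · refine ⟨⟨4, diamondGraph⟩, by simp [calG4], nonempty_iso h2 fun a b => ?_⟩
    fin_cases a <;> fin_cases b <;> simp [diamondGraph, *]
  · refine ⟨⟨4, C4⟩, by simp [calG4], nonempty_iso h1 fun a b => ?_⟩
    fin_cases a <;> fin_cases b <;> simp [C4, SimpleGraph.cycleGraph_adj, *] <;> decide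

lemma Bad9.exists_iso (h : Bad9 G univ) : ∃ H ∈ calG9, Nonempty (G ≃g H.2) := by
  obtain ⟨H, hH, f, hf, hadj⟩ := h
  refine ⟨⟨9, H⟩, ?_, nonempty_iso ⟨f.injective, fun u => ?_⟩ hadj⟩
  · rcases hH with rfl | rfl | rfl | rfl | rfl | rfl <;> simp [calG9]
  · have := mem_univ u
    rw [← hf, mem_map] at this
    exact this.imp fun _ h => h.2

lemma Bad.exists_iso (h : Bad G univ) : ∃ H ∈ calE4, Nonempty (G ≃g H.2) := by
  rcases h with h | h
  · obtain ⟨H, hH, hi⟩ := h.exists_iso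
    exact ⟨H, .inl hH, hi⟩
  · obtain ⟨H, hH, hi⟩ := h.exists_iso
    exact ⟨H, .inr hH, hi⟩

lemma mem_closedNbhd {D : Finset V} {x : V} : x ∈ closedNbhd G D ↔ x ∈ nbhds G D := by
  rw [mem_nbhds]
  constructor
  · rintro (hx | ⟨u, hu, hux⟩)
    exacts [⟨x, hx, .inl rfl⟩, ⟨u, hu, .inr hux⟩]
  · rintro ⟨u, hu, rfl | hux⟩
    exacts [.inl hu, .inr ⟨u, hu, hux⟩]

lemma isIsolating_of_not_hasC4 {D : Finset V} (h : ¬ HasC4 G (univ \ nbhds G D)) :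
    IsIsolating C4 G D := by
  rintro ⟨f, hf⟩
  have hmem : ∀ i, (f i : V) ∈ univ \ nbhds G D := fun i =>
    mem_sdiff.mpr ⟨mem_univ _, fun hi => (f i).2 (mem_closedNbhd.mpr hi)⟩
  have hne : ∀ i j, i ≠ j → (f i : V) ≠ f j := fun i j hij hc => hij (f.injective (Subtype.ext hc))
  have hadj : ∀ i j, C4.Adj i j → G.Adj (f i) (f j) := fun i j hij => hf hij
  refine h ⟨f 0, f 1, f 2, f 3, hmem 0, hmem 1, hmem 2, hmem 3, hne 0 2 (by decide),
    hne 1 3 (by decide), hadj 0 1 ?_, hadj 1 2 ?_, hadj 2 3 ?_, hadj 3 0 ?_⟩ <;>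
  simp [C4, SimpleGraph.cycleGraph_adj]
  decide

end Conclusion

end SquareIsolation

/-- If `G` is a connected `n`-vertex graph that is not an `ℰ₄`-graph, then
`ι(G, C₄) ≤ ⌊n/5⌋`. -/
theorem stmt0 {V : Type*} [Fintype V] (G : SimpleGraph V) (hG : G.Connected)
    (hE : ∀ H ∈ calE4, ¬ Nonempty (G ≃g H.2)) :
    isolNum C4 G ≤ Fintype.card V / 5 := by
  obtain ⟨D, hD, hC⟩ := SquareIsolation.exists_isolating (SquareIsolation.conn_univ hG) fun h => by
    obtain ⟨H, hH, hi⟩ := h.exists_iso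
    exact hE H hH hi
  have hle : isolNum C4 G ≤ D.card :=
    Nat.sInf_le ⟨D, Set.ncard_coe_finset D, SquareIsolation.isIsolating_of_not_hasC4 hC⟩
  omega
end

section
/- For every natural number n ≥ 1, there exists a connected graph G on n vertices whose C_4-isolation number satisfies ι(G, C_4) = ⌊n/5⌋. -/
open SimpleGraph

/-- Vertices are grouped in consecutive blocks of five, the last block possibly incomplete. The
multiples of `5` form a clique, a complete block is a clique, and an incomplete block is a star
centred at its multiple of `5`. -/
def blockGraph (n : ℕ) : SimpleGraph (Fin n) where
  Adj u v := u ≠ v ∧ ((u.val % 5 = 0 ∧ v.val % 5 = 0) ∨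
    (u.val / 5 = v.val / 5 ∧ (u.val % 5 = 0 ∨ v.val % 5 = 0 ∨ u.val / 5 < n / 5)))
  symm := ⟨fun u v h => ⟨h.1.symm, by have := h.2; omega⟩⟩
  loopless := ⟨fun _ h => h.1 rfl⟩

theorem blockGraph_adj {n : ℕ} {u v : Fin n} : (blockGraph n).Adj u v ↔
    u.val ≠ v.val ∧ ((u.val % 5 = 0 ∧ v.val % 5 = 0) ∨
    (u.val / 5 = v.val / 5 ∧ (u.val % 5 = 0 ∨ v.val % 5 = 0 ∨ u.val / 5 < n / 5))) := by
  simp [blockGraph, Fin.ext_iff]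

theorem blockGraph_connected {n : ℕ} (hn : 1 ≤ n) : (blockGraph n).Connected := by
  have reachable_of_imp {u v : Fin n} (h : u.val ≠ v.val → (blockGraph n).Adj u v) :
      (blockGraph n).Reachable u v := by
    by_cases huv : u = v
    · exact huv ▸ Reachable.refl _
    · exact (h fun h' => huv (Fin.ext h')).reachable
  refine (connected_iff_exists_forall_reachable _).2 ⟨⟨0, hn⟩, fun v => ?_⟩
  have hv := v.isLt
  refine (reachable_of_imp (v := ⟨5 * (v.val / 5), by omega⟩) fun h => ?_).trans
    (reachable_of_imp fun h => ?_)
  all_goals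
    rw [blockGraph_adj]
    dsimp only at h ⊢
    omega

theorem exists_isIsolating_C4_blockGraph (n : ℕ) :
    ∃ D : Set (Fin n), D.ncard = n / 5 ∧ IsIsolating C4 (blockGraph n) D := by
  refine ⟨Set.range fun i : Fin (n / 5) => (⟨5 * i.val, by omega⟩ : Fin n), ?_, ?_⟩
  · rw [← Set.image_univ, Set.ncard_image_of_injective, Set.ncard_univ, Nat.card_fin]
    intro i j h
    simp only [Fin.mk.injEq] at h
    omega
  · rintro ⟨f, hf⟩
    have uncovered (a : Fin 4) : n / 5 ≤ (f a).val.val / 5 := by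
      by_contra! hlt
      refine (f a).property ?_
      by_cases h : (f a).val.val = 5 * ((f a).val.val / 5)
      · exact Or.inl ⟨⟨_, hlt⟩, Fin.ext h.symm⟩
      · refine Or.inr ⟨_, ⟨⟨_, hlt⟩, rfl⟩, blockGraph_adj.2 ?_⟩
        dsimp only
        omega
    have center {a b : Fin 4} (h : C4.Adj a b) :
        (f a).val.val = 5 * (n / 5) ∨ (f b).val.val = 5 * (n / 5) := by
      have hadj := blockGraph_adj.1 (comap_adj.1 (hf h))
      simp only [Function.Embedding.subtype_apply] at hadj
      have ha := uncovered a
      have hb := uncovered b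
      have := (f a).val.isLt
      have := (f b).val.isLt
      omega
    have eq_of_center {a b : Fin 4} (ha : (f a).val.val = 5 * (n / 5))
        (hb : (f b).val.val = 5 * (n / 5)) : a = b :=
      f.injective (Subtype.ext (Fin.ext (ha.trans hb.symm)))
    have h₁ : C4.Adj 0 1 := by unfold C4; decide
    have h₂ : C4.Adj 2 3 := by unfold C4; decide
    rcases center h₁ with h | h <;> rcases center h₂ with h' | h' <;>
      exact absurd (eq_of_center h h') (by decide)

theorem le_ncard_of_isIsolating_blockGraph {n : ℕ} {H : SimpleGraph (Fin 4)} {D : Set (Fin n)}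
    (hD : IsIsolating H (blockGraph n) D) : n / 5 ≤ D.ncard := by
  by_contra! hlt
  obtain ⟨i, hi, hiD⟩ : ∃ i < n / 5, ∀ u ∈ D, u.val / 5 ≠ i := by
    by_contra! h
    have hsub : (Finset.range (n / 5) : Set ℕ) ⊆ (fun u : Fin n => u.val / 5) '' D := by
      intro i hi
      exact h i (by simpa using hi)
    have := (Set.ncard_le_ncard hsub).trans (Set.ncard_image_le D.toFinite)
    rw [Set.ncard_coe_finset, Finset.card_range] at this
    omega
  have avoids (a : Fin 4) :
      (⟨5 * i + 1 + a.val, by omega⟩ : Fin n) ∈ (closedNbhd (blockGraph n) D)ᶜ := by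
    rintro (h | ⟨u, hu, h⟩)
    · refine hiD _ h ?_
      dsimp only
      omega
    · have := hiD u hu
      rw [blockGraph_adj] at h
      dsimp only at h
      omega
  refine hD ⟨⟨fun a => ⟨_, avoids a⟩, fun a b h => ?_⟩, fun a b h => ?_⟩
  · simp only [Subtype.mk.injEq, Fin.mk.injEq] at h
    omega
  · have hne : a.val ≠ b.val := fun h' => h.ne (Fin.ext h')
    change (blockGraph n).Adj ⟨5 * i + 1 + a.val, _⟩ ⟨5 * i + 1 + b.val, _⟩
    rw [blockGraph_adj]
    dsimp only
    omega

/-- For every `n ≥ 1` there is a connected `n`-vertex graph whose `C₄`-isolation number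
equals `⌊n/5⌋`. -/
theorem stmt1 (n : ℕ) (hn : 1 ≤ n) :
    ∃ G : SimpleGraph (Fin n), G.Connected ∧ isolNum C4 G = n / 5 := by
  have hmem := exists_isIsolating_C4_blockGraph n
  refine ⟨blockGraph n, blockGraph_connected hn, le_antisymm (Nat.sInf_le hmem) ?_⟩
  refine le_csInf ⟨_, hmem⟩ ?_
  rintro _ ⟨D, rfl, hD⟩
  exact le_ncard_of_isIsolating_blockGraph hD
end

section
/- If G is a graph, F is a set of graphs, X ⊆ V(G), and Y ⊆ N[X] (the closed neighbourhood of X in G), then ι(G, F) ≤ |X| + ι(G − Y, F). -/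
open SimpleGraph

theorem HasCopy.trans_hom {U V W : Type*} {H : SimpleGraph U} {G : SimpleGraph V}
    {K : SimpleGraph W} (h : HasCopy H G) (f : G →g K) (hf : Function.Injective f) :
    HasCopy H K := by
  obtain ⟨g, hg⟩ := h
  exact ⟨g.trans ⟨f, hf⟩, fun a b hab => f.map_rel (hg hab)⟩

/-- Extending an isolating set of `G - Y` by a set `X` whose closed neighbourhood contains `Y`
gives an isolating set of `G`. -/
theorem IsIsolatingFam.union_image_of_induce_compl {V : Type*} {G : SimpleGraph V}
    {F : Set ((n : ℕ) × SimpleGraph (Fin n))} {X Y : Set V} (hY : Y ⊆ closedNbhd G X)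
    {D : Set ↥(Yᶜ)} (hD : IsIsolatingFam F (G.induce Yᶜ) D) :
    IsIsolatingFam F G (X ∪ Subtype.val '' D) := by
  have hmem : ∀ v ∈ (closedNbhd G (X ∪ Subtype.val '' D))ᶜ, v ∈ Yᶜ := by
    intro v hv hvY
    refine hv ?_
    rcases hY hvY with hX | ⟨u, hu, huv⟩
    · exact Or.inl (Or.inl hX)
    · exact Or.inr ⟨u, Or.inl hu, huv⟩
  have hmem' : ∀ v (hv : v ∈ (closedNbhd G (X ∪ Subtype.val '' D))ᶜ),
      (⟨v, hmem v hv⟩ : ↥(Yᶜ)) ∈ (closedNbhd (G.induce Yᶜ) D)ᶜ := by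
    rintro v hv (h | ⟨u, hu, huv⟩)
    · exact hv (Or.inl (Or.inr ⟨_, h, rfl⟩))
    · exact hv (Or.inr ⟨u, Or.inr ⟨u, hu, rfl⟩, huv⟩)
  intro H hH hcopy
  refine hD H hH (hcopy.trans_hom
    ⟨fun v => ⟨⟨v.1, hmem v.1 v.2⟩, hmem' v.1 v.2⟩, fun {a b} hab => hab⟩ ?_)
  intro a b hab
  exact Subtype.ext (congrArg (fun x => x.1.1) hab)

/-- A graph contained in a graph without vertices is contained in every graph. -/
theorem HasCopy.of_isEmpty {U V W : Type*} {H : SimpleGraph U} {G : SimpleGraph V}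
    [IsEmpty V] (h : HasCopy H G) (K : SimpleGraph W) : HasCopy H K := by
  obtain ⟨g, -⟩ := h
  have : IsEmpty U := Function.isEmpty g
  exact ⟨Function.Embedding.ofIsEmpty, fun a => isEmptyElim a⟩

/-- If some graph has an isolating set, then the whole vertex set of any graph is isolating. -/
theorem IsIsolatingFam.univ_of_exists {V W : Type*} {F : Set ((n : ℕ) × SimpleGraph (Fin n))}
    {G : SimpleGraph V} {D : Set V} (hD : IsIsolatingFam F G D) (K : SimpleGraph W) :
    IsIsolatingFam F K Set.univ := by
  intro H hH hcopy
  have : IsEmpty ↥((closedNbhd K Set.univ)ᶜ) := ⟨fun v => v.2 (Or.inl trivial)⟩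
  exact hD H hH (hcopy.of_isEmpty _)

/-- If `X ⊆ V(G)` and `Y ⊆ N[X]`, then `ι(G, 𝓕) ≤ |X| + ι(G − Y, 𝓕)`. -/
theorem stmt2 {V : Type*} [Fintype V] (G : SimpleGraph V)
    (F : Set ((n : ℕ) × SimpleGraph (Fin n))) (X Y : Set V)
    (hY : Y ⊆ closedNbhd G X) :
    isolNumFam F G ≤ X.ncard + isolNumFam F (G.induce Yᶜ) := by
  unfold isolNumFam
  rcases Set.eq_empty_or_nonempty {k | ∃ D : Set V, D.ncard = k ∧ IsIsolatingFam F G D} with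
    h | ⟨_, D₀, -, hD₀⟩
  · simp [h]
  obtain ⟨D, hcard, hD⟩ :=
    Nat.sInf_mem (s := {k | ∃ D : Set ↥(Yᶜ), D.ncard = k ∧ IsIsolatingFam F (G.induce Yᶜ) D})
      ⟨_, Set.univ, rfl, hD₀.univ_of_exists _⟩
  rw [← hcard]
  calc sInf {k | ∃ D : Set V, D.ncard = k ∧ IsIsolatingFam F G D} ≤ (X ∪ Subtype.val '' D).ncard :=
        Nat.sInf_le ⟨_, rfl, hD.union_image_of_induce_compl hY⟩
    _ ≤ X.ncard + (Subtype.val '' D).ncard := Set.ncard_union_le _ _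
    _ = X.ncard + D.ncard := by rw [Set.ncard_image_of_injective _ Subtype.val_injective]
end
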